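/- For an integer p ≥ 2 let T_p : ℝ/ℤ → ℝ/ℤ be T_p(x) = p·x. Let p_1,…,p_d ≥ 2 be pairwise multiplicatively independent integers (log p_i / log p_j ∉ ℚ for all i ≠ j), let A_1,…,A_d ⊆ ℝ/ℤ be closed sets with T_{p_j}(A_j) ⊆ A_j, identified with subsets of [0,1) ⊂ ℝ, and set s = Σ_{j=1}^d hdim(A_j). Then for all affine maps g_1,…,g_d : ℝ → ℝ, ubdim( g_1(A_1) ∩ ⋯ ∩ g_d(A_d) ) ≤ max{ s − (d−1), 0 }. Moreover, for every ε > 0 and K ≥ 1 there is a constant C = C(ε,K) > 0 such that, if the absolute values of the slopes of the g_j are at most K, then |g_1(A_1) ∩ ⋯ ∩ g_d(A_d)|_δ ≤ C·δ^{−max{s−(d−1),0}−ε} for all 0 < δ ≤ 1. -/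

import Mathlib

open Filter Topology Set MeasureTheory
open scoped Pointwise ENNReal

noncomputable section

abbrev Euc (d : ℕ) := EuclideanSpace ℝ (Fin d)

/-- Half-open dyadic cube of generation `m` indexed by `k ∈ ℤ^d`. -/
def dyadicCube (d m : ℕ) (k : Fin d → ℤ) : Set (Euc d) :=
  {x | ∀ i, (k i : ℝ) / 2 ^ m ≤ x i ∧ x i < ((k i : ℝ) + 1) / 2 ^ m}

/-- A finite set is `δ`-separated. -/
def IsDeltaSep {X : Type*} [PseudoMetricSpace X] (F : Finset X) (δ : ℝ) : Prop :=
  ∀ a ∈ F, ∀ b ∈ F, a ≠ b → δ ≤ dist a b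

/-- `|E|_δ`: the packing number, i.e. the largest cardinality of a `δ`-separated subset. -/
def packingNumber {X : Type*} [PseudoMetricSpace X] (E : Set X) (δ : ℝ) : ℕ :=
  sSup {n : ℕ | ∃ F : Finset X, ↑F ⊆ E ∧ IsDeltaSep F δ ∧ F.card = n}

/-- Upper box dimension via packing numbers: `limsup_{δ→0⁺} log|E|_δ / log(1/δ)`. -/
def ubdim {X : Type*} [PseudoMetricSpace X] (E : Set X) : ℝ :=
  Filter.limsup (fun δ : ℝ => Real.log (packingNumber E δ) / Real.log (1 / δ))
    (nhdsWithin 0 (Set.Ioi 0))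

/-- The number of zero coordinates of a vector in `ℝ^d`. -/
def zeroCount {d : ℕ} (v : Euc d) : ℕ := {i : Fin d | v i = 0}.ncard

/-- `Z(π)`: the largest number of zero coordinates of a unit vector contained in `π`. -/
def Zzero {d : ℕ} (V : Submodule ℝ (Euc d)) : ℕ :=
  sSup {n : ℕ | ∃ v ∈ V, ‖v‖ = 1 ∧ zeroCount v = n}

/-- `Z_η(v)`: the number of coordinates of `v` of absolute value less than `η`. -/
def etaCount {d : ℕ} (η : ℝ) (v : Euc d) : ℕ := {i : Fin d | |v i| < η}.ncard

/-- `Z_η(π) = max{Z_η(v) : v ∈ π, |v| = 1}`. -/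
def Zeta {d : ℕ} (η : ℝ) (V : Submodule ℝ (Euc d)) : ℕ :=
  sSup {n : ℕ | ∃ v ∈ V, ‖v‖ = 1 ∧ etaCount η v = n}


namespace Furst
section Part1
section Entropy

variable {Ω Ω' α β γ : Type*} [Fintype Ω] [Fintype Ω']

open Classical in
/-- probability that `X = a`. -/
def pr (p : Ω → ℝ) (X : Ω → α) (a : α) : ℝ := ∑ ω, if X ω = a then p ω else 0

/-- Shannon entropy. -/
def ent (p : Ω → ℝ) (X : Ω → α) : ℝ := -∑ ω, p ω * Real.log (pr p X (X ω))

/-- Conditional Shannon entropy. -/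
def cent (p : Ω → ℝ) (X : Ω → α) (Z : Ω → β) : ℝ := ent p (fun ω => (X ω, Z ω)) - ent p Z

lemma pr_nonneg {p : Ω → ℝ} (hp : ∀ ω, 0 ≤ p ω) (X : Ω → α) (a : α) : 0 ≤ pr p X a := by
  classical
  unfold pr
  refine Finset.sum_nonneg fun ω _ => ?_
  split_ifs
  · exact hp ω
  · exact le_rfl

lemma le_pr {p : Ω → ℝ} (hp : ∀ ω, 0 ≤ p ω) (X : Ω → α) (ω : Ω) : p ω ≤ pr p X (X ω) := by
  classical
  unfold pr
  have := Finset.single_le_sum (f := fun ω' => if X ω' = X ω then p ω' else 0)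
    (fun ω' _ => by split_ifs; exacts [hp ω', le_rfl]) (Finset.mem_univ ω)
  simpa using this

lemma pr_pos {p : Ω → ℝ} (hp : ∀ ω, 0 ≤ p ω) (X : Ω → α) {ω : Ω} (h : p ω ≠ 0) :
    0 < pr p X (X ω) := lt_of_lt_of_le (lt_of_le_of_ne (hp ω) h.symm) (le_pr hp X ω)

lemma pr_mono {p : Ω → ℝ} (hp : ∀ ω, 0 ≤ p ω) {X : Ω → α} {Y : Ω → β} (ω : Ω)
    (h : ∀ ω', X ω' = X ω → Y ω' = Y ω) : pr p X (X ω) ≤ pr p Y (Y ω) := by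
  classical
  unfold pr
  refine Finset.sum_le_sum fun ω' _ => ?_
  by_cases hx : X ω' = X ω
  · simp [hx, h ω' hx]
  · simp only [hx, if_false]; split_ifs; exacts [hp ω', le_rfl]

lemma pr_le_one {p : Ω → ℝ} (hp : ∀ ω, 0 ≤ p ω) (h1 : ∑ ω, p ω = 1) (X : Ω → α) (a : α) :
    pr p X a ≤ 1 := by
  classical
  rw [← h1]; unfold pr
  refine Finset.sum_le_sum fun ω _ => ?_
  split_ifs; exacts [le_rfl, hp ω]

lemma ent_nonneg {p : Ω → ℝ} (hp : ∀ ω, 0 ≤ p ω) (h1 : ∑ ω, p ω = 1) (X : Ω → α) :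
    0 ≤ ent p X := by
  unfold ent
  rw [neg_nonneg]
  refine Finset.sum_nonpos fun ω _ => mul_nonpos_of_nonneg_of_nonpos (hp ω) ?_
  exact Real.log_nonpos (pr_nonneg hp _ _) (pr_le_one hp h1 _ _)

lemma ent_mono {p : Ω → ℝ} (hp : ∀ ω, 0 ≤ p ω) {X : Ω → α} {Y : Ω → β}
    (h : ∀ ω ω', X ω = X ω' → Y ω = Y ω') : ent p Y ≤ ent p X := by
  unfold ent
  rw [neg_le_neg_iff]
  refine Finset.sum_le_sum fun ω _ => ?_
  by_cases h0 : p ω = 0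
  · simp [h0]
  · refine mul_le_mul_of_nonneg_left ?_ (hp ω)
    exact Real.log_le_log (pr_pos hp X h0) (pr_mono hp ω fun ω' => h ω' ω)

lemma ent_congr {p : Ω → ℝ} (hp : ∀ ω, 0 ≤ p ω) {X : Ω → α} {Y : Ω → β}
    (h : ∀ ω ω', X ω = X ω' ↔ Y ω = Y ω') : ent p X = ent p Y :=
  le_antisymm (ent_mono hp fun ω ω' => (h ω ω').2) (ent_mono hp fun ω ω' => (h ω ω').1)

lemma sum_pr (p : Ω → ℝ) (φ : Ω → Ω') (g : Ω' → ℝ) :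
    ∑ a, pr p φ a * g a = ∑ ω, p ω * g (φ ω) := by
  classical
  unfold pr
  simp_rw [Finset.sum_mul]
  rw [Finset.sum_comm]
  refine Finset.sum_congr rfl fun ω _ => ?_
  simp [ite_mul]

lemma pr_comp {p : Ω → ℝ} {p' : Ω' → ℝ} {φ : Ω → Ω'} (h : ∀ a, p' a = pr p φ a) (X : Ω' → α)
    (a : α) : pr p' X a = pr p (fun ω => X (φ ω)) a := by
  classical
  have := sum_pr p φ (fun b => if X b = a then 1 else 0)
  simp only [mul_ite, mul_one, mul_zero] at this
  unfold pr at this ⊢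
  rw [← this]
  refine Finset.sum_congr rfl fun b _ => ?_
  rw [h b]; rfl

lemma ent_map {p : Ω → ℝ} {p' : Ω' → ℝ} {φ : Ω → Ω'} (h : ∀ a, p' a = pr p φ a) (X : Ω' → α) :
    ent p (fun ω => X (φ ω)) = ent p' X := by
  unfold ent
  have : ∀ a, p' a * Real.log (pr p' X (X a)) = pr p φ a * Real.log (pr p' X (X a)) := by
    intro a; rw [h]
  simp_rw [this]
  rw [sum_pr p φ (fun a => Real.log (pr p' X (X a)))]
  simp_rw [pr_comp h]

lemma cent_map {p : Ω → ℝ} {p' : Ω' → ℝ} {φ : Ω → Ω'} (h : ∀ a, p' a = pr p φ a) (X : Ω' → α)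
    (Z : Ω' → β) : cent p (fun ω => X (φ ω)) (fun ω => Z (φ ω)) = cent p' X Z := by
  unfold cent
  rw [← ent_map h Z, ← ent_map h (fun a => (X a, Z a))]

open Classical in
/-- Gibbs inequality, conditional version. -/
lemma gibbs {p : Ω → ℝ} (hp : ∀ ω, 0 ≤ p ω) (h1 : ∑ ω, p ω = 1) (X : Ω → α) (Z : Ω → β)
    (q : Ω → ℝ) (hq0 : ∀ ω, p ω ≠ 0 → 0 < q ω)
    (hsum : ∀ z, ∑ ω, (if Z ω = z then p ω * q ω / pr p (fun ω => (X ω, Z ω)) (X ω, Z ω) else 0) ≤ 1) :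
    cent p X Z ≤ -∑ ω, p ω * Real.log (q ω) := by
  have key : ∑ ω, p ω * (Real.log (pr p Z (Z ω)) + Real.log (q ω)
      - Real.log (pr p (fun ω => (X ω, Z ω)) (X ω, Z ω))) ≤ 0 := by
    have e1 : ∀ ω, p ω * (Real.log (pr p Z (Z ω)) + Real.log (q ω)
      - Real.log (pr p (fun ω => (X ω, Z ω)) (X ω, Z ω))) ≤
      p ω * q ω / pr p (fun ω => (X ω, Z ω)) (X ω, Z ω) * pr p Z (Z ω) - p ω := by
      intro ω
      by_cases h0 : p ω = 0
      · simp [h0]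
      · have a1 := pr_pos hp Z h0
        have a2 := pr_pos hp (fun ω => (X ω, Z ω)) h0
        have a3 := hq0 ω h0
        have : Real.log (pr p Z (Z ω)) + Real.log (q ω)
          - Real.log (pr p (fun ω => (X ω, Z ω)) (X ω, Z ω)) =
          Real.log (pr p Z (Z ω) * q ω / pr p (fun ω => (X ω, Z ω)) (X ω, Z ω)) := by
          rw [Real.log_div (by positivity) (by positivity), Real.log_mul (by positivity) (by positivity)]
        rw [this]
        have a4 := Real.log_le_sub_one_of_pos
          (show 0 < pr p Z (Z ω) * q ω / pr p (fun ω => (X ω, Z ω)) (X ω, Z ω) by positivity)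
        calc _ ≤ p ω * (pr p Z (Z ω) * q ω / pr p (fun ω => (X ω, Z ω)) (X ω, Z ω) - 1) :=
              mul_le_mul_of_nonneg_left a4 (hp ω)
          _ = _ := by ring
    refine (Finset.sum_le_sum fun ω _ => e1 ω).trans ?_
    rw [Finset.sum_sub_distrib, h1, sub_nonpos]
    have e2 : ∀ ω, p ω * q ω / pr p (fun ω => (X ω, Z ω)) (X ω, Z ω) * pr p Z (Z ω) =
      ∑ ω0, p ω0 * (if Z ω = Z ω0 then p ω * q ω / pr p (fun ω => (X ω, Z ω)) (X ω, Z ω) else 0) := by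
      intro ω
      conv_lhs => rw [show pr p Z (Z ω) = ∑ ω0, if Z ω0 = Z ω then p ω0 else 0 from rfl, Finset.mul_sum]
      refine Finset.sum_congr rfl fun ω0 _ => ?_
      by_cases h : Z ω = Z ω0
      · simp [h, mul_comm]
      · simp [h, Ne.symm h]
    simp_rw [e2]
    rw [Finset.sum_comm]
    simp_rw [← Finset.mul_sum]
    calc _ ≤ ∑ ω0, p ω0 * 1 := Finset.sum_le_sum fun ω0 _ =>
          mul_le_mul_of_nonneg_left (hsum (Z ω0)) (hp ω0)
      _ = 1 := by simpa using h1
  unfold cent ent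
  simp only [mul_sub, mul_add, Finset.sum_sub_distrib, Finset.sum_add_distrib] at key
  linarith

open Classical in
lemma sum_image_bound {p : Ω → ℝ} (X : Ω → α) (Z : Ω → β) (z : β)
    (g : α → ℝ) (hg : ∀ a, 0 ≤ g a) :
    ∑ ω, (if Z ω = z then p ω * g (X ω) / pr p (fun ω => (X ω, Z ω)) (X ω, Z ω) else 0) ≤
      ∑ a ∈ (Finset.univ.filter (fun ω => Z ω = z)).image X, g a := by
  rw [← Finset.sum_filter]
  rw [← Finset.sum_fiberwise_of_maps_to
    (t := (Finset.univ.filter (fun ω => Z ω = z)).image X) (g := X)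
    (fun i hi => Finset.mem_image_of_mem X hi)]
  refine Finset.sum_le_sum fun a _ => ?_
  have : ∀ ω ∈ ((Finset.univ.filter (fun ω => Z ω = z)).filter (fun ω => X ω = a)),
      p ω * g (X ω) / pr p (fun ω => (X ω, Z ω)) (X ω, Z ω) =
      p ω * (g a / pr p (fun ω => (X ω, Z ω)) (a, z)) := by
    intro ω hω
    simp only [Finset.mem_filter, Finset.mem_univ, true_and] at hω
    rw [hω.1, hω.2]; ring
  rw [Finset.sum_congr rfl this, ← Finset.sum_mul]
  have e : ∑ ω ∈ ((Finset.univ.filter (fun ω => Z ω = z)).filter (fun ω => X ω = a)), p ω =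
      pr p (fun ω => (X ω, Z ω)) (a, z) := by
    rw [Finset.filter_filter, Finset.sum_filter, pr]
    refine Finset.sum_congr rfl fun ω _ => ?_
    simp [Prod.ext_iff, and_comm]
  rw [e]
  by_cases h0 : pr p (fun ω => (X ω, Z ω)) (a, z) = 0
  · simp [h0, hg a]
  · rw [mul_div_cancel₀ _ h0]

/-- Conditioning on more reduces entropy. -/
lemma cent_anti {p : Ω → ℝ} (hp : ∀ ω, 0 ≤ p ω) (h1 : ∑ ω, p ω = 1) (X : Ω → α) {Z : Ω → β}
    {Z' : Ω → γ} (h : ∀ ω ω', Z' ω = Z' ω' → Z ω = Z ω') : cent p X Z' ≤ cent p X Z := by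
  classical
  have hc : cent p X Z = -∑ ω, p ω * Real.log (pr p (fun ω => (X ω, Z ω)) (X ω, Z ω) / pr p Z (Z ω)) := by
    unfold cent ent
    have : ∀ ω, p ω * Real.log (pr p (fun ω => (X ω, Z ω)) (X ω, Z ω) / pr p Z (Z ω)) =
      p ω * Real.log (pr p (fun ω => (X ω, Z ω)) (X ω, Z ω)) - p ω * Real.log (pr p Z (Z ω)) := by
      intro ω
      by_cases h0 : p ω = 0
      · simp [h0]
      · rw [Real.log_div (pr_pos hp _ h0).ne' (pr_pos hp _ h0).ne']; ring
    simp_rw [this]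
    rw [Finset.sum_sub_distrib]; ring
  rw [hc]
  refine gibbs hp h1 X Z' _
    (fun ω h0 => div_pos (pr_pos hp (fun ω => (X ω, Z ω)) h0) (pr_pos hp _ h0)) ?_
  intro z'
  by_cases hz : ∃ ω0, Z' ω0 = z'
  swap
  · push Not at hz
    simp [hz]
  obtain ⟨ω0, hω0⟩ := hz
  let g : α → ℝ := fun a => pr p (fun ω => (X ω, Z ω)) (a, Z ω0) / pr p Z (Z ω0)
  have hg : ∀ a, 0 ≤ g a := fun a => div_nonneg (pr_nonneg hp _ _) (pr_nonneg hp _ _)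
  have e : ∀ ω, (if Z' ω = z' then p ω * (pr p (fun ω => (X ω, Z ω)) (X ω, Z ω) / pr p Z (Z ω))
      / pr p (fun ω => (X ω, Z' ω)) (X ω, Z' ω) else 0) =
      (if Z' ω = z' then p ω * g (X ω)
      / pr p (fun ω => (X ω, Z' ω)) (X ω, Z' ω) else 0) := by
    intro ω
    by_cases hh : Z' ω = z'
    · have : Z ω = Z ω0 := h _ _ (hh.trans hω0.symm)
      simp only [hh, this, if_true, g]
    · simp only [hh, if_false]
  rw [Finset.sum_congr rfl fun ω _ => e ω]
  have := sum_image_bound (p := p) X Z' z' g hg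
  refine this.trans ?_
  dsimp only [g]
  rw [← Finset.sum_div]
  refine div_le_one_of_le₀ ?_ (pr_nonneg hp _ _)
  unfold pr
  rw [Finset.sum_comm]
  refine Finset.sum_le_sum fun ω _ => ?_
  by_cases hh : Z ω = Z ω0
  · simp only [Prod.mk.injEq, hh, and_true, if_true]
    rw [Finset.sum_ite_eq]
    split_ifs; exacts [le_rfl, hp ω]
  · simp [hh]

open Classical in
/-- indicator of a proposition -/
def indi (P : Prop) : ℝ := if P then 1 else 0

lemma indi_pos {P : Prop} (h : P) : indi P = 1 := by simp [indi, h]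
lemma indi_neg {P : Prop} (h : ¬ P) : indi P = 0 := by simp [indi, h]
lemma indi_nonneg (P : Prop) : 0 ≤ indi P := by
  by_cases h : P
  · simp [indi, h]
  · simp [indi, h]
lemma indi_le_one (P : Prop) : indi P ≤ 1 := by
  by_cases h : P
  · simp [indi, h]
  · simp [indi, h]

lemma card_image_le_of (X : Ω → α) (Q : Ω → Prop) (U : Finset α) (L : ℝ)
    (hU : ∀ a ∈ U, ∃ ω, Q ω ∧ X ω = a)
    (hc : ∀ S : Finset Ω, (∀ ω ∈ S, Q ω) → Set.InjOn X S → (S.card : ℝ) ≤ L) :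
    (U.card : ℝ) ≤ L := by
  classical
  rcases isEmpty_or_nonempty Ω with hΩ | hΩ
  · have : U = ∅ := Finset.eq_empty_of_forall_notMem fun a ha => by
      obtain ⟨ω, _⟩ := hU a ha
      exact hΩ.elim ω
    rw [this]
    simpa using hc ∅ (by simp) (by simp)
  choose! f hf using hU
  have hinj : Set.InjOn f U := fun a ha b hb hab => by
    rw [← (hf a ha).2, ← (hf b hb).2, hab]
  have h1 : ((U.image f).card : ℝ) ≤ L := by
    refine hc _ ?_ ?_
    · intro ω hω
      obtain ⟨a, ha, rfl⟩ := Finset.mem_image.1 hω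
      exact (hf a ha).1
    · intro ω hω ω' hω' hX
      obtain ⟨a, ha, rfl⟩ := Finset.mem_image.1 (Finset.mem_coe.1 hω)
      obtain ⟨b, hb, rfl⟩ := Finset.mem_image.1 (Finset.mem_coe.1 hω')
      rw [(hf a ha).2, (hf b hb).2] at hX
      rw [hX]
  rwa [Finset.card_image_of_injOn hinj] at h1

/-- Counting bound with a bound depending on the conditioning value. -/
lemma cent_le_log_var {p : Ω → ℝ} (hp : ∀ ω, 0 ≤ p ω) (h1 : ∑ ω, p ω = 1) (X : Ω → α) (Z : Ω → β)
    (K : β → ℝ) (hK : ∀ z, 0 < K z)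
    (hG' : ∀ z, ∀ S : Finset Ω, (∀ ω ∈ S, Z ω = z) → Set.InjOn X S → (S.card : ℝ) ≤ K z) :
    cent p X Z ≤ ∑ ω, p ω * Real.log (K (Z ω)) := by
  classical
  have hG : ∀ z, (((Finset.univ.filter (fun ω => Z ω = z)).image X).card : ℝ) ≤ K z := by
    intro z
    refine card_image_le_of X (fun ω => Z ω = z) _ (K z) ?_ (hG' z)
    intro a ha
    simpa using ha
  have hgi := gibbs hp h1 X Z (fun ω => 1 / K (Z ω)) (fun ω _ => by have := hK (Z ω); positivity) ?_
  · refine hgi.trans (le_of_eq ?_)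
    rw [← Finset.sum_neg_distrib]
    refine Finset.sum_congr rfl fun ω _ => ?_
    rw [one_div, Real.log_inv]
    ring
  · intro z
    have e : ∀ ω, (if Z ω = z then p ω * (1 / K (Z ω)) / pr p (fun ω => (X ω, Z ω)) (X ω, Z ω) else 0)
      = (if Z ω = z then p ω * (1 / K z) / pr p (fun ω => (X ω, Z ω)) (X ω, Z ω) else 0) := by
      intro ω
      by_cases h : Z ω = z <;> simp [h]
    rw [Finset.sum_congr rfl fun ω _ => e ω]
    have hKz := hK z
    refine (sum_image_bound X Z z (fun _ => 1 / K z) (fun _ => by positivity)).trans ?_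
    rw [Finset.sum_const, nsmul_eq_mul, mul_one_div]
    exact div_le_one_of_le₀ (hG z) hKz.le

lemma cent_le_log {p : Ω → ℝ} (hp : ∀ ω, 0 ≤ p ω) (h1 : ∑ ω, p ω = 1) (X : Ω → α) (Z : Ω → β)
    (K : ℝ) (hK : 0 < K)
    (hG' : ∀ z, ∀ S : Finset Ω, (∀ ω ∈ S, Z ω = z) → Set.InjOn X S → (S.card : ℝ) ≤ K) :
    cent p X Z ≤ Real.log K := by
  refine (cent_le_log_var hp h1 X Z (fun _ => K) (fun _ => hK) hG').trans (le_of_eq ?_)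
  rw [← Finset.sum_mul, h1, one_mul]

lemma ent_unit {p : Ω → ℝ} (h1 : ∑ ω, p ω = 1) : ent p (fun _ => ()) = 0 := by
  classical
  simp [ent, pr, h1]

lemma ent_eq_cent {p : Ω → ℝ} (hp : ∀ ω, 0 ≤ p ω) (h1 : ∑ ω, p ω = 1) (X : Ω → α) :
    ent p X = cent p X (fun _ => ()) := by
  unfold cent
  rw [ent_unit h1, sub_zero]
  exact ent_congr hp (by simp)

lemma cent_le_ent {p : Ω → ℝ} (hp : ∀ ω, 0 ≤ p ω) (h1 : ∑ ω, p ω = 1) (X : Ω → α) (Z : Ω → β) :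
    cent p X Z ≤ ent p X := by
  rw [ent_eq_cent hp h1]
  exact cent_anti hp h1 X (by simp)

lemma cent_nonneg {p : Ω → ℝ} (hp : ∀ ω, 0 ≤ p ω) (X : Ω → α) (Z : Ω → β) : 0 ≤ cent p X Z := by
  unfold cent
  rw [sub_nonneg]
  exact ent_mono hp (by simp)

lemma cent_mono {p : Ω → ℝ} (hp : ∀ ω, 0 ≤ p ω) {X : Ω → α} {Y : Ω → γ} (Z : Ω → β)
    (h : ∀ ω ω', Z ω = Z ω' → X ω = X ω' → Y ω = Y ω') : cent p Y Z ≤ cent p X Z := by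
  unfold cent
  refine sub_le_sub_right (ent_mono hp ?_) _
  simp only [Prod.mk.injEq]
  exact fun ω ω' hh => ⟨h ω ω' hh.2 hh.1, hh.2⟩

lemma cent_chain {p : Ω → ℝ} (hp : ∀ ω, 0 ≤ p ω) (X : Ω → α) (Y : Ω → γ) (Z : Ω → β) :
    cent p (fun ω => (X ω, Y ω)) Z = cent p X Z + cent p Y (fun ω => (X ω, Z ω)) := by
  unfold cent
  have : ent p (fun ω => ((X ω, Y ω), Z ω)) = ent p (fun ω => (Y ω, (X ω, Z ω))) :=
    ent_congr hp (by simp; tauto)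
  rw [this]; ring

/-- subadditivity for finite families -/
lemma cent_pi {p : Ω → ℝ} (hp : ∀ ω, 0 ≤ p ω) (h1 : ∑ ω, p ω = 1) (X : ℕ → Ω → α) (Z : Ω → β)
    (R : ℕ) : cent p (fun ω => fun j : Fin R => X j ω) Z ≤ ∑ j ∈ Finset.range R, cent p (X j) Z := by
  induction R with
  | zero =>
    simp only [Finset.range_zero, Finset.sum_empty]
    unfold cent
    rw [sub_nonpos]
    refine ent_mono hp ?_
    intro ω ω' h
    simp only [Prod.mk.injEq]
    exact ⟨funext fun j => j.elim0, h⟩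
  | succ R ih =>
    rw [Finset.sum_range_succ]
    have e1 : cent p (fun ω => fun j : Fin (R+1) => X j ω) Z ≤
        cent p (fun ω => ((fun j : Fin R => X j ω), X R ω)) Z := by
      refine cent_mono hp Z ?_
      intro ω ω' _ h
      simp only [Prod.mk.injEq] at h
      funext j
      refine Fin.lastCases ?_ (fun i => ?_) j
      · simpa using h.2
      · have := congrFun h.1 i
        simpa using this
    refine e1.trans ?_
    rw [cent_chain hp]
    refine add_le_add ih (cent_anti hp h1 _ ?_)
    simp

/-- Counting bound with finitely many classes. -/
lemma cent_cls {ι : Type*} [Fintype ι] [Nonempty ι] {p : Ω → ℝ} (hp : ∀ ω, 0 ≤ p ω) (h1 : ∑ ω, p ω = 1)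
    (X : Ω → α) (Z : Ω → β) (cls : Ω → ι) (K : ι → ℝ) (hK : ∀ c, 0 < K c)
    (hcount : ∀ z c, ∀ S : Finset Ω, (∀ ω ∈ S, Z ω = z ∧ cls ω = c) → Set.InjOn X S →
      (S.card : ℝ) ≤ K c) :
    cent p X Z ≤ Real.log (Fintype.card ι) + ∑ ω, p ω * Real.log (K (cls ω)) := by
  have a1 : cent p X Z ≤ cent p (fun ω => (cls ω, X ω)) Z :=
    cent_mono hp Z (fun ω ω' _ h => (Prod.ext_iff.1 h).2)
  rw [cent_chain hp] at a1
  have a2 : cent p cls Z ≤ Real.log (Fintype.card ι) := by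
    refine cent_le_log hp h1 cls Z _ (by exact_mod_cast Fintype.card_pos) ?_
    intro z S _ hinj
    classical
    rw [← Finset.card_image_of_injOn hinj]
    exact_mod_cast Finset.card_le_univ _
  have a3 : cent p X (fun ω => (cls ω, Z ω)) ≤ ∑ ω, p ω * Real.log (K (cls ω)) := by
    refine cent_le_log_var hp h1 X (fun ω => (cls ω, Z ω)) (fun z => K z.1) (fun z => hK z.1) ?_
    intro z S hS hinj
    exact hcount z.2 z.1 S (fun ω hω => by rw [← hS ω hω]; exact ⟨rfl, rfl⟩) hinj
  linarith

end Entropy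
end Part1

section Part2
/-- The dynamical data. -/
structure Sys (d : ℕ) where
  p : Fin d → ℕ
  hp : ∀ i, 2 ≤ p i
  A : Fin d → Set ℝ
  hA : ∀ i, A i ⊆ Set.Ico 0 1
  hinv : ∀ i, ∀ x ∈ A i, Int.fract ((p i : ℝ) * x) ∈ A i

lemma fract_mul_fract (a : ℤ) (y : ℝ) : Int.fract ((a : ℝ) * Int.fract y) = Int.fract ((a : ℝ) * y) := by
  have : (a : ℝ) * y = (a : ℝ) * Int.fract y + ((a * ⌊y⌋ : ℤ) : ℝ) := by
    push_cast
    rw [← mul_add, Int.fract_add_floor]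
  rw [this, Int.fract_add_intCast]

lemma Sys.hpow {d : ℕ} (S : Sys d) (i : Fin d) (l : ℕ) (x : ℝ) (hx : x ∈ S.A i) :
    Int.fract (((S.p i : ℝ) ^ l) * x) ∈ S.A i := by
  induction l with
  | zero =>
    have := S.hA i hx
    rw [pow_zero, one_mul, Int.fract_eq_self.2 ⟨this.1, this.2⟩]
    exact hx
  | succ l ih =>
    have h2 := S.hinv i _ ih
    have := fract_mul_fract (S.p i) ((S.p i : ℝ) ^ l * x)
    push_cast at this
    rw [this] at h2
    rw [pow_succ']
    rwa [← mul_assoc] at h2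

/-- polynomial evaluation -/
def pe {d k : ℕ} (v : Fin d → ℝ) (P : Fin k → ℝ) (i : Fin d) : ℝ := ∑ j, P j * v i ^ (j : ℕ)

lemma pe_smul {d k : ℕ} (v : Fin d → ℝ) (P : Fin k → ℝ) (i : Fin d) (a : ℝ) :
    pe v (fun j => a * P j) i = a * pe v P i := by
  simp [pe, Finset.mul_sum, mul_assoc]

lemma pe_sub {d k : ℕ} (v : Fin d → ℝ) (P Q : Fin k → ℝ) (i : Fin d) :
    pe v (fun j => P j - Q j) i = pe v P i - pe v Q i := by
  simp [pe, sub_mul, Finset.sum_sub_distrib]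

/-- A finite separated set in `∏ A_i` near a twisted `k`-plane. -/
def IsSlice {d : ℕ} (S : Sys d) (v : Fin d → ℝ) (k n : ℕ) (E : Finset (Fin d → ℝ)) : Prop :=
  (∀ x ∈ E, ∀ i, x i ∈ S.A i) ∧
  (∃ b c : Fin d → ℝ, (∀ i, 1 ≤ |c i| ∧ |c i| ≤ S.p i) ∧
    ∀ x ∈ E, ∃ P : Fin k → ℝ, ∀ i, |x i - b i - c i * pe v P i| ≤ (1 / 2 : ℝ) ^ n) ∧
  (∀ x ∈ E, ∀ y ∈ E, x ≠ y → ∃ i, (1 / 2 : ℝ) ^ n ≤ |x i - y i|)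

/-- uniform bound on slices with exponent `β`. -/
def UB {d : ℕ} (S : Sys d) (v : Fin d → ℝ) (k : ℕ) (β : ℝ) : Prop :=
  ∃ K : ℝ, 0 < K ∧ ∀ n E, IsSlice S v k n E → (E.card : ℝ) ≤ K * (2 : ℝ) ^ (β * n)

lemma pigeon {α β : Type*} [DecidableEq β] (E : Finset α) (f : α → β) (T : Finset β)
    (h : ∀ x ∈ E, f x ∈ T) (hE : E.Nonempty) :
    ∃ b ∈ T, (E.card : ℝ) ≤ T.card * ((E.filter (fun x => f x = b)).card : ℝ) := by
  have hT : T.Nonempty := by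
    obtain ⟨x, hx⟩ := hE
    exact ⟨f x, h x hx⟩
  by_contra hcon
  push Not at hcon
  have h1 : E.card = ∑ b ∈ T, (E.filter (fun x => f x = b)).card :=
    Finset.card_eq_sum_card_fiberwise h
  have h2 : ∑ b ∈ T, ((T.card : ℝ) * ((E.filter (fun x => f x = b)).card : ℝ)) < ∑ b ∈ T, (E.card : ℝ) :=
    Finset.sum_lt_sum_of_nonempty hT fun b hb => hcon b hb
  rw [← Finset.mul_sum, ← Nat.cast_sum, ← h1, Finset.sum_const, nsmul_eq_mul] at h2
  exact lt_irrefl _ h2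

lemma exists_scale (p : ℕ) (hp : 2 ≤ p) (c : ℝ) (h0 : 0 < |c|) (h1 : |c| ≤ 1) :
    ∃ l : ℕ, 1 ≤ |(p : ℝ) ^ l * c| ∧ |(p : ℝ) ^ l * c| ≤ p := by
  have hp1 : (1 : ℝ) < p := by exact_mod_cast hp
  obtain ⟨l, hl1, hl2⟩ := exists_nat_pow_near (x := 1 / |c|) (y := (p : ℝ))
    (by rw [le_div_iff₀ h0]; linarith) hp1
  refine ⟨l + 1, ?_, ?_⟩
  · rw [abs_mul, abs_of_pos (by positivity)]
    rw [div_lt_iff₀ h0] at hl2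
    exact hl2.le
  · rw [abs_mul, abs_of_pos (by positivity)]
    rw [le_div_iff₀ h0] at hl1
    rw [pow_succ]
    nlinarith

lemma floor_range {a b M : ℝ} (h : |a - b| ≤ M) : ⌊a⌋ - ⌊b⌋ ∈ Finset.Icc (-(⌈M⌉ + 1)) (⌈M⌉ + 1) := by
  rw [abs_le] at h
  have h1 := Int.floor_le a
  have h2 := Int.lt_floor_add_one a
  have h3 := Int.floor_le b
  have h4 := Int.lt_floor_add_one b
  have h5 := Int.le_ceil M
  rw [Finset.mem_Icc]
  constructor
  · have : (-(⌈M⌉ + 1) : ℝ) - 1 < ((⌊a⌋ - ⌊b⌋ : ℤ) : ℝ) := by push_cast; linarith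
    have h6 : (((-(⌈M⌉ + 1) - 1 : ℤ)) : ℝ) < ((⌊a⌋ - ⌊b⌋ : ℤ) : ℝ) := by push_cast at this ⊢; linarith
    have := Int.cast_lt.1 h6
    omega
  · have h6 : ((⌊a⌋ - ⌊b⌋ : ℤ) : ℝ) < ((⌈M⌉ + 1 + 1 : ℤ) : ℝ) := by push_cast; linarith
    have := Int.cast_lt.1 h6
    omega

/-- Magnification lemma. -/
lemma magnify {d : ℕ} (S : Sys d) (v : Fin d → ℝ) (k : ℕ) (Λ : ℝ) (hΛ : 1 ≤ Λ) :
    ∃ Kc : ℝ, 0 < Kc ∧ ∀ (n : ℕ) (E : Finset (Fin d → ℝ)) (x0 b c : Fin d → ℝ),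
      (∀ x ∈ E, ∀ i, x i ∈ S.A i) → (∀ i, 0 < |c i| ∧ |c i| ≤ Λ) →
      (∀ x ∈ E, ∀ i, |x i - x0 i| ≤ Λ * |c i|) →
      (∀ x ∈ E, ∃ P : Fin k → ℝ, ∀ i, |x i - b i - c i * pe v P i| ≤ Λ * |c i| * (1 / 2 : ℝ) ^ n) →
      (∀ x ∈ E, ∀ y ∈ E, x ≠ y → ∃ i, |c i| * (1 / 2 : ℝ) ^ n ≤ Λ * |x i - y i|) →
      ∃ E', IsSlice S v k n E' ∧ (E.card : ℝ) ≤ Kc * E'.card := by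
  classical
  let I : Fin d → Finset ℤ := fun i => Finset.Icc (-(⌈Λ ^ 2 * S.p i⌉ + 1)) (⌈Λ ^ 2 * S.p i⌉ + 1)
  let T : Finset ((Fin d → ℤ) × (Fin d → ℤ)) := (Fintype.piFinset I) ×ˢ (Fintype.piFinset I)
  refine ⟨(T.card : ℝ) + 1, by positivity, ?_⟩
  intro n E x0 b c hEA hc hx0 hP hsep
  rcases E.eq_empty_or_nonempty with rfl | hE
  · refine ⟨∅, ⟨by simp, ⟨0, fun i => 1, fun i => ?_, by simp⟩, by simp⟩, by simp⟩
    have := S.hp i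
    simp
    omega
  have hΛ0 : 0 < Λ := by linarith
  have hs : ∀ i, ∃ l : ℕ, 1 ≤ |(S.p i : ℝ) ^ l * (c i / Λ)| ∧ |(S.p i : ℝ) ^ l * (c i / Λ)| ≤ S.p i := by
    intro i
    refine exists_scale (S.p i) (S.hp i) (c i / Λ) ?_ ?_
    · rw [abs_div, abs_of_pos hΛ0]; exact div_pos (hc i).1 hΛ0
    · rw [abs_div, abs_of_pos hΛ0]; exact div_le_one_of_le₀ (hc i).2 hΛ0.le
  choose l hl1 hl2 using hs
  choose! P hP using hP
  let q : Fin d → ℝ := fun i => (S.p i : ℝ) ^ l i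
  have hq : ∀ i, 0 < q i := fun i => by
    have := S.hp i
    positivity
  have hcl : ∀ i, q i * |c i| ≤ Λ * S.p i := by
    intro i
    have := hl2 i
    rw [abs_mul, abs_div, abs_of_pos hΛ0, abs_of_pos (hq i)] at this
    rw [← mul_div_assoc, div_le_iff₀ hΛ0] at this
    linarith
  have hcl1 : ∀ i, Λ ≤ q i * |c i| := by
    intro i
    have := hl1 i
    rw [abs_mul, abs_div, abs_of_pos hΛ0, abs_of_pos (hq i)] at this
    rw [← mul_div_assoc, le_div_iff₀ hΛ0] at this
    linarith
  let e : (Fin d → ℝ) → Fin d → ℝ := fun x i => q i * (x i - b i - c i * pe v (P x) i)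
  let F : (Fin d → ℝ) → (Fin d → ℤ) × (Fin d → ℤ) := fun x =>
    (fun i => ⌊q i * x i⌋ - ⌊q i * x0 i⌋, fun i => ⌊(2 : ℝ) ^ n * e x i⌋ - ⌊(0 : ℝ)⌋)
  have h2n : (2 : ℝ) ^ n * (1 / 2) ^ n = 1 := by rw [← mul_pow]; norm_num
  have hF : ∀ x ∈ E, F x ∈ T := by
    intro x hx
    rw [Finset.mem_product, Fintype.mem_piFinset, Fintype.mem_piFinset]
    refine ⟨fun i => floor_range ?_, fun i => floor_range ?_⟩
    · rw [← mul_sub, abs_mul, abs_of_pos (hq i)]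
      calc q i * |x i - x0 i| ≤ q i * (Λ * |c i|) := mul_le_mul_of_nonneg_left (hx0 x hx i) (hq i).le
        _ = Λ * (q i * |c i|) := by ring
        _ ≤ Λ * (Λ * S.p i) := mul_le_mul_of_nonneg_left (hcl i) hΛ0.le
        _ = _ := by ring
    · rw [sub_zero, abs_mul, abs_mul, abs_of_pos (hq i), abs_of_pos (by positivity : (0:ℝ) < 2 ^ n)]
      calc (2:ℝ)^n * (q i * |x i - b i - c i * pe v (P x) i|)
          ≤ (2:ℝ)^n * (q i * (Λ * |c i| * (1 / 2 : ℝ) ^ n)) := by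
            have := hP x hx i
            have := (hq i).le
            gcongr
        _ = ((2:ℝ)^n * (1/2)^n) * (Λ * (q i * |c i|)) := by ring
        _ ≤ Λ * (Λ * S.p i) := by
          rw [h2n, one_mul]
          exact mul_le_mul_of_nonneg_left (hcl i) hΛ0.le
        _ = _ := by ring
  obtain ⟨w, hwT, hw⟩ := pigeon E F T hF hE
  set E1 := E.filter (fun x => F x = w) with hE1
  have hm : ∀ x ∈ E1, x ∈ E ∧ F x = w := fun x hx => Finset.mem_filter.1 hx
  let f : Fin d → ℤ := fun i => w.1 i + ⌊q i * x0 i⌋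
  have hf : ∀ x ∈ E1, ∀ i, Int.fract (q i * x i) = q i * x i - f i := by
    intro x hx i
    have := congrFun (congrArg Prod.fst (hm x hx).2) i
    simp only [F] at this
    rw [Int.fract]
    congr 1
    exact_mod_cast (by simp only [f]; omega : ⌊q i * x i⌋ = f i)
  let φ : (Fin d → ℝ) → Fin d → ℝ := fun x i => Int.fract (q i * x i)
  have hdiff : ∀ x ∈ E1, ∀ y ∈ E1, ∀ i, |φ x i - φ y i| = q i * |x i - y i| := by
    intro x hx y hy i
    simp only [φ]
    rw [hf x hx i, hf y hy i]
    rw [show q i * x i - f i - (q i * y i - f i) = q i * (x i - y i) by ring, abs_mul, abs_of_pos (hq i)]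
  have hsepφ : ∀ x ∈ E1, ∀ y ∈ E1, x ≠ y → ∃ i, (1 / 2 : ℝ) ^ n ≤ |φ x i - φ y i| := by
    intro x hx y hy hxy
    obtain ⟨i, hi⟩ := hsep x (hm x hx).1 y (hm y hy).1 hxy
    refine ⟨i, ?_⟩
    rw [hdiff x hx y hy]
    have h3 : Λ * (1/2:ℝ)^n ≤ Λ * (q i * |x i - y i|) := by
      calc Λ * (1/2:ℝ)^n ≤ q i * |c i| * (1/2)^n := mul_le_mul_of_nonneg_right (hcl1 i) (by positivity)
        _ = q i * (|c i| * (1/2)^n) := by ring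
        _ ≤ q i * (Λ * |x i - y i|) := mul_le_mul_of_nonneg_left hi (hq i).le
        _ = _ := by ring
    exact le_of_mul_le_mul_left h3 hΛ0
  have hinj : Set.InjOn φ E1 := by
    intro x hx y hy hxy
    by_contra hne
    obtain ⟨i, hi⟩ := hsepφ x hx y hy hne
    rw [hxy, sub_self, abs_zero] at hi
    have : (0:ℝ) < (1/2)^n := by positivity
    linarith
  refine ⟨E1.image φ, ⟨?_, ⟨fun i => q i * b i + w.2 i * (1/2)^n - f i, fun i => q i * (c i / Λ),
    fun i => ⟨hl1 i, hl2 i⟩, ?_⟩, ?_⟩, ?_⟩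
  · intro y hy i
    obtain ⟨x, hx, rfl⟩ := Finset.mem_image.1 hy
    exact S.hpow i (l i) (x i) (hEA x (hm x hx).1 i)
  · intro y hy
    obtain ⟨x, hx, rfl⟩ := Finset.mem_image.1 hy
    refine ⟨fun j => Λ * P x j, fun i => ?_⟩
    rw [pe_smul]
    have h5 := congrFun (congrArg Prod.snd (hm x hx).2) i
    simp only [F, Int.floor_zero, sub_zero] at h5
    have h6 := Int.floor_le ((2 : ℝ) ^ n * e x i)
    have h7 := Int.lt_floor_add_one ((2 : ℝ) ^ n * e x i)
    rw [h5] at h6 h7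
    have h8 : φ x i - (q i * b i + w.2 i * (1/2)^n - f i) - q i * (c i / Λ) * (Λ * pe v (P x) i)
        = e x i - w.2 i * (1/2)^n := by
      simp only [φ]
      rw [hf x hx i]
      simp only [e]
      field_simp
      ring
    rw [h8]
    have h9 : e x i = ((2:ℝ)^n * e x i) * (1/2)^n := by
      rw [mul_assoc, mul_comm (e x i), ← mul_assoc, h2n, one_mul]
    rw [h9, ← sub_mul, abs_mul, abs_of_pos (by positivity : (0:ℝ) < (1/2)^n)]
    refine mul_le_of_le_one_left (by positivity) ?_
    rw [abs_le]
    constructor <;> linarith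
  · intro y hy y' hy' hne
    obtain ⟨x, hx, rfl⟩ := Finset.mem_image.1 hy
    obtain ⟨x', hx', rfl⟩ := Finset.mem_image.1 hy'
    exact hsepφ x hx x' hx' (fun h => hne (by rw [h]))
  · rw [Finset.card_image_of_injOn hinj]
    refine hw.trans ?_
    gcongr
    linarith

/-- Magnification with injective cell map instead of separation. -/
lemma magnify_cells {d : ℕ} (S : Sys d) (v : Fin d → ℝ) (k : ℕ) (Λ : ℝ) (hΛ : 1 ≤ Λ) :
    ∃ Kc : ℝ, 0 < Kc ∧ ∀ (n : ℕ) (E : Finset (Fin d → ℝ)) (x0 b c : Fin d → ℝ) (q : Fin d → ℝ),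
      (∀ x ∈ E, ∀ i, x i ∈ S.A i) → (∀ i, 0 < |c i| ∧ |c i| ≤ Λ) →
      (∀ x ∈ E, ∀ i, |x i - x0 i| ≤ Λ * |c i|) →
      (∀ x ∈ E, ∃ P : Fin k → ℝ, ∀ i, |x i - b i - c i * pe v P i| ≤ Λ * |c i| * (1 / 2 : ℝ) ^ n) →
      (∀ i, 0 < q i ∧ q i * (|c i| * (1 / 2 : ℝ) ^ n) ≤ Λ) →
      (Set.InjOn (fun (x : Fin d → ℝ) (i : Fin d) => ⌊q i * x i⌋) E) →
      ∃ E', IsSlice S v k n E' ∧ (E.card : ℝ) ≤ Kc * E'.card := by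
  classical
  obtain ⟨Kc, hKc, H⟩ := magnify S v k Λ hΛ
  refine ⟨2 ^ d * Kc, by positivity, ?_⟩
  intro n E x0 b c q hEA hc hx0 hP hq hinj
  rcases E.eq_empty_or_nonempty with rfl | hE
  · obtain ⟨E', h1, h2⟩ := H n ∅ x0 b c (by simp) hc (by simp) (by simp) (by simp)
    exact ⟨E', h1, by simp; positivity⟩
  let F : (Fin d → ℝ) → Fin d → ℤ := fun x i => ⌊q i * x i⌋ % 2
  obtain ⟨w, hwT, hw⟩ := pigeon E F (Fintype.piFinset fun _ => ({0, 1} : Finset ℤ)) (by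
    intro x _
    rw [Fintype.mem_piFinset]
    intro i
    simp only [F, Finset.mem_insert, Finset.mem_singleton]
    omega) hE
  have hcard : (((Fintype.piFinset fun _ : Fin d => ({0, 1} : Finset ℤ)).card : ℕ) : ℝ) = 2 ^ d := by
    rw [Fintype.card_piFinset]
    simp
  rw [hcard] at hw
  set E1 := E.filter (fun x => F x = w) with hE1
  have hm : ∀ x ∈ E1, x ∈ E ∧ F x = w := fun x hx => Finset.mem_filter.1 hx
  obtain ⟨E', h1, h2⟩ := H n E1 x0 b c (fun x hx => hEA x (hm x hx).1) hc
    (fun x hx => hx0 x (hm x hx).1) (fun x hx => hP x (hm x hx).1) (by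
    intro x hx y hy hne
    have h3 : ¬ ((fun i => ⌊q i * x i⌋) = fun i => ⌊q i * y i⌋) := fun h =>
      hne (hinj (hm x hx).1 (hm y hy).1 h)
    rw [funext_iff] at h3
    push Not at h3
    obtain ⟨i, hi⟩ := h3
    refine ⟨i, ?_⟩
    have h4 := congrFun ((hm x hx).2.trans (hm y hy).2.symm) i
    simp only [F] at h4
    have h5 : (1 : ℝ) ≤ |q i * x i - q i * y i| := by
      have a1 := Int.floor_le (q i * x i)
      have a2 := Int.lt_floor_add_one (q i * x i)
      have a3 := Int.floor_le (q i * y i)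
      have a4 := Int.lt_floor_add_one (q i * y i)
      rcases lt_or_gt_of_ne hi with h | h
      · have : ⌊q i * x i⌋ + 2 ≤ ⌊q i * y i⌋ := by omega
        have : (⌊q i * x i⌋ : ℝ) + 2 ≤ ⌊q i * y i⌋ := by exact_mod_cast this
        rw [abs_sub_comm]
        exact le_trans (by linarith) (le_abs_self _)
      · have : ⌊q i * y i⌋ + 2 ≤ ⌊q i * x i⌋ := by omega
        have : (⌊q i * y i⌋ : ℝ) + 2 ≤ ⌊q i * x i⌋ := by exact_mod_cast this
        exact le_trans (by linarith) (le_abs_self _)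
    rw [← mul_sub, abs_mul, abs_of_pos (hq i).1] at h5
    have h6 : q i * (|c i| * (1 / 2 : ℝ) ^ n) ≤ q i * (Λ * |x i - y i|) := by
      calc q i * (|c i| * (1 / 2 : ℝ) ^ n) ≤ Λ := (hq i).2
        _ ≤ Λ * (q i * |x i - y i|) := le_mul_of_one_le_right (by linarith) h5
        _ = _ := by ring
    exact le_of_mul_le_mul_left h6 (hq i).1)
  refine ⟨E', h1, hw.trans ?_⟩
  rw [mul_assoc]
  exact mul_le_mul_of_nonneg_left h2 (by positivity)

/-- combined with a uniform bound -/
lemma count_cells {d : ℕ} {S : Sys d} {v : Fin d → ℝ} {k : ℕ} {β : ℝ} (h : UB S v k β) (Λ : ℝ)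
    (hΛ : 1 ≤ Λ) :
    ∃ Kc : ℝ, 1 ≤ Kc ∧ ∀ (n : ℕ) (E : Finset (Fin d → ℝ)) (x0 b c : Fin d → ℝ) (q : Fin d → ℝ),
      (∀ x ∈ E, ∀ i, x i ∈ S.A i) → (∀ i, 0 < |c i| ∧ |c i| ≤ Λ) →
      (∀ x ∈ E, ∀ i, |x i - x0 i| ≤ Λ * |c i|) →
      (∀ x ∈ E, ∃ P : Fin k → ℝ, ∀ i, |x i - b i - c i * pe v P i| ≤ Λ * |c i| * (1 / 2 : ℝ) ^ n) →
      (∀ i, 0 < q i ∧ q i * (|c i| * (1 / 2 : ℝ) ^ n) ≤ Λ) →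
      (Set.InjOn (fun (x : Fin d → ℝ) (i : Fin d) => ⌊q i * x i⌋) E) →
      (E.card : ℝ) ≤ Kc * (2 : ℝ) ^ (β * n) := by
  obtain ⟨K, hK, h⟩ := h
  obtain ⟨Kc, hKc, H⟩ := magnify_cells S v k Λ hΛ
  refine ⟨max (Kc * K) 1, le_max_right _ _, ?_⟩
  intro n E x0 b c q h1 h2 h3 h4 h5 h6
  obtain ⟨E', h7, h8⟩ := H n E x0 b c q h1 h2 h3 h4 h5 h6
  have h9 := h n E' h7
  calc (E.card : ℝ) ≤ Kc * E'.card := h8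
    _ ≤ Kc * (K * (2 : ℝ) ^ (β * n)) := mul_le_mul_of_nonneg_left h9 hKc.le
    _ = (Kc * K) * (2 : ℝ) ^ (β * n) := by ring
    _ ≤ _ := mul_le_mul_of_nonneg_right (le_max_left _ _) (by positivity)

/-- Vandermonde lower bound -/
lemma vander {d : ℕ} {v : Fin d → ℝ} (hv : Function.Injective v) {k : ℕ} (hk : k ≤ d) :
    ∃ C : ℝ, 1 ≤ C ∧ ∀ (P : Fin k → ℝ) (e : ℝ), (∀ i, |pe v P i| ≤ e) → ∀ j, |P j| ≤ C * e := by
  let f : (Fin k → ℝ) →ₗ[ℝ] (Fin d → ℝ) :=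
    { toFun := fun P i => pe v P i
      map_add' := by intro P Q; funext i; simp [pe, add_mul, Finset.sum_add_distrib]
      map_smul' := by intro a P; funext i; simp [pe, Finset.mul_sum, mul_assoc] }
  have hf : LinearMap.ker f = ⊥ := by
    rw [LinearMap.ker_eq_bot']
    intro P hP
    have h1 : ∀ i : Fin k, ∑ j, P j * (v (Fin.castLE hk i)) ^ (j : ℕ) = 0 := fun i => congrFun hP _
    have hinj : Function.Injective (fun i : Fin k => v (Fin.castLE hk i)) :=
      hv.comp (Fin.castLE_injective hk)
    have := Matrix.eq_zero_of_forall_index_sum_mul_pow_eq_zero hinj h1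
    exact this
  obtain ⟨K, hK, hL⟩ := LinearMap.exists_antilipschitzWith f hf
  refine ⟨K + 1, by simp, ?_⟩
  intro P e he j
  have he0 : 0 ≤ e := by
    by_cases hd : Nonempty (Fin d)
    · exact le_trans (abs_nonneg _) (he hd.some)
    · exact absurd ⟨Fin.castLE hk j⟩ hd
  have h1 := hL.le_mul_dist P 0
  rw [map_zero, dist_zero_right, dist_zero_right] at h1
  have h2 : ‖f P‖ ≤ e := (pi_norm_le_iff_of_nonneg he0).2 (fun i => by
    rw [Real.norm_eq_abs]; exact he i)
  calc |P j| ≤ ‖P‖ := by rw [← Real.norm_eq_abs]; exact norm_le_pi_norm P j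
    _ ≤ K * ‖f P‖ := h1
    _ ≤ K * e := mul_le_mul_of_nonneg_left h2 K.2
    _ ≤ _ := by nlinarith
end Part2

section Part3
section Kron
variable {d : ℕ}

/-- one parameter subgroups in a closed subgroup -/
def flows (G : AddSubgroup (EuclideanSpace ℝ (Fin d))) : Submodule ℝ (EuclideanSpace ℝ (Fin d)) where
  carrier := {v | ∀ t : ℝ, t • v ∈ G}
  add_mem' := by
    intro a b ha hb t
    rw [smul_add]
    exact G.add_mem (ha t) (hb t)
  zero_mem' := by
    intro t
    simp
  smul_mem' := by
    intro c x hx t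
    rw [smul_smul]
    exact hx _

lemma small_mem_flows (G : AddSubgroup (EuclideanSpace ℝ (Fin d)))
    (hG : IsClosed (G : Set (EuclideanSpace ℝ (Fin d)))) :
    ∃ ε : ℝ, 0 < ε ∧ ∀ x ∈ G, ‖x‖ < ε → x ∈ flows G := by
  by_contra hcon
  push Not at hcon
  have h1 : ∀ n : ℕ, ∃ x ∈ G, ‖x‖ < 1 / ((n : ℝ) + 1) ∧ x ∉ flows G := fun n =>
    hcon _ (by positivity)
  choose x hxG hx0 hxL using h1
  set L := flows G with hL
  let z : ℕ → EuclideanSpace ℝ (Fin d) := fun n => x n - L.starProjection (x n)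
  have hLG : ∀ y ∈ L, y ∈ G := fun y hy => by simpa using hy 1
  have hzG : ∀ n, z n ∈ G := fun n => G.sub_mem (hxG n) (hLG _ (by simp))
  have hzL : ∀ n, z n ∈ Lᗮ := fun n => Submodule.sub_starProjection_mem_orthogonal (x n)
  have hz0 : ∀ n, z n ≠ 0 := by
    intro n h
    apply hxL n
    have : x n = L.starProjection (x n) := sub_eq_zero.1 h
    rw [this]
    simp
  have hzn : ∀ n, ‖z n‖ ≤ 2 * (1 / ((n : ℝ) + 1)) := by
    intro n
    have := norm_sub_le (x n) (L.starProjection (x n))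
    have h3 := L.norm_starProjection_apply_le (x n)
    have := hx0 n
    simp only [z]
    linarith
  have hzt : Tendsto (fun n => ‖z n‖) atTop (𝓝 0) := by
    refine squeeze_zero (fun _ => norm_nonneg _) hzn ?_
    have := tendsto_one_div_add_atTop_nhds_zero_nat (𝕜 := ℝ)
    simpa using this.const_mul 2
  let u : ℕ → EuclideanSpace ℝ (Fin d) := fun n => ‖z n‖⁻¹ • z n
  have hu1 : ∀ n, ‖u n‖ = 1 := by
    intro n
    simp only [u]
    rw [norm_smul, norm_inv, norm_norm, inv_mul_cancel₀ (norm_ne_zero_iff.2 (hz0 n))]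
  obtain ⟨w, hw, φ, hφ, hlim⟩ := (isCompact_sphere (0 : EuclideanSpace ℝ (Fin d)) 1).tendsto_subseq
    (x := u) (fun n => by simp [hu1 n])
  have hw1 : ‖w‖ = 1 := by simpa using hw
  have hwL' : w ∈ Lᗮ := by
    have hc : IsClosed (Lᗮ : Set (EuclideanSpace ℝ (Fin d))) := Submodule.isClosed_orthogonal L
    refine hc.mem_of_tendsto hlim (Eventually.of_forall fun n => ?_)
    exact Submodule.smul_mem _ _ (hzL _)
  have hwL : w ∈ L := by
    intro t
    have hm : ∀ n, ⌊t / ‖z (φ n)‖⌋ • z (φ n) ∈ (G : Set (EuclideanSpace ℝ (Fin d))) := fun n =>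
      G.zsmul_mem (hzG _) _
    refine hG.mem_of_tendsto (b := atTop) ?_ (Eventually.of_forall hm)
    have e : ∀ n, ⌊t / ‖z (φ n)‖⌋ • z (φ n) = t • u (φ n) - (Int.fract (t / ‖z (φ n)‖)) • z (φ n) := by
      intro n
      have hne := norm_ne_zero_iff.2 (hz0 (φ n))
      simp only [u]
      rw [smul_smul, ← sub_smul, ← Int.cast_smul_eq_zsmul ℝ]
      congr 1
      rw [Int.fract]
      field_simp
      ring
    simp_rw [e]
    have h1 : Tendsto (fun n => t • u (φ n)) atTop (𝓝 (t • w)) := hlim.const_smul t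
    have h2 : Tendsto (fun n => (Int.fract (t / ‖z (φ n)‖)) • z (φ n)) atTop (𝓝 0) := by
      refine squeeze_zero_norm (a := fun n => ‖z (φ n)‖) (fun n => ?_) (hzt.comp hφ.tendsto_atTop)
      rw [norm_smul, Real.norm_eq_abs, abs_of_nonneg (Int.fract_nonneg _)]
      exact mul_le_of_le_one_left (norm_nonneg _) (Int.fract_lt_one _).le
    simpa using h1.sub h2
  have : inner ℝ w w = (0 : ℝ) := Submodule.inner_right_of_mem_orthogonal hwL hwL'
  rw [real_inner_self_eq_norm_sq, hw1] at this
  norm_num at this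

/-- vectors `r log 2 - a_i log p_i`. -/
def kronGroup (p : Fin d → ℕ) : AddSubgroup (EuclideanSpace ℝ (Fin d)) where
  carrier := {x | ∃ (r : ℤ) (a : Fin d → ℤ), ∀ i, x i = r * Real.log 2 - a i * Real.log (p i)}
  zero_mem' := ⟨0, 0, by simp⟩
  add_mem' := by
    rintro x y ⟨r, a, h⟩ ⟨r', a', h'⟩
    refine ⟨r + r', a + a', fun i => ?_⟩
    simp only [PiLp.add_apply, h, h', Pi.add_apply]
    push_cast
    ring
  neg_mem' := by
    rintro x ⟨r, a, h⟩
    refine ⟨-r, -a, fun i => ?_⟩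
    simp only [PiLp.neg_apply, h, Pi.neg_apply]
    push_cast
    ring

lemma recur (p : Fin d → ℕ) (hp : ∀ i, 2 ≤ p i) (ε : ℝ) (hε : 0 < ε) :
    ∃ (r : ℤ) (a : Fin d → ℤ), r ≠ 0 ∧
      ‖(WithLp.toLp 2 (fun i => (r : ℝ) * Real.log 2 - a i * Real.log (p i)) : EuclideanSpace ℝ (Fin d))‖ < ε := by
  have hlp : ∀ i, 0 < Real.log (p i) := fun i => Real.log_pos (by exact_mod_cast hp i)
  let A : ℕ → Fin d → ℤ := fun r i => ⌊(r : ℝ) * Real.log 2 / Real.log (p i)⌋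
  let g : ℕ → Fin d → ℝ := fun r i => (r : ℝ) * Real.log 2 - A r i * Real.log (p i)
  have hg : ∀ r, g r ∈ Set.pi Set.univ (fun i => Set.Icc (0:ℝ) (Real.log (p i))) := by
    intro r i _
    have h1 := Int.floor_le ((r : ℝ) * Real.log 2 / Real.log (p i))
    have h2 := Int.lt_floor_add_one ((r : ℝ) * Real.log 2 / Real.log (p i))
    rw [le_div_iff₀ (hlp i)] at h1
    rw [div_lt_iff₀ (hlp i)] at h2
    simp only [g, A]
    constructor <;> linarith
  have hcomp : IsCompact (Set.pi Set.univ (fun i : Fin d => Set.Icc (0:ℝ) (Real.log (p i)))) :=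
    isCompact_univ_pi fun i => isCompact_Icc
  obtain ⟨w, hw, φ, hφ, hlim⟩ := hcomp.tendsto_subseq hg
  have hlim2 : Tendsto (fun n => (WithLp.toLp 2 (g (φ n)) : EuclideanSpace ℝ (Fin d))) atTop
      (𝓝 (WithLp.toLp 2 w)) := ((PiLp.continuous_toLp 2 _).tendsto w).comp hlim
  have hc := hlim2.cauchySeq
  rw [Metric.cauchySeq_iff] at hc
  obtain ⟨N, hN⟩ := hc ε hε
  have h3 := hN (N + 1) (by simp) N le_rfl
  rw [dist_eq_norm] at h3
  refine ⟨(φ (N + 1) : ℤ) - φ N, fun i => A (φ (N+1)) i - A (φ N) i, ?_, ?_⟩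
  · have := hφ (Nat.lt_succ_self N)
    simp only [Nat.succ_eq_add_one] at this
    omega
  · refine lt_of_eq_of_lt (congrArg norm ?_) h3
    ext i
    simp [g]
    ring

/-- Simultaneous Kronecker approximation along a generic flow. -/
lemma kron (p : Fin d → ℕ) (hp : ∀ i, 2 ≤ p i)
    (hindep : ∀ i j, i ≠ j → Irrational (Real.log (p i) / Real.log (p j))) :
    ∃ v : Fin d → ℝ, Function.Injective v ∧ ∀ τ κ : ℝ, 0 < κ → ∃ (r : ℤ) (a : Fin d → ℤ),
      ∀ i, |r * Real.log 2 - a i * Real.log (p i) - τ * v i| < κ := by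
  classical
  have hlp : ∀ i, 0 < Real.log (p i) := fun i => Real.log_pos (by exact_mod_cast hp i)
  let G := (kronGroup p).topologicalClosure
  obtain ⟨ε, hε, hsm⟩ := small_mem_flows G (kronGroup p).isClosed_topologicalClosure
  obtain ⟨r, a, hr, hra⟩ := recur p hp (min ε (Real.log 2)) (lt_min hε (Real.log_pos (by norm_num)))
  set g : EuclideanSpace ℝ (Fin d) := WithLp.toLp 2 (fun i => (r : ℝ) * Real.log 2 - a i * Real.log (p i)) with hg
  have hgi : ∀ i, g i = (r : ℝ) * Real.log 2 - a i * Real.log (p i) := fun i => rfl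
  have hgL : g ∈ flows G := hsm g ((kronGroup p).le_topologicalClosure ⟨r, a, fun i => rfl⟩)
    (lt_of_lt_of_le hra (min_le_left _ _))
  have hgne : ∀ i j, i ≠ j → g i ≠ g j := by
    intro i j hij h
    rw [hgi, hgi] at h
    have h' : (a i : ℝ) * Real.log (p i) = a j * Real.log (p j) := by linarith
    by_cases hai : a i = 0
    · rw [hai] at h'
      have h3 : ‖g i‖ ≤ ‖g‖ := PiLp.norm_apply_le g i
      rw [hgi, hai] at h3
      simp only [Int.cast_zero, zero_mul, sub_zero, norm_mul, Real.norm_eq_abs] at h3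
      have h4 : (1:ℝ) ≤ |(r:ℝ)| := by exact_mod_cast Int.one_le_abs hr
      have h5 : 0 < Real.log 2 := Real.log_pos (by norm_num)
      rw [abs_of_pos h5] at h3
      have h6 := lt_of_lt_of_le hra (min_le_right _ _)
      nlinarith
    · apply (hindep i j hij)
      refine ⟨(a j : ℚ) / a i, ?_⟩
      have : (a i : ℝ) ≠ 0 := by exact_mod_cast hai
      push_cast
      rw [div_eq_div_iff this (hlp j).ne']
      linarith
  let L := flows G
  let H : Fin d × Fin d → Submodule ℝ L := fun ij =>
    LinearMap.ker (((EuclideanSpace.proj ij.1 : EuclideanSpace ℝ (Fin d) →L[ℝ] ℝ) : _ →ₗ[ℝ] ℝ).comp L.subtype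
      - ((EuclideanSpace.proj ij.2 : EuclideanSpace ℝ (Fin d) →L[ℝ] ℝ) : _ →ₗ[ℝ] ℝ).comp L.subtype)
  have hmem : ∀ ij (w : L), w ∈ H ij ↔ (w : EuclideanSpace ℝ (Fin d)) ij.1 = (w : EuclideanSpace ℝ (Fin d)) ij.2 := by
    intro ij w
    simp [H, sub_eq_zero]
  let s : Finset (Submodule ℝ L) := (Finset.univ.filter (fun ij : Fin d × Fin d => ij.1 ≠ ij.2)).image H
  have hs : ⊤ ∉ s := by
    intro htop
    obtain ⟨ij, hij, h⟩ := Finset.mem_image.1 htop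
    have h1 : (⟨g, hgL⟩ : L) ∈ H ij := by rw [h]; trivial
    rw [hmem] at h1
    exact hgne _ _ (Finset.mem_filter.1 hij).2 h1
  have hne := Subspace.biUnion_ne_univ_of_top_notMem hs
  obtain ⟨w, hw⟩ := (Set.ne_univ_iff_exists_notMem _).1 hne
  refine ⟨fun i => (w : EuclideanSpace ℝ (Fin d)) i, ?_, ?_⟩
  · intro i j hij
    by_contra hne
    apply hw
    simp only [Set.mem_iUnion]
    exact ⟨H (i, j), Finset.mem_image_of_mem _ (by simp [hne]), (hmem (i, j) w).2 hij⟩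
  · intro τ κ hκ
    have h1 : τ • (w : EuclideanSpace ℝ (Fin d)) ∈ G := w.2 τ
    have h2 : τ • (w : EuclideanSpace ℝ (Fin d)) ∈ closure (kronGroup p : Set (EuclideanSpace ℝ (Fin d))) := h1
    rw [Metric.mem_closure_iff] at h2
    obtain ⟨y, ⟨r, a, hy⟩, hd⟩ := h2 κ hκ
    refine ⟨r, a, fun i => ?_⟩
    rw [dist_comm, dist_eq_norm] at hd
    have h3 := PiLp.norm_apply_le (y - τ • (w : EuclideanSpace ℝ (Fin d))) i
    rw [← hy i]
    refine lt_of_le_of_lt ?_ hd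
    simpa using h3

end Kron
end Part3

section Part4
lemma cover_lemma (A : Set ℝ) (hA : IsCompact A) (s : ℝ) (hs : 0 < s) (h0 : Measure.hausdorffMeasure s A = 0)
    (r ε : ℝ) (hr : 0 < r) (hε : 0 < ε) :
    ∃ (w : Finset ℕ) (x ρ : ℕ → ℝ), (∀ n, 0 < ρ n ∧ ρ n ≤ r) ∧
      (A ⊆ ⋃ n ∈ w, Metric.ball (x n) (ρ n)) ∧ ∑ n ∈ w, ρ n ^ s ≤ ε := by
  classical
  set ε1 : ℝ := ε / (3 * 2 ^ s) with hε1
  have h2s : (0:ℝ) < 2 ^ s := by positivity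
  have hεpos1 : 0 < ε1 := by positivity
  rw [Measure.hausdorffMeasure_apply] at h0
  simp only [ENNReal.iSup_eq_zero] at h0
  have h1 := h0 (ENNReal.ofReal (r / 2)) (by simpa using hr)
  have h2 : (0 : ℝ≥0∞) < ENNReal.ofReal ε1 := by simpa using hεpos1
  rw [← h1] at h2
  simp only [iInf_lt_iff] at h2
  obtain ⟨t, hcov, hdiam, hsum⟩ := h2
  have hD : ∀ n, Metric.ediam (t n) ≠ ⊤ := fun n => ne_top_of_le_ne_top ENNReal.ofReal_ne_top (hdiam n)
  let D : ℕ → ℝ := fun n => (Metric.ediam (t n)).toReal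
  have hDr : ∀ n, D n ≤ r / 2 := fun n => ENNReal.toReal_le_of_le_ofReal (by positivity) (hdiam n)
  have hD0 : ∀ n, 0 ≤ D n := fun n => ENNReal.toReal_nonneg
  let e : ℕ → ℝ := fun n => min (r / 2) ((ε1 * (1 / 2) ^ n) ^ (1 / s))
  have he0 : ∀ n, 0 < e n := fun n => lt_min (by positivity) (by positivity)
  have hes : ∀ n, e n ^ s ≤ ε1 * (1 / 2) ^ n := by
    intro n
    calc e n ^ s ≤ ((ε1 * (1 / 2) ^ n) ^ (1 / s)) ^ s :=
          Real.rpow_le_rpow (he0 n).le (min_le_right _ _) hs.le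
      _ = ε1 * (1 / 2) ^ n := by
        rw [← Real.rpow_mul (by positivity), one_div_mul_cancel hs.ne', Real.rpow_one]
  let x : ℕ → ℝ := fun n => if h : (t n).Nonempty then h.some else 0
  have hxt : ∀ n, ∀ y ∈ t n, x n ∈ t n := by
    intro n y hy
    have hne : (t n).Nonempty := ⟨y, hy⟩
    simp only [x, dif_pos hne]
    exact hne.some_mem
  have hball : ∀ n, t n ⊆ Metric.ball (x n) (D n + e n) := by
    intro n y hy
    rw [Metric.mem_ball, dist_edist]
    have h5 := Metric.edist_le_ediam_of_mem hy (hxt n y hy)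
    have := ENNReal.toReal_mono (hD n) h5
    have := he0 n
    simp only [D]
    linarith
  obtain ⟨w2, hw2⟩ := hA.elim_finite_subcover
    (fun n => if (t n).Nonempty then Metric.ball (x n) (D n + e n) else ∅)
    (fun n => by
      by_cases h : (t n).Nonempty
      · simp only [if_pos h]; exact Metric.isOpen_ball
      · simp only [if_neg h]; exact isOpen_empty)
    (by
      intro y hy
      obtain ⟨n, hn⟩ := Set.mem_iUnion.1 (hcov hy)
      refine Set.mem_iUnion.2 ⟨n, ?_⟩
      have hne : (t n).Nonempty := ⟨y, hn⟩
      rw [if_pos hne]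
      exact hball n hn)
  refine ⟨w2.filter (fun n => (t n).Nonempty), x, fun n => D n + e n, ?_, ?_, ?_⟩
  · intro n
    have := hD0 n
    have := he0 n
    have h3 := hDr n
    have : e n ≤ r / 2 := min_le_left _ _
    constructor <;> linarith
  · intro y hy
    obtain ⟨n, hn⟩ := Set.mem_iUnion.1 (hw2 hy)
    simp only [Set.mem_iUnion] at hn
    obtain ⟨hnw, hn⟩ := hn
    by_cases h : (t n).Nonempty
    · simp only [if_pos h] at hn
      simp only [Set.mem_iUnion]
      exact ⟨n, Finset.mem_filter.2 ⟨hnw, h⟩, hn⟩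
    · simp only [if_neg h] at hn
      exact absurd hn (Set.notMem_empty _)
  · set W := w2.filter (fun n => (t n).Nonempty) with hW
    have hDs : ∑ n ∈ W, D n ^ s ≤ ε1 := by
      have h6 : ∑ n ∈ W, (⨆ _ : (t n).Nonempty, Metric.ediam (t n) ^ s) < ENNReal.ofReal ε1 :=
        lt_of_le_of_lt (ENNReal.sum_le_tsum W) hsum
      have h7 : ∑ n ∈ W, Metric.ediam (t n) ^ s ≤ ENNReal.ofReal ε1 := by
        refine le_trans (le_of_eq ?_) h6.le
        refine Finset.sum_congr rfl fun n hn => ?_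
        rw [ciSup_pos (Finset.mem_filter.1 hn).2]
      have h8 := ENNReal.toReal_le_of_le_ofReal hεpos1.le h7
      rw [ENNReal.toReal_sum (fun n _ => ENNReal.rpow_ne_top_of_nonneg hs.le (hD n))] at h8
      simpa [D, ENNReal.toReal_rpow] using h8
    have hE : ∑ n ∈ W, e n ^ s ≤ 2 * ε1 := by
      calc ∑ n ∈ W, e n ^ s ≤ ∑ n ∈ W, ε1 * (1 / 2) ^ n := Finset.sum_le_sum fun n _ => hes n
        _ = ε1 * ∑ n ∈ W, (1 / 2 : ℝ) ^ n := by rw [Finset.mul_sum]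
        _ ≤ ε1 * 2 := by
          refine mul_le_mul_of_nonneg_left ?_ hεpos1.le
          exact (summable_geometric_two.sum_le_tsum W (fun _ _ => by positivity)).trans
            tsum_geometric_two.le
        _ = _ := by ring
    have hpt : ∀ n, (D n + e n) ^ s ≤ 2 ^ s * (D n ^ s + e n ^ s) := by
      intro n
      have a1 := hD0 n
      have a2 := he0 n
      have a3 : 0 ≤ D n ^ s := by positivity
      have a4 : 0 ≤ e n ^ s := by positivity
      rcases le_total (D n) (e n) with h | h
      · calc (D n + e n) ^ s ≤ (2 * e n) ^ s := Real.rpow_le_rpow (by positivity) (by linarith) hs.le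
          _ = 2 ^ s * e n ^ s := Real.mul_rpow (by norm_num) a2.le
          _ ≤ _ := by gcongr; linarith
      · calc (D n + e n) ^ s ≤ (2 * D n) ^ s := Real.rpow_le_rpow (by positivity) (by linarith) hs.le
          _ = 2 ^ s * D n ^ s := Real.mul_rpow (by norm_num) a1
          _ ≤ _ := by gcongr; linarith
    calc ∑ n ∈ W, (D n + e n) ^ s ≤ ∑ n ∈ W, 2 ^ s * (D n ^ s + e n ^ s) :=
          Finset.sum_le_sum fun n _ => hpt n
      _ = 2 ^ s * (∑ n ∈ W, D n ^ s + ∑ n ∈ W, e n ^ s) := by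
        rw [← Finset.mul_sum, Finset.sum_add_distrib]
      _ ≤ 2 ^ s * (ε1 + 2 * ε1) := by gcongr
      _ = ε := by rw [hε1]; field_simp; ring

/-- cell counting bound -/
def BoxB (p : ℕ) (A : Set ℝ) (s : ℝ) : Prop :=
  ∃ K : ℝ, 0 < K ∧ ∀ (n : ℕ) (F : Finset ℝ), ↑F ⊆ A → Set.InjOn (fun t : ℝ => ⌊(p : ℝ) ^ n * t⌋) F →
    (F.card : ℝ) ≤ K * (p : ℝ) ^ (s * n)

lemma floor_split (a : ℕ) (y : ℝ) : ⌊(a : ℝ) * y⌋ = a * ⌊y⌋ + ⌊(a : ℝ) * Int.fract y⌋ := by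
  have : (a : ℝ) * y = (a : ℝ) * Int.fract y + ((a * ⌊y⌋ : ℤ) : ℝ) := by
    push_cast
    rw [← mul_add, Int.fract_add_floor]
  rw [this, Int.floor_add_intCast, add_comm]

lemma cells_trivial (p : ℕ) (hp : 0 < p) (A : Set ℝ) (hA : A ⊆ Set.Ico 0 1) (n : ℕ) (F : Finset ℝ)
    (hF : ↑F ⊆ A) (hinj : Set.InjOn (fun t : ℝ => ⌊(p : ℝ) ^ n * t⌋) F) :
    F.card ≤ p ^ n := by
  rcases F.eq_empty_or_nonempty with rfl | ⟨x0, hx0⟩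
  · simp
  classical
  rw [← Finset.card_image_of_injOn hinj]
  have : F.image (fun t : ℝ => ⌊(p : ℝ) ^ n * t⌋) ⊆ Finset.Ico 0 ((p ^ n : ℕ) : ℤ) := by
    intro z hz
    obtain ⟨t, ht, rfl⟩ := Finset.mem_image.1 hz
    have h1 := hA (hF ht)
    rw [Finset.mem_Ico]
    constructor
    · exact Int.floor_nonneg.2 (mul_nonneg (by positivity) h1.1)
    · rw [Int.floor_lt]
      push_cast
      have : 0 < (p : ℝ) ^ n := by positivity
      nlinarith [h1.2]
  refine (Finset.card_le_card this).trans ?_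
  simp

lemma box_haus (p : ℕ) (hp : 2 ≤ p) (A A' : Set ℝ) (hA : A ⊆ Set.Ico 0 1) (hAA : A ⊆ A')
    (hc : IsCompact A') (hinv : ∀ l : ℕ, ∀ x ∈ A, Int.fract ((p : ℝ) ^ l * x) ∈ A)
    (s : ℝ) (hs : 0 < s) (h0 : Measure.hausdorffMeasure s A' = 0) : BoxB p A s := by
  classical
  have hp1 : (1:ℝ) < p := by exact_mod_cast hp
  have hp0 : (0:ℝ) < p := by linarith
  obtain ⟨w, x, ρ, hρ, hcov, hsum⟩ := cover_lemma A' hc s hs h0 (1 / (2 * p ^ 2)) (1 / (2 * (2 * p) ^ s))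
    (by positivity) (by positivity)
  have hl : ∀ n, ∃ l : ℕ, 1 ≤ l ∧ 2 * ρ n ≤ (1 / p : ℝ) ^ l ∧ (1 / p : ℝ) ^ (l + 1) ≤ 2 * ρ n := by
    intro n
    have h1 : 2 * ρ n ≤ (1 / p : ℝ) ^ 2 := by
      have := (hρ n).2
      calc 2 * ρ n ≤ 2 * (1 / (2 * p ^ 2)) := by linarith
        _ = _ := by field_simp
    have h1' : (1 / p : ℝ) ^ 2 ≤ 1 / p := by
      rw [pow_two]
      refine mul_le_of_le_one_left (by positivity) ?_
      rw [div_le_one hp0]; exact hp1.le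
    obtain ⟨l, hl1, hl2⟩ := exists_nat_pow_near_of_lt_one (x := 2 * ρ n) (y := (1 / p : ℝ))
      (by have := (hρ n).1; linarith) (h1.trans (h1'.trans (by rw [div_le_one hp0]; exact hp1.le)))
      (by positivity) (by rw [div_lt_one hp0]; exact hp1)
    refine ⟨l, ?_, hl2, hl1.le⟩
    by_contra hl0
    have : l = 0 := by omega
    subst this
    simp only [zero_add, pow_one] at hl1
    linarith [h1.trans h1']
  choose l hl1 hl2 hl3 using hl
  let M := w.sup l
  have key : ∀ (n : ℕ) (F : Finset ℝ), ↑F ⊆ A → Set.InjOn (fun t : ℝ => ⌊(p : ℝ) ^ n * t⌋) F →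
    (F.card : ℝ) ≤ (p : ℝ) ^ M * (p : ℝ) ^ (s * n) := by
    intro n
    induction n using Nat.strong_induction_on with
    | _ n ih =>
    intro F hF hinj
    by_cases hn : n ≤ M
    · have h1 := cells_trivial p (by omega) A hA n F hF hinj
      have h2 : (F.card : ℝ) ≤ (p : ℝ) ^ n := by exact_mod_cast h1
      have h3 : (p : ℝ) ^ n ≤ (p : ℝ) ^ M := pow_le_pow_right₀ hp1.le hn
      have h4 : (1 : ℝ) ≤ (p : ℝ) ^ (s * n) := Real.one_le_rpow hp1.le (by positivity)
      calc (F.card : ℝ) ≤ (p : ℝ) ^ M * 1 := by linarith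
        _ ≤ _ := by gcongr
    push Not at hn
    -- pieces
    have hpiece : ∀ m ∈ w, ((F.filter (fun t => t ∈ Metric.ball (x m) (ρ m))).card : ℝ) ≤
        2 * ((p : ℝ) ^ M * (p : ℝ) ^ (s * ((n - l m : ℕ) : ℝ))) := by
      intro m hm
      set F1 := F.filter (fun t => t ∈ Metric.ball (x m) (ρ m)) with hF1
      have hlm : l m ≤ M := Finset.le_sup hm
      rcases F1.eq_empty_or_nonempty with h | hne
      · rw [h]; simp; positivity
      set z := ⌊(p:ℝ) ^ (l m) * (x m - ρ m)⌋ with hz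
      obtain ⟨b, hb, hbc⟩ := pigeon F1 (fun t => ⌊(p:ℝ) ^ (l m) * t⌋) {z, z + 1} (by
        intro t ht
        have ht2 := (Finset.mem_filter.1 ht).2
        rw [Metric.mem_ball, Real.dist_eq, abs_lt] at ht2
        have hpl : (0:ℝ) < (p:ℝ) ^ l m := by positivity
        have a1 : (p:ℝ) ^ l m * (2 * ρ m) ≤ 1 := by
          calc (p:ℝ) ^ l m * (2 * ρ m) ≤ (p:ℝ) ^ l m * (1 / p) ^ l m :=
                mul_le_mul_of_nonneg_left (hl2 m) hpl.le
            _ = 1 := by rw [← mul_pow, mul_one_div_cancel hp0.ne', one_pow]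
        have a2 : (p:ℝ) ^ l m * (x m - ρ m) ≤ (p:ℝ) ^ l m * t :=
          mul_le_mul_of_nonneg_left (by linarith) hpl.le
        have a3 : (p:ℝ) ^ l m * t < (p:ℝ) ^ l m * (x m - ρ m) + 1 := by
          have : (p:ℝ) ^ l m * t < (p:ℝ) ^ l m * (x m - ρ m + 2 * ρ m) :=
            mul_lt_mul_of_pos_left (by linarith) hpl
          linarith
        have a4 := Int.lt_floor_add_one ((p:ℝ) ^ (l m) * (x m - ρ m))
        have b1 : z ≤ ⌊(p:ℝ) ^ l m * t⌋ := Int.floor_le_floor a2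
        have b2 : ⌊(p:ℝ) ^ l m * t⌋ < z + 2 := by
          rw [Int.floor_lt]; push_cast; linarith
        simp only [Finset.mem_insert, Finset.mem_singleton]
        omega) hne
      have hc2 : ((({z, z + 1} : Finset ℤ).card : ℕ) : ℝ) ≤ 2 := by
        exact_mod_cast Finset.card_le_two
      set F2 := F1.filter (fun t => ⌊(p:ℝ) ^ (l m) * t⌋ = b) with hF2
      have hm2 : ∀ t ∈ F2, t ∈ F ∧ ⌊(p:ℝ) ^ (l m) * t⌋ = b := fun t ht =>
        ⟨(Finset.mem_filter.1 (Finset.mem_filter.1 ht).1).1, (Finset.mem_filter.1 ht).2⟩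
      let φ : ℝ → ℝ := fun t => Int.fract ((p:ℝ) ^ (l m) * t)
      have hpn : (p:ℝ) ^ n = (p:ℝ) ^ (n - l m) * (p:ℝ) ^ (l m) := by
        rw [← pow_add]; congr 1; omega
      have hcell : ∀ t ∈ F2, ⌊(p:ℝ) ^ n * t⌋ = (p ^ (n - l m) : ℕ) * b + ⌊(p:ℝ) ^ (n - l m) * φ t⌋ := by
        intro t ht
        have := floor_split (p ^ (n - l m)) ((p:ℝ) ^ (l m) * t)
        rw [(hm2 t ht).2] at this
        rw [hpn, mul_assoc]
        push_cast at this ⊢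
        exact this
      have hinjφ : Set.InjOn φ F2 := by
        intro t ht u hu h
        refine hinj (hm2 t ht).1 (hm2 u hu).1 ?_
        simp only
        rw [hcell t ht, hcell u hu, h]
      have hb2 := ih (n - l m) (by have := hl1 m; omega) (F2.image φ) (by
        intro y hy
        obtain ⟨t, ht, rfl⟩ := Finset.mem_image.1 (Finset.mem_coe.1 hy)
        exact hinv _ _ (hF (hm2 t ht).1)) (by
        intro y hy y' hy' h
        obtain ⟨t, ht, rfl⟩ := Finset.mem_image.1 (Finset.mem_coe.1 hy)
        obtain ⟨u, hu, rfl⟩ := Finset.mem_image.1 (Finset.mem_coe.1 hy')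
        simp only at h
        congr 1
        refine hinj (hm2 t ht).1 (hm2 u hu).1 ?_
        simp only
        rw [hcell t ht, hcell u hu, h])
      rw [Finset.card_image_of_injOn hinjφ] at hb2
      refine hbc.trans ?_
      exact mul_le_mul hc2 hb2 (by positivity) (by norm_num)
    have hle : (F.card : ℝ) ≤ ∑ m ∈ w, ((F.filter (fun t => t ∈ Metric.ball (x m) (ρ m))).card : ℝ) := by
      have : F ⊆ w.biUnion (fun m => F.filter (fun t => t ∈ Metric.ball (x m) (ρ m))) := by
        intro t ht
        have := hcov (hAA (hF ht))
        simp only [Set.mem_iUnion] at this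
        obtain ⟨m, hm, h⟩ := this
        exact Finset.mem_biUnion.2 ⟨m, hm, Finset.mem_filter.2 ⟨ht, h⟩⟩
      exact_mod_cast (Finset.card_le_card this).trans Finset.card_biUnion_le
    refine hle.trans ((Finset.sum_le_sum hpiece).trans ?_)
    have hterm : ∀ m ∈ w, 2 * ((p : ℝ) ^ M * (p : ℝ) ^ (s * ((n - l m : ℕ) : ℝ))) ≤
        ((p : ℝ) ^ M * (p : ℝ) ^ (s * n)) * (2 * (2 * p) ^ s * ρ m ^ s) := by
      intro m hm
      have hlm : l m ≤ M := Finset.le_sup hm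
      have h5 : (p : ℝ) ^ (s * ((n - l m : ℕ) : ℝ)) = (p : ℝ) ^ (s * n) * ((1 / p : ℝ) ^ l m) ^ s := by
        rw [Nat.cast_sub (by omega), mul_sub, Real.rpow_sub hp0, one_div, inv_pow,
          Real.inv_rpow (by positivity), div_eq_mul_inv]
        congr 2
        rw [mul_comm, Real.rpow_mul hp0.le, Real.rpow_natCast]
      have h6 : ((1 / p : ℝ) ^ l m) ^ s ≤ (2 * p) ^ s * ρ m ^ s := by
        rw [← Real.mul_rpow (by positivity) (hρ m).1.le]
        refine Real.rpow_le_rpow (by positivity) ?_ hs.le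
        have := hl3 m
        rw [pow_succ, mul_one_div, div_le_iff₀ hp0] at this
        linarith
      rw [h5]
      calc 2 * ((p : ℝ) ^ M * ((p : ℝ) ^ (s * n) * ((1 / p : ℝ) ^ l m) ^ s))
          = ((p : ℝ) ^ M * (p : ℝ) ^ (s * n)) * (2 * ((1 / p : ℝ) ^ l m) ^ s) := by ring
        _ ≤ ((p : ℝ) ^ M * (p : ℝ) ^ (s * n)) * (2 * ((2 * p) ^ s * ρ m ^ s)) := by gcongr
        _ = _ := by ring
    refine (Finset.sum_le_sum hterm).trans ?_
    rw [← Finset.mul_sum, ← Finset.mul_sum]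
    refine mul_le_of_le_one_right (by positivity) ?_
    calc 2 * (2 * (p:ℝ)) ^ s * ∑ m ∈ w, ρ m ^ s ≤ 2 * (2 * (p:ℝ)) ^ s * (1 / (2 * (2 * p) ^ s)) := by gcongr
      _ = 1 := by field_simp
  exact ⟨(p : ℝ) ^ M, by positivity, key⟩
end Part4

section Part5
lemma UB_top {d : ℕ} (S : Sys d) (v : Fin d → ℝ) (k : ℕ) (s : Fin d → ℝ) (hs : ∀ i, 0 ≤ s i)
    (hB : ∀ i, BoxB (S.p i) (S.A i) (s i)) : UB S v k (∑ i, s i) := by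
  classical
  choose K hK hB using hB
  have hp1 : ∀ i, (1:ℝ) < S.p i := fun i => by exact_mod_cast S.hp i
  have hp0 : ∀ i, (0:ℝ) < S.p i := fun i => by linarith [hp1 i]
  refine ⟨∏ i, (K i * (S.p i : ℝ) ^ s i), Finset.prod_pos fun i _ => mul_pos (hK i) (Real.rpow_pos_of_pos (hp0 i) _), ?_⟩
  intro n E hE
  let L : Fin d → ℕ := fun i => Nat.log (S.p i) (2 ^ n) + 1
  have hL1 : ∀ i, (2:ℝ) ^ n ≤ (S.p i : ℝ) ^ L i := by
    intro i
    have := Nat.lt_pow_succ_log_self (by have := S.hp i; omega : 1 < S.p i) (2 ^ n)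
    exact_mod_cast this.le
  have hL2 : ∀ i, (S.p i : ℝ) ^ L i ≤ S.p i * 2 ^ n := by
    intro i
    have := Nat.pow_log_le_self (S.p i) (x := 2 ^ n) (by positivity)
    have h2 : (S.p i : ℝ) ^ (Nat.log (S.p i) (2 ^ n)) ≤ 2 ^ n := by exact_mod_cast this
    simp only [L]
    rw [pow_succ, mul_comm]
    exact mul_le_mul_of_nonneg_left h2 (hp0 i).le
  let T : Fin d → Finset ℤ := fun i => E.image (fun x => ⌊(S.p i : ℝ) ^ L i * x i⌋)
  have hT : ∀ i, ((T i).card : ℝ) ≤ (K i * (S.p i : ℝ) ^ s i) * (2:ℝ) ^ (s i * n) := by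
    intro i
    obtain ⟨F, hF1, hF2, hF3⟩ := Finset.exists_subset_injOn_image_eq_of_surjOn
      (f := fun t : ℝ => ⌊(S.p i : ℝ) ^ L i * t⌋) (↑(E.image (fun x => x i)) : Set ℝ) (T i) (by
        intro z hz
        obtain ⟨x, hx, rfl⟩ := Finset.mem_image.1 (Finset.mem_coe.1 hz)
        exact ⟨x i, Finset.mem_coe.2 (Finset.mem_image_of_mem _ hx), rfl⟩)
    rw [← hF3, Finset.card_image_of_injOn hF2]
    have h1 := hB i (L i) F (by
      intro t ht
      obtain ⟨x, hx, rfl⟩ := Finset.mem_image.1 (hF1 ht)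
      exact hE.1 x hx i) hF2
    refine h1.trans ?_
    rw [mul_assoc]
    refine mul_le_mul_of_nonneg_left ?_ (hK i).le
    calc (S.p i : ℝ) ^ (s i * L i) = ((S.p i : ℝ) ^ L i) ^ s i := by
          rw [mul_comm, Real.rpow_mul (hp0 i).le, Real.rpow_natCast]
      _ ≤ (S.p i * 2 ^ n) ^ s i := Real.rpow_le_rpow (pow_nonneg (hp0 i).le _) (hL2 i) (hs i)
      _ = (S.p i : ℝ) ^ s i * (2:ℝ) ^ (s i * n) := by
        rw [Real.mul_rpow (hp0 i).le (by positivity), mul_comm (s i), Real.rpow_mul (by norm_num), Real.rpow_natCast]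
  let φ : (Fin d → ℝ) → Fin d → ℤ := fun x i => ⌊(S.p i : ℝ) ^ L i * x i⌋
  have hinj : Set.InjOn φ E := by
    intro x hx y hy hxy
    by_contra hne
    obtain ⟨i, hi⟩ := hE.2.2 x hx y hy hne
    have h1 : ⌊(S.p i : ℝ) ^ L i * x i⌋ = ⌊(S.p i : ℝ) ^ L i * y i⌋ := congrFun hxy i
    have h2 := Int.abs_sub_lt_one_of_floor_eq_floor h1
    rw [← mul_sub, abs_mul, abs_of_pos (pow_pos (hp0 i) _)] at h2
    have h3 : (2:ℝ)^n * (1/2)^n ≤ (S.p i : ℝ) ^ L i * |x i - y i| :=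
      mul_le_mul (hL1 i) hi (by positivity) (pow_nonneg (hp0 i).le _)
    rw [← mul_pow] at h3
    norm_num at h3
    linarith
  have hsub : E.image φ ⊆ Fintype.piFinset T := by
    intro z hz
    obtain ⟨x, hx, rfl⟩ := Finset.mem_image.1 hz
    rw [Fintype.mem_piFinset]
    exact fun i => Finset.mem_image_of_mem _ hx
  have hcard := Finset.card_le_card hsub
  rw [Finset.card_image_of_injOn hinj, Fintype.card_piFinset] at hcard
  have h4 : (E.card : ℝ) ≤ ∏ i, ((T i).card : ℝ) := by exact_mod_cast hcard
  refine h4.trans ((Finset.prod_le_prod (fun i _ => by positivity) (fun i _ => hT i)).trans (le_of_eq ?_))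
  rw [Finset.prod_mul_distrib, Finset.sum_mul, Real.rpow_sum_of_pos (by norm_num)]
end Part5

section Part6
lemma count_idx {d : ℕ} {S : Sys d} {v : Fin d → ℝ} {k : ℕ} {β : ℝ} (h : UB S v k β) (Λ : ℝ)
    (hΛ : 1 ≤ Λ) :
    ∃ Kc : ℝ, 1 ≤ Kc ∧ ∀ {ι : Type} (n : ℕ) (E : Finset ι) (y : ι → Fin d → ℝ)
      (b c : Fin d → ℝ) (q : Fin d → ℝ),
      (∀ x ∈ E, ∀ i, y x i ∈ S.A i) → (∀ i, 0 < |c i| ∧ |c i| ≤ Λ) →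
      (∀ x ∈ E, ∀ x' ∈ E, ∀ i, |y x i - y x' i| ≤ Λ * |c i|) →
      (∀ x ∈ E, ∃ P : Fin k → ℝ, ∀ i, |y x i - b i - c i * pe v P i| ≤ Λ * |c i| * (1 / 2 : ℝ) ^ n) →
      (∀ i, 0 < q i ∧ q i * (|c i| * (1 / 2 : ℝ) ^ n) ≤ Λ) →
      (Set.InjOn (fun (x : ι) (i : Fin d) => ⌊q i * y x i⌋) E) →
      (E.card : ℝ) ≤ Kc * (2 : ℝ) ^ (β * n) := by
  classical
  obtain ⟨Kc, hKc, H⟩ := count_cells h Λ hΛ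
  refine ⟨Kc, hKc, ?_⟩
  intro ι n E y b c q hA hc hd hP hq hinj
  rcases E.eq_empty_or_nonempty with rfl | ⟨x0, hx0⟩
  · simp; positivity
  have hyinj : Set.InjOn y E := by
    intro x hx x' hx' he
    apply hinj hx hx'
    simp only [he]
  have hcard : (E.image y).card = E.card := Finset.card_image_of_injOn hyinj
  rw [← hcard]
  refine H n (E.image y) (y x0) b c q ?_ hc ?_ ?_ hq ?_
  · intro x hx
    obtain ⟨w, hw, rfl⟩ := Finset.mem_image.1 hx
    exact hA w hw
  · intro x hx
    obtain ⟨w, hw, rfl⟩ := Finset.mem_image.1 hx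
    exact hd w hw x0 hx0
  · intro x hx
    obtain ⟨w, hw, rfl⟩ := Finset.mem_image.1 hx
    exact hP w hw
  · intro x hx x' hx' he
    obtain ⟨w, hw, rfl⟩ := Finset.mem_image.1 (Finset.mem_coe.1 hx)
    obtain ⟨w', hw', rfl⟩ := Finset.mem_image.1 (Finset.mem_coe.1 hx')
    rw [hinj hw hw' he]

/-- Geometric data for a cluster of points. -/
structure Geo {d : ℕ} (S : Sys d) (v : Fin d → ℝ) {k : ℕ} (Λ : ℝ) (n : ℕ) {ι : Type} (E : Finset ι)
    (y : ι → Fin d → ℝ) (ξ c : Fin d → ℝ) (s : ι → ℝ) (P : ι → Fin k → ℝ) : Prop where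
  hv : ∀ i, |v i| ≤ Λ
  hA : ∀ x ∈ E, ∀ i, y x i ∈ S.A i
  hc : ∀ i, 1 / Λ ≤ |c i| ∧ |c i| ≤ Λ
  hs : ∀ x ∈ E, 0 ≤ s x ∧ s x ≤ (1 / 2 : ℝ) ^ n
  hpe : ∀ x ∈ E, ∀ i, |pe v (P x) i| ≤ Λ
  hy : ∀ x ∈ E, ∀ i, |y x i - ξ i - c i * (Real.exp (-(s x * v i)) * pe v (P x) i)| ≤ Λ * (1 / 4 : ℝ) ^ n

lemma exp_bd1 {Λ s v : ℝ} (hΛ : 1 ≤ Λ) (hv : |v| ≤ Λ) (hs : 0 ≤ s) (hs1 : s ≤ 1) :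
    |Real.exp (-(s * v)) - 1| ≤ Λ * Real.exp Λ * s := by
  have h1 := Complex.norm_exp_sub_sum_le_norm_mul_exp ((-(s * v) : ℝ) : ℂ) 1
  simp only [Finset.range_one, Finset.sum_singleton, pow_zero, Nat.factorial_zero, Nat.cast_one,
    div_one, pow_one] at h1
  rw [← Complex.ofReal_exp, ← Complex.ofReal_one, ← Complex.ofReal_sub, Complex.norm_real,
    Complex.norm_real, Real.norm_eq_abs, Real.norm_eq_abs, abs_neg] at h1
  refine h1.trans ?_
  rw [abs_mul, abs_of_nonneg hs]
  have h2 : s * |v| ≤ Λ := by nlinarith [abs_nonneg v]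
  have h3 := Real.exp_le_exp.2 h2
  calc s * |v| * Real.exp (s * |v|) ≤ s * Λ * Real.exp Λ := by gcongr
    _ = _ := by ring

lemma exp_bd2 {Λ s v : ℝ} (hΛ : 1 ≤ Λ) (hv : |v| ≤ Λ) (hs : 0 ≤ s) (hs1 : s ≤ 1) :
    |Real.exp (-(s * v)) - (1 - s * v)| ≤ Λ ^ 2 * Real.exp Λ * s ^ 2 := by
  have h1 := Complex.norm_exp_sub_sum_le_norm_mul_exp ((-(s * v) : ℝ) : ℂ) 2
  simp only [Finset.sum_range_succ, Finset.range_one, Finset.sum_singleton, pow_zero, Nat.factorial_zero, Nat.cast_one,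
    div_one, pow_one, Nat.factorial_one] at h1
  rw [← Complex.ofReal_exp, ← Complex.ofReal_one, ← Complex.ofReal_add, ← Complex.ofReal_sub, Complex.norm_real,
    Complex.norm_real, Real.norm_eq_abs, Real.norm_eq_abs, abs_neg] at h1
  rw [show 1 - s * v = 1 + -(s * v) by ring]
  refine h1.trans ?_
  rw [abs_mul, abs_of_nonneg hs]
  have h2 : s * |v| ≤ Λ := by nlinarith [abs_nonneg v]
  have h3 := Real.exp_le_exp.2 h2
  calc (s * |v|) ^ 2 * Real.exp (s * |v|) ≤ (s * Λ) ^ 2 * Real.exp Λ := by gcongr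
    _ = _ := by ring

/-- the derivative-corrected polynomial -/
def Qp {k : ℕ} (s : ℝ) (P : Fin k → ℝ) : Fin (k + 1) → ℝ :=
  fun j => (Fin.snoc P 0 : Fin (k + 1) → ℝ) j - s * (Fin.cons 0 P : Fin (k + 1) → ℝ) j

lemma pe_Qp {d k : ℕ} (v : Fin d → ℝ) (s : ℝ) (P : Fin k → ℝ) (i : Fin d) :
    pe v (Qp s P) i = (1 - s * v i) * pe v P i := by
  unfold Qp
  rw [pe_sub v (Fin.snoc P 0 : Fin (k + 1) → ℝ), pe_smul]
  have h1 : pe v (Fin.snoc P 0 : Fin (k + 1) → ℝ) i = pe v P i := by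
    unfold pe
    rw [Fin.sum_univ_castSucc]
    simp
  have h2 : pe v (Fin.cons 0 P : Fin (k + 1) → ℝ) i = v i * pe v P i := by
    unfold pe
    rw [Fin.sum_univ_succ, Finset.mul_sum]
    simp only [Fin.cons_zero, zero_mul, Fin.cons_succ, Fin.val_succ, zero_add]
    refine Finset.sum_congr rfl fun j _ => ?_
    ring
  rw [h1, h2]; ring

lemma Qp_last {k : ℕ} (s : ℝ) (P : Fin (k + 1) → ℝ) :
    Qp s P (Fin.last (k + 1)) = - (s * P (Fin.last k)) := by
  unfold Qp
  rw [Fin.snoc_last, ← Fin.succ_last, Fin.cons_succ]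
  ring

section
variable {d : ℕ} {S : Sys d} {v : Fin d → ℝ} {k : ℕ} {Λ : ℝ} {n : ℕ} {ι : Type} {E : Finset ι}
    {y : ι → Fin d → ℝ} {ξ c : Fin d → ℝ} {s : ι → ℝ} {P : ι → Fin k → ℝ}

lemma Geo.s1 (g : Geo S v Λ n E y ξ c s P) (x : ι) (hx : x ∈ E) : s x ≤ 1 :=
  (g.hs x hx).2.trans (pow_le_one₀ (by norm_num) (by norm_num))

lemma quarter_eq (n : ℕ) : (1 / 4 : ℝ) ^ n = (1 / 2 : ℝ) ^ n * (1 / 2 : ℝ) ^ n := by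
  rw [← mul_pow]; norm_num

lemma half_le_one (n : ℕ) : (1 / 2 : ℝ) ^ n ≤ 1 := pow_le_one₀ (by norm_num) (by norm_num)

lemma Geo.first (g : Geo S v Λ n E y ξ c s P) (hΛ : 1 ≤ Λ) (x : ι) (hx : x ∈ E) (i : Fin d) :
    |y x i - ξ i - c i * pe v (P x) i| ≤ (Λ + Λ ^ 3 * Real.exp Λ) * (1 / 2 : ℝ) ^ n := by
  have h1 := g.hy x hx i
  have h2 := exp_bd1 hΛ (g.hv i) (g.hs x hx).1 (g.s1 x hx)
  have e : y x i - ξ i - c i * pe v (P x) i = (y x i - ξ i - c i * (Real.exp (-(s x * v i)) * pe v (P x) i))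
    + c i * ((Real.exp (-(s x * v i)) - 1) * pe v (P x) i) := by ring
  have hh : (0:ℝ) < (1/2:ℝ)^n := by positivity
  rw [e]
  refine (abs_add_le _ _).trans ?_
  rw [abs_mul (c i), abs_mul (_ - _)]
  have h3 : |c i| * (|Real.exp (-(s x * v i)) - 1| * |pe v (P x) i|) ≤
      Λ * ((Λ * Real.exp Λ * (1/2:ℝ)^n) * Λ) := by
    have := (g.hs x hx).2
    gcongr
    · exact (g.hc i).2
    · exact h2.trans (by gcongr)
    · exact g.hpe x hx i
  have h4 : Λ * (1/4:ℝ)^n ≤ Λ * (1/2:ℝ)^n := by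
    rw [quarter_eq]
    have := half_le_one n
    gcongr
    nlinarith
  linarith

lemma Geo.second (g : Geo S v Λ n E y ξ c s P) (hΛ : 1 ≤ Λ) (x : ι) (hx : x ∈ E) (i : Fin d) :
    |y x i - ξ i - c i * pe v (Qp (s x) (P x)) i| ≤ (Λ + Λ ^ 4 * Real.exp Λ) * (1 / 4 : ℝ) ^ n := by
  have h1 := g.hy x hx i
  have h2 := exp_bd2 hΛ (g.hv i) (g.hs x hx).1 (g.s1 x hx)
  have e : y x i - ξ i - c i * pe v (Qp (s x) (P x)) i =
    (y x i - ξ i - c i * (Real.exp (-(s x * v i)) * pe v (P x) i))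
    + c i * ((Real.exp (-(s x * v i)) - (1 - s x * v i)) * pe v (P x) i) := by rw [pe_Qp]; ring
  have hh : (0:ℝ) < (1/2:ℝ)^n := by positivity
  rw [e]
  refine (abs_add_le _ _).trans ?_
  rw [abs_mul (c i), abs_mul (_ - _)]
  have h3 : |c i| * (|Real.exp (-(s x * v i)) - (1 - s x * v i)| * |pe v (P x) i|) ≤
      Λ * ((Λ ^ 2 * Real.exp Λ * ((1/2:ℝ)^n) ^ 2) * Λ) := by
    have := (g.hs x hx).2
    have h0 := (g.hs x hx).1
    gcongr
    · exact (g.hc i).2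
    · exact h2.trans (by gcongr)
    · exact g.hpe x hx i
  have h4 : ((1/2:ℝ)^n)^2 = (1/4:ℝ)^n := by rw [quarter_eq]; ring
  rw [h4] at h3
  linarith

end

lemma geo_b {d : ℕ} {S : Sys d} {v : Fin d → ℝ} {k : ℕ} {β : ℝ} (h : UB S v k β) (Λ : ℝ)
    (hΛ : 1 ≤ Λ) :
    ∃ Kc : ℝ, 1 ≤ Kc ∧ ∀ {ι : Type} (n : ℕ) (E : Finset ι) (y : ι → Fin d → ℝ)
      (ξ c : Fin d → ℝ) (s : ι → ℝ) (P : ι → Fin k → ℝ) (q : Fin d → ℝ),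
      Geo S v Λ n E y ξ c s P → (∀ i, 0 < q i ∧ q i ≤ Λ * 2 ^ n) →
      (Set.InjOn (fun (x : ι) (i : Fin d) => ⌊q i * y x i⌋) E) →
      (E.card : ℝ) ≤ Kc * (2 : ℝ) ^ (β * n) := by
  obtain ⟨Kc, hKc, H⟩ := count_idx h (Λ ^ 2 + Λ ^ 4 * Real.exp Λ) (by
    have : 0 ≤ Λ ^ 4 * Real.exp Λ := by positivity
    nlinarith)
  refine ⟨Kc, hKc, ?_⟩
  intro ι n E y ξ c s P q g hq hinj
  have hΛ0 : 0 < Λ := by linarith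
  have hc1 : ∀ i, 1 ≤ Λ * |c i| := by
    intro i
    have := (g.hc i).1
    rw [div_le_iff₀ hΛ0] at this
    linarith
  have hex : 0 ≤ Λ ^ 4 * Real.exp Λ := by positivity
  refine H n E y ξ c q g.hA ?_ ?_ ?_ ?_ hinj
  · intro i
    refine ⟨lt_of_lt_of_le (by positivity) (g.hc i).1, (g.hc i).2.trans ?_⟩
    nlinarith
  · intro x hx x' hx' i
    have h1 := S.hA i (g.hA x hx i)
    have h2 := S.hA i (g.hA x' hx' i)
    have h3 : |y x i - y x' i| ≤ 1 := by
      rw [abs_le]; constructor <;> linarith [h1.1, h1.2, h2.1, h2.2]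
    refine h3.trans ((hc1 i).trans ?_)
    gcongr
    nlinarith
  · intro x hx
    refine ⟨P x, fun i => (g.first hΛ x hx i).trans ?_⟩
    gcongr
    have := hc1 i
    calc Λ + Λ ^ 3 * Real.exp Λ = (Λ + Λ ^ 3 * Real.exp Λ) * 1 := by ring
      _ ≤ (Λ + Λ ^ 3 * Real.exp Λ) * (Λ * |c i|) := by gcongr
      _ = _ := by ring
  · intro i
    refine ⟨(hq i).1, ?_⟩
    calc q i * (|c i| * (1/2:ℝ)^n) ≤ (Λ * 2^n) * (Λ * (1/2:ℝ)^n) := by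
          gcongr
          · exact (hq i).2
          · exact (g.hc i).2
      _ = Λ ^ 2 * ((2 * (1/2:ℝ))^n) := by rw [mul_pow]; ring
      _ ≤ _ := by norm_num; exact hex

lemma geo_c {d : ℕ} {S : Sys d} {v : Fin d → ℝ} {k : ℕ} {β : ℝ} (h : UB S v (k + 1) β) (Λ : ℝ)
    (hΛ : 1 ≤ Λ) :
    ∃ Kc : ℝ, 1 ≤ Kc ∧ ∀ {ι : Type} (n : ℕ) (E : Finset ι) (y : ι → Fin d → ℝ)
      (ξ c : Fin d → ℝ) (s : ι → ℝ) (P : ι → Fin k → ℝ) (q : Fin d → ℝ),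
      Geo S v Λ n E y ξ c s P → (∀ i, 0 < q i ∧ q i ≤ Λ * 4 ^ n) →
      (∀ x ∈ E, ∀ x' ∈ E, ∀ i, |y x i - y x' i| ≤ Λ * (1 / 2 : ℝ) ^ n) →
      (Set.InjOn (fun (x : ι) (i : Fin d) => ⌊q i * y x i⌋) E) →
      (E.card : ℝ) ≤ Kc * (2 : ℝ) ^ (β * n) := by
  obtain ⟨Kc, hKc, H⟩ := count_idx h (Λ ^ 2 + Λ ^ 5 * Real.exp Λ) (by
    have : 0 ≤ Λ ^ 5 * Real.exp Λ := by positivity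
    nlinarith)
  refine ⟨Kc, hKc, ?_⟩
  intro ι n E y ξ c s P q g hq hd hinj
  have hΛ0 : 0 < Λ := by linarith
  have hc1 : ∀ i, 1 ≤ Λ * |c i| := by
    intro i
    have := (g.hc i).1
    rw [div_le_iff₀ hΛ0] at this
    linarith
  have hex : 0 ≤ Λ ^ 5 * Real.exp Λ := by positivity
  have hh : (0:ℝ) < (1/2:ℝ)^n := by positivity
  have habs : ∀ i, |(1/2:ℝ)^n * c i| = (1/2:ℝ)^n * |c i| := fun i => by
    rw [abs_mul, abs_of_pos hh]
  refine H n E y ξ (fun i => (1/2:ℝ)^n * c i) q g.hA ?_ ?_ ?_ ?_ hinj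
  · intro i
    rw [habs]
    have h0 : 0 < |c i| := lt_of_lt_of_le (by positivity) (g.hc i).1
    refine ⟨by positivity, ?_⟩
    have := half_le_one n
    have := (g.hc i).2
    nlinarith
  · intro x hx x' hx' i
    rw [habs]
    refine (hd x hx x' hx' i).trans ?_
    calc Λ * (1/2:ℝ)^n = Λ * (1/2:ℝ)^n * 1 := by ring
      _ ≤ Λ * (1/2:ℝ)^n * (Λ * |c i|) := by gcongr; exact hc1 i
      _ = Λ ^ 2 * ((1/2:ℝ)^n * |c i|) := by ring
      _ ≤ _ := by gcongr; linarith
  · intro x hx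
    refine ⟨fun j => 2 ^ n * Qp (s x) (P x) j, fun i => ?_⟩
    rw [habs, pe_smul]
    have e : (1/2:ℝ)^n * c i * (2 ^ n * pe v (Qp (s x) (P x)) i) = c i * pe v (Qp (s x) (P x)) i := by
      have : (1/2:ℝ)^n * 2 ^ n = 1 := by rw [← mul_pow]; norm_num
      linear_combination c i * pe v (Qp (s x) (P x)) i * this
    rw [e]
    refine (g.second hΛ x hx i).trans ?_
    rw [quarter_eq]
    calc (Λ + Λ ^ 4 * Real.exp Λ) * ((1/2:ℝ)^n * (1/2:ℝ)^n) = (Λ + Λ ^ 4 * Real.exp Λ) * 1 * ((1/2:ℝ)^n * (1/2:ℝ)^n) := by ring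
      _ ≤ (Λ + Λ ^ 4 * Real.exp Λ) * (Λ * |c i|) * ((1/2:ℝ)^n * (1/2:ℝ)^n) := by gcongr; exact hc1 i
      _ = _ := by ring
  · intro i
    refine ⟨(hq i).1, ?_⟩
    rw [habs]
    calc q i * ((1/2:ℝ)^n * |c i| * (1/2:ℝ)^n) ≤ (Λ * 4^n) * ((1/2:ℝ)^n * Λ * (1/2:ℝ)^n) := by
          gcongr
          · exact (hq i).2
          · exact (g.hc i).2
      _ = Λ ^ 2 * ((4 * (1/2:ℝ) * (1/2:ℝ))^n) := by rw [mul_pow, mul_pow]; ring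
      _ ≤ _ := by norm_num; exact hex

lemma geo_d {d : ℕ} (S : Sys d) {v : Fin d → ℝ} (hv : Function.Injective v) {k : ℕ} (hk : k + 2 ≤ d) (Λ : ℝ)
    (hΛ : 1 ≤ Λ) :
    ∃ C : ℝ, 1 ≤ C ∧ ∀ {ι : Type} (n : ℕ) (E : Finset ι) (y : ι → Fin d → ℝ)
      (ξ c : Fin d → ℝ) (s : ι → ℝ) (P : ι → Fin (k + 1) → ℝ) (ρ : ℝ),
      Geo S v Λ n E y ξ c s P →
      (∀ x ∈ E, ∀ x' ∈ E, ∀ i, |y x i - y x' i| ≤ Λ * (1 / 4 : ℝ) ^ n) →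
      0 < ρ → (∀ x ∈ E, ρ ≤ |P x (Fin.last k)|) →
      ∀ x ∈ E, ∀ x' ∈ E, |s x - s x'| ≤ C / ρ * (1 / 4 : ℝ) ^ n := by
  obtain ⟨C1, hC1, H1⟩ := vander hv (k := k + 1) (by omega)
  obtain ⟨C2, hC2, H2⟩ := vander hv (k := k + 2) (by omega)
  have hΛ0 : 0 < Λ := by linarith
  set B1 := Λ * (Λ + 2 * (Λ + Λ ^ 3 * Real.exp Λ)) with hB1
  set B2 := Λ * (Λ + 2 * (Λ + Λ ^ 4 * Real.exp Λ)) with hB2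
  have hB1p : 1 ≤ B1 := by
    have : 0 ≤ Λ ^ 3 * Real.exp Λ := by positivity
    nlinarith
  have hB2p : 1 ≤ B2 := by
    have : 0 ≤ Λ ^ 4 * Real.exp Λ := by positivity
    nlinarith
  refine ⟨C1 * B1 + C2 * B2, by nlinarith, ?_⟩
  intro ι n E y ξ c s P ρ g hd hρ hP x hx x' hx'
  have hc1 : ∀ i, 1 ≤ Λ * |c i| := by
    intro i
    have := (g.hc i).1
    rw [div_le_iff₀ hΛ0] at this
    linarith
  have hh : (0:ℝ) < (1/2:ℝ)^n := by positivity
  have key : ∀ (a b e e' : ℝ) (i : Fin d), |y x i - ξ i - c i * a| ≤ e → |y x' i - ξ i - c i * b| ≤ e →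
      |y x i - y x' i| ≤ e' → |a - b| ≤ Λ * (e' + 2 * e) := by
    intro a b e e' i h1 h2 h3
    have h4 : |c i| * |a - b| ≤ e' + 2 * e := by
      rw [← abs_mul]
      rw [abs_le] at h1 h2 h3 ⊢
      constructor <;> linarith [h1.1, h1.2, h2.1, h2.2, h3.1, h3.2]
    calc |a - b| = 1 * |a - b| := by ring
      _ ≤ (Λ * |c i|) * |a - b| := by gcongr; exact hc1 i
      _ = Λ * (|c i| * |a - b|) := by ring
      _ ≤ _ := by gcongr
  have q1 : ∀ i, |pe v (fun j => P x j - P x' j) i| ≤ B1 * (1/2:ℝ)^n := by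
    intro i
    rw [pe_sub]
    refine (key _ _ _ _ i (g.first hΛ x hx i) (g.first hΛ x' hx' i) ((hd x hx x' hx' i).trans
      (b := Λ * (1/4:ℝ)^n) (c := Λ * (1/2:ℝ)^n) ?_)).trans ?_
    · rw [quarter_eq]
      have := half_le_one n
      gcongr
      nlinarith
    · rw [hB1]; apply le_of_eq; ring
  have q2 : ∀ i, |pe v (fun j => Qp (s x) (P x) j - Qp (s x') (P x') j) i| ≤ B2 * (1/4:ℝ)^n := by
    intro i
    rw [pe_sub]
    refine (key _ _ _ _ i (g.second hΛ x hx i) (g.second hΛ x' hx' i) (hd x hx x' hx' i)).trans ?_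
    · rw [hB2]; apply le_of_eq; ring
  have r1 := H1 _ _ q1 (Fin.last k)
  have r2 := H2 _ _ q2 (Fin.last (k+1))
  simp only [Qp_last] at r1 r2
  have hs' := g.hs x' hx'
  have hp := hP x hx
  set a := P x (Fin.last k)
  set b := P x' (Fin.last k)
  have e : (s x - s x') * a = (s x * a - s x' * b) - s x' * (a - b) := by ring
  have h5 : |s x - s x'| * |a| ≤ (C1 * B1 + C2 * B2) * (1/4:ℝ)^n := by
    rw [← abs_mul, e]
    refine (abs_sub _ _).trans ?_
    have h6 : |s x * a - s x' * b| ≤ C2 * (B2 * (1/4:ℝ)^n) := by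
      rw [← abs_neg]; refine le_trans (le_of_eq ?_) r2; congr 1; ring
    have h7 : |s x' * (a - b)| ≤ (1/2:ℝ)^n * (C1 * (B1 * (1/2:ℝ)^n)) := by
      rw [abs_mul, abs_of_nonneg hs'.1]
      gcongr
      exact hs'.2
    rw [quarter_eq] at h6 ⊢
    linarith
  rw [div_mul_eq_mul_div, le_div_iff₀ hρ]
  refine le_trans ?_ h5
  gcongr

lemma count_drop {d : ℕ} {S : Sys d} {v : Fin d → ℝ} {k : ℕ} {β : ℝ} (h : UB S v k β) (Λ : ℝ)
    (hΛ : 1 ≤ Λ) :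
    ∃ Kc : ℝ, 1 ≤ Kc ∧ ∀ {ι : Type} (n : ℕ) (E : Finset ι) (y : ι → Fin d → ℝ)
      (ξ c : Fin d → ℝ) (P : ι → Fin (k + 1) → ℝ) (q : Fin d → ℝ),
      (∀ i, |v i| ≤ Λ) → (∀ x ∈ E, ∀ i, y x i ∈ S.A i) → (∀ i, 1 / Λ ≤ |c i| ∧ |c i| ≤ Λ) →
      (∀ x ∈ E, ∀ i, |y x i - ξ i - c i * pe v (P x) i| ≤ Λ * (1 / 2 : ℝ) ^ n) →
      (∀ x ∈ E, |P x (Fin.last k)| ≤ (1 / 2 : ℝ) ^ n) →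
      (∀ i, 0 < q i ∧ q i ≤ Λ * 2 ^ n) →
      (Set.InjOn (fun (x : ι) (i : Fin d) => ⌊q i * y x i⌋) E) →
      (E.card : ℝ) ≤ Kc * (2 : ℝ) ^ (β * n) := by
  have hΛ0 : 0 < Λ := by linarith
  obtain ⟨Kc, hKc, H⟩ := count_idx h (Λ * (Λ + Λ * Λ ^ k)) (by
    have : 0 ≤ Λ * Λ ^ k := by positivity
    nlinarith)
  refine ⟨Kc, hKc, ?_⟩
  intro ι n E y ξ c P q hv hA hc hP hl hq hinj
  have hc1 : ∀ i, 1 ≤ Λ * |c i| := by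
    intro i
    have := (hc i).1
    rw [div_le_iff₀ hΛ0] at this
    linarith
  have hex : 0 ≤ Λ * Λ ^ k := by positivity
  have hh : (0:ℝ) < (1/2:ℝ)^n := by positivity
  refine H n E y ξ c q hA ?_ ?_ ?_ ?_ hinj
  · intro i
    refine ⟨lt_of_lt_of_le (by positivity) (hc i).1, (hc i).2.trans ?_⟩
    nlinarith
  · intro x hx x' hx' i
    have h1 := S.hA i (hA x hx i)
    have h2 := S.hA i (hA x' hx' i)
    have h3 : |y x i - y x' i| ≤ 1 := by
      rw [abs_le]; constructor <;> linarith [h1.1, h1.2, h2.1, h2.2]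
    refine h3.trans ((hc1 i).trans ?_)
    gcongr
    nlinarith
  · intro x hx
    refine ⟨fun j => P x j.castSucc, fun i => ?_⟩
    have e : pe v (P x) i = pe v (fun j : Fin k => P x j.castSucc) i + P x (Fin.last k) * v i ^ k := by
      unfold pe
      rw [Fin.sum_univ_castSucc]
      simp
    have h1 := hP x hx i
    rw [e] at h1
    have e2 : y x i - ξ i - c i * pe v (fun j : Fin k => P x j.castSucc) i =
      (y x i - ξ i - c i * (pe v (fun j : Fin k => P x j.castSucc) i + P x (Fin.last k) * v i ^ k))
      + c i * (P x (Fin.last k) * v i ^ k) := by ring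
    rw [e2]
    refine (abs_add_le _ _).trans ?_
    have h2 : |c i * (P x (Fin.last k) * v i ^ k)| ≤ Λ * ((1/2:ℝ)^n * Λ ^ k) := by
      rw [abs_mul, abs_mul, abs_pow]
      gcongr
      · exact (hc i).2
      · exact hl x hx
      · exact hv i
    calc _ ≤ Λ * (1/2:ℝ)^n + Λ * ((1/2:ℝ)^n * Λ ^ k) := add_le_add h1 h2
      _ = (Λ + Λ * Λ ^ k) * 1 * (1/2:ℝ)^n := by ring
      _ ≤ (Λ + Λ * Λ ^ k) * (Λ * |c i|) * (1/2:ℝ)^n := by gcongr; exact hc1 i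
      _ = _ := by ring
  · intro i
    refine ⟨(hq i).1, ?_⟩
    calc q i * (|c i| * (1/2:ℝ)^n) ≤ (Λ * 2^n) * (Λ * (1/2:ℝ)^n) := by
          gcongr
          · exact (hq i).2
          · exact (hc i).2
      _ = Λ ^ 2 * ((2 * (1/2:ℝ))^n) := by rw [mul_pow]; ring
      _ ≤ _ := by norm_num; nlinarith

lemma count_plain {d : ℕ} {S : Sys d} {v : Fin d → ℝ} {k : ℕ} {β : ℝ} (h : UB S v k β) (Λ : ℝ)
    (hΛ : 1 ≤ Λ) :
    ∃ Kc : ℝ, 1 ≤ Kc ∧ ∀ {ι : Type} (n : ℕ) (E : Finset ι) (y : ι → Fin d → ℝ)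
      (ξ c : Fin d → ℝ) (P : ι → Fin k → ℝ) (q : Fin d → ℝ),
      (∀ x ∈ E, ∀ i, y x i ∈ S.A i) → (∀ i, 1 / Λ ≤ |c i| ∧ |c i| ≤ Λ) →
      (∀ x ∈ E, ∀ i, |y x i - ξ i - c i * pe v (P x) i| ≤ Λ * (1 / 2 : ℝ) ^ n) →
      (∀ i, 0 < q i ∧ q i ≤ Λ * 2 ^ n) →
      (Set.InjOn (fun (x : ι) (i : Fin d) => ⌊q i * y x i⌋) E) →
      (E.card : ℝ) ≤ Kc * (2 : ℝ) ^ (β * n) := by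
  have hΛ0 : 0 < Λ := by linarith
  obtain ⟨Kc, hKc, H⟩ := count_idx h (Λ * Λ) (by nlinarith)
  refine ⟨Kc, hKc, ?_⟩
  intro ι n E y ξ c P q hA hc hP hq hinj
  have hc1 : ∀ i, 1 ≤ Λ * |c i| := by
    intro i
    have := (hc i).1
    rw [div_le_iff₀ hΛ0] at this
    linarith
  refine H n E y ξ c q hA ?_ ?_ ?_ ?_ hinj
  · intro i
    refine ⟨lt_of_lt_of_le (by positivity) (hc i).1, (hc i).2.trans ?_⟩
    nlinarith
  · intro x hx x' hx' i
    have h1 := S.hA i (hA x hx i)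
    have h2 := S.hA i (hA x' hx' i)
    have h3 : |y x i - y x' i| ≤ 1 := by
      rw [abs_le]; constructor <;> linarith [h1.1, h1.2, h2.1, h2.2]
    refine h3.trans ((hc1 i).trans ?_)
    gcongr
    nlinarith
  · intro x hx
    refine ⟨P x, fun i => (hP x hx i).trans ?_⟩
    calc _ = Λ * 1 * (1/2:ℝ)^n := by ring
      _ ≤ Λ * (Λ * |c i|) * (1/2:ℝ)^n := by gcongr; exact hc1 i
      _ = _ := by ring
  · intro i
    refine ⟨(hq i).1, ?_⟩
    calc q i * (|c i| * (1/2:ℝ)^n) ≤ (Λ * 2^n) * (Λ * (1/2:ℝ)^n) := by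
          gcongr
          · exact (hq i).2
          · exact (hc i).2
      _ = Λ ^ 2 * ((2 * (1/2:ℝ))^n) := by rw [mul_pow]; ring
      _ ≤ _ := by norm_num; nlinarith

lemma UB_zero {d : ℕ} (S : Sys d) (v : Fin d → ℝ) : UB S v 0 0 := by
  classical
  refine ⟨(5 : ℝ) ^ d + 1, by positivity, ?_⟩
  intro n E ⟨hA, ⟨b, c, hc, hP⟩, hsep⟩
  have hh : (0:ℝ) < (1/2:ℝ)^n := by positivity
  have h2n : (2:ℝ)^n * (1/2:ℝ)^n = 1 := by rw [← mul_pow]; norm_num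
  have h1 : ∀ x ∈ E, (fun i => ⌊(2:ℝ)^n * x i⌋ - ⌊(2:ℝ)^n * b i⌋) ∈
      Fintype.piFinset (fun _ : Fin d => Finset.Icc (-(⌈(1:ℝ)⌉ + 1)) (⌈(1:ℝ)⌉ + 1)) := by
    intro x hx
    rw [Fintype.mem_piFinset]
    intro i
    apply floor_range
    obtain ⟨P, hP⟩ := hP x hx
    have := hP i
    have e : pe v P i = 0 := by simp [pe]
    rw [e, mul_zero, sub_zero] at this
    rw [← mul_sub, abs_mul, abs_of_pos (by positivity), ← h2n]
    gcongr
  have h2 : Set.InjOn (fun (x : Fin d → ℝ) i => ⌊(2:ℝ)^n * x i⌋ - ⌊(2:ℝ)^n * b i⌋) E := by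
    intro x hx y hy he
    by_contra hne
    obtain ⟨i, hi⟩ := hsep x hx y hy hne
    have h3 := congrFun he i
    simp only [sub_left_inj] at h3
    have h4 := Int.abs_sub_lt_one_of_floor_eq_floor h3
    rw [← mul_sub, abs_mul, abs_of_pos (by positivity)] at h4
    have : (2:ℝ)^n * (1/2:ℝ)^n ≤ (2:ℝ)^n * |x i - y i| := by gcongr
    linarith
  have h3 := Finset.card_le_card_of_injOn _ h1 h2
  rw [Fintype.card_piFinset] at h3
  simp at h3
  have h4 : (E.card : ℝ) ≤ (5:ℝ)^d := by exact_mod_cast h3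
  simp
  linarith
end Part6

section Part7
section levels
variable {d : ℕ} (S : Sys d)

/-- number of base `p i` digits matching `m` bits -/
def lv (m : ℕ) (i : Fin d) : ℕ := Nat.log (S.p i) (2 ^ m)

def qq (m : ℕ) (i : Fin d) : ℝ := (S.p i : ℝ) ^ lv S m i

def TT (m : ℕ) (x : Fin d → ℝ) (i : Fin d) : ℝ := Int.fract (qq S m i * x i)

def DD (m : ℕ) (x : Fin d → ℝ) (i : Fin d) : ℤ := ⌊qq S m i * x i⌋

def dl (m n : ℕ) (i : Fin d) : ℕ := lv S (m + n) i - lv S m i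

def WW (m n : ℕ) (x : Fin d → ℝ) (i : Fin d) : ℕ × ℤ :=
  (dl S m n i, ⌊(S.p i : ℝ) ^ dl S m n i * TT S m x i⌋)

def ww (m : ℕ) (i : Fin d) : ℝ := qq S m i / 2 ^ m

lemma p_pos (i : Fin d) : (0 : ℝ) < S.p i := by
  have := S.hp i
  positivity

lemma p_ge (i : Fin d) : (2 : ℝ) ≤ S.p i := by
  exact_mod_cast S.hp i

lemma qq_pos (m : ℕ) (i : Fin d) : 0 < qq S m i := pow_pos (p_pos S i) _

lemma qq_le (m : ℕ) (i : Fin d) : qq S m i ≤ 2 ^ m := by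
  unfold qq lv
  exact_mod_cast Nat.pow_log_le_self (S.p i) (by positivity)

lemma lt_qq (m : ℕ) (i : Fin d) : (2 : ℝ) ^ m < S.p i * qq S m i := by
  unfold qq lv
  have := Nat.lt_pow_succ_log_self (b := S.p i) (S.hp i) (2 ^ m)
  rw [Nat.succ_eq_add_one, pow_succ'] at this
  exact_mod_cast this

lemma lv_le (m n : ℕ) (i : Fin d) : lv S m i ≤ lv S (m + n) i := by
  unfold lv
  apply Nat.log_mono_right
  exact Nat.pow_le_pow_right (by norm_num) (by omega)

lemma lv_add (m n : ℕ) (i : Fin d) : lv S (m + n) i = lv S m i + dl S m n i := by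
  unfold dl
  have := lv_le S m n i
  omega

lemma dl_add (m n n' : ℕ) (i : Fin d) : dl S m (n + n') i = dl S m n i + dl S (m + n) n' i := by
  have h1 := lv_add S m (n + n') i
  have h2 := lv_add S m n i
  have h3 := lv_add S (m + n) n' i
  rw [← add_assoc] at h1
  omega

lemma qq_add (m n : ℕ) (i : Fin d) : qq S (m + n) i = (S.p i : ℝ) ^ dl S m n i * qq S m i := by
  unfold qq
  rw [lv_add, pow_add, mul_comm]

lemma pdl_le (m n : ℕ) (i : Fin d) : (S.p i : ℝ) ^ dl S m n i ≤ S.p i * 2 ^ n := by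
  have h1 := qq_le S (m + n) i
  rw [qq_add, pow_add] at h1
  have h2 := lt_qq S m i
  have h3 := qq_pos S m i
  by_contra hc
  push Not at hc
  have h5 : (S.p i * 2 ^ n) * qq S m i < (S.p i : ℝ) ^ dl S m n i * qq S m i := by gcongr
  have h6 : (2:ℝ) ^ m * 2 ^ n < (S.p i * qq S m i) * 2 ^ n := by gcongr
  linarith

lemma le_pdl (m n : ℕ) (i : Fin d) : (2 : ℝ) ^ n ≤ S.p i * (S.p i : ℝ) ^ dl S m n i := by
  have h1 := lt_qq S (m + n) i
  rw [qq_add, pow_add] at h1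
  have h2 := qq_le S m i
  have h3 := p_pos S i
  by_contra hc
  push Not at hc
  have h5 : S.p i * (S.p i : ℝ) ^ dl S m n i * qq S m i ≤ 2 ^ n * 2 ^ m := by
    have := (qq_pos S m i).le
    gcongr
  linarith

lemma TT_add (m n : ℕ) (x : Fin d → ℝ) (i : Fin d) :
    TT S (m + n) x i = Int.fract ((S.p i : ℝ) ^ dl S m n i * TT S m x i) := by
  unfold TT
  rw [qq_add]
  have := fract_mul_fract ((S.p i : ℤ) ^ dl S m n i) (qq S m i * x i)
  push_cast at this
  rw [this, mul_assoc]

lemma TT_nonneg (m : ℕ) (x : Fin d → ℝ) (i : Fin d) : 0 ≤ TT S m x i := Int.fract_nonneg _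
lemma TT_lt (m : ℕ) (x : Fin d → ℝ) (i : Fin d) : TT S m x i < 1 := Int.fract_lt_one _

lemma TT_mem (m : ℕ) (x : Fin d → ℝ) (i : Fin d) (h : x i ∈ S.A i) : TT S m x i ∈ S.A i :=
  S.hpow i _ _ h

lemma DD_add (m n : ℕ) (x : Fin d → ℝ) (i : Fin d) :
    DD S (m + n) x i = (S.p i : ℤ) ^ dl S m n i * DD S m x i + (WW S m n x i).2 := by
  unfold DD WW TT
  rw [qq_add, mul_assoc]
  have := floor_split (S.p i ^ dl S m n i) (qq S m i * x i)
  push_cast at this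
  exact this

lemma WW_snd_nonneg (m n : ℕ) (x : Fin d → ℝ) (i : Fin d) : 0 ≤ (WW S m n x i).2 := by
  apply Int.floor_nonneg.2
  have := TT_nonneg S m x i
  positivity

lemma WW_snd_lt (m n : ℕ) (x : Fin d → ℝ) (i : Fin d) :
    (WW S m n x i).2 < (S.p i : ℤ) ^ dl S m n i := by
  apply Int.floor_lt.2
  push_cast
  have := TT_lt S m x i
  have h := pow_pos (p_pos S i) (dl S m n i)
  nlinarith

lemma DD_eq_iff (m n : ℕ) (x x' : Fin d → ℝ) :
    DD S (m + n) x = DD S (m + n) x' ↔ DD S m x = DD S m x' ∧ WW S m n x = WW S m n x' := by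
  constructor
  · intro h
    have key : ∀ i, DD S m x i = DD S m x' i ∧ (WW S m n x i).2 = (WW S m n x' i).2 := by
      intro i
      have h1 := congrFun h i
      rw [DD_add, DD_add] at h1
      have hp : (0 : ℤ) < (S.p i : ℤ) ^ dl S m n i := by
        have := S.hp i
        positivity
      have a := WW_snd_nonneg S m n x i
      have a' := WW_snd_nonneg S m n x' i
      have b := WW_snd_lt S m n x i
      have b' := WW_snd_lt S m n x' i
      have h2 := congrArg (fun z : ℤ => z / (S.p i : ℤ) ^ dl S m n i) h1
      rw [Int.mul_add_ediv_left _ _ hp.ne', Int.mul_add_ediv_left _ _ hp.ne',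
        Int.ediv_eq_zero_of_lt a b, Int.ediv_eq_zero_of_lt a' b'] at h2
      have h3 : DD S m x i = DD S m x' i := by simpa using h2
      refine ⟨h3, ?_⟩
      rw [h3] at h1
      linarith
    exact ⟨funext fun i => (key i).1, funext fun i => Prod.ext rfl (key i).2⟩
  · rintro ⟨h1, h2⟩
    funext i
    rw [DD_add, DD_add, h1, h2]

lemma WW_concat {m m' n n' : ℕ} {x x' : Fin d → ℝ} (h1 : WW S m n x = WW S m' n x')
    (h2 : WW S (m + n) n' x = WW S (m' + n) n' x') : WW S m (n + n') x = WW S m' (n + n') x' := by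
  funext i
  have a1 := congrFun h1 i
  have a2 := congrFun h2 i
  unfold WW at a1 a2 ⊢
  obtain ⟨b1, c1⟩ := Prod.ext_iff.1 a1
  obtain ⟨b2, c2⟩ := Prod.ext_iff.1 a2
  simp only at b1 c1 b2 c2
  rw [TT_add, TT_add, ← b2, ← b1] at c2
  rw [← b1] at c1
  rw [dl_add, dl_add, ← b1, ← b2]
  refine Prod.ext rfl ?_
  simp only
  have e : ∀ t : ℝ, ⌊(S.p i : ℝ) ^ (dl S m n i + dl S (m + n) n' i) * t⌋ =
      (S.p i : ℤ) ^ dl S (m + n) n' i * ⌊(S.p i : ℝ) ^ (dl S m n i) * t⌋ +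
      ⌊(S.p i : ℝ) ^ dl S (m + n) n' i * Int.fract ((S.p i : ℝ) ^ (dl S m n i) * t)⌋ := by
    intro t
    have := floor_split (S.p i ^ dl S (m + n) n' i) ((S.p i : ℝ) ^ (dl S m n i) * t)
    push_cast at this
    rw [← this, pow_add]
    congr 1
    ring
  rw [e, e, c1, c2]

lemma WW_concat_many {m m' n : ℕ} {x x' : Fin d → ℝ} (R : ℕ)
    (h : ∀ j < R, WW S (m + n * j) n x = WW S (m' + n * j) n x') :
    WW S m (n * R) x = WW S m' (n * R) x' := by
  induction R with
  | zero =>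
    funext i
    simp only [mul_zero, WW, dl, add_zero, Nat.sub_self, pow_zero, one_mul]
    have : ∀ m x, ⌊TT S m x i⌋ = 0 := fun m x => Int.floor_eq_zero_iff.2 ⟨TT_nonneg S m x i, TT_lt S m x i⟩
    rw [this, this]
  | succ R ih =>
    rw [mul_add, mul_one]
    exact WW_concat S (ih fun j hj => h j (by omega)) (h R (by omega))

lemma WW_close {m m' n : ℕ} {x x' : Fin d → ℝ} (h : WW S m n x = WW S m' n x') (i : Fin d) :
    |TT S m x i - TT S m' x' i| ≤ S.p i * (1 / 2 : ℝ) ^ n := by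
  have a1 := congrFun h i
  unfold WW at a1
  obtain ⟨b1, c1⟩ := Prod.ext_iff.1 a1
  simp only at b1 c1
  rw [← b1] at c1
  have h1 := Int.abs_sub_lt_one_of_floor_eq_floor c1
  rw [← mul_sub, abs_mul, abs_of_pos (pow_pos (p_pos S i) _)] at h1
  have h2 := le_pdl S m n i
  have h3 : (2:ℝ)^n * (1/2:ℝ)^n = 1 := by rw [← mul_pow]; norm_num
  set a := |TT S m x i - TT S m' x' i| with ha
  have ha0 : 0 ≤ a := abs_nonneg _
  have h4 : 2 ^ n * a ≤ S.p i := by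
    calc 2 ^ n * a ≤ S.p i * (S.p i : ℝ) ^ dl S m n i * a := by gcongr
      _ = S.p i * ((S.p i : ℝ) ^ dl S m n i * a) := by ring
      _ ≤ S.p i * 1 := by
        have := p_pos S i
        gcongr
      _ = _ := mul_one _
  calc a = (2 ^ n * a) * (1/2:ℝ)^n := by rw [mul_comm _ a, mul_assoc, h3, mul_one]
    _ ≤ _ := by gcongr

/-- bound for the number of names -/
def nameN (n : ℕ) : ℕ := ∏ i, (S.p i * 2 ^ n) ^ 2

lemma nameN_pos (n : ℕ) : 0 < nameN S n := by
  unfold nameN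
  refine Finset.prod_pos fun i _ => ?_
  have := S.hp i
  positivity

lemma dl_lt (m n : ℕ) (i : Fin d) : dl S m n i < S.p i * 2 ^ n := by
  have h1 := pdl_le S m n i
  have h2 : S.p i ^ dl S m n i ≤ S.p i * 2 ^ n := by exact_mod_cast h1
  exact lt_of_lt_of_le (Nat.lt_pow_self (S.hp i)) h2

lemma WW_count {ι : Type*} (n : ℕ) (E : Finset ι) (m : ι → ℕ) (x : ι → Fin d → ℝ)
    (h : Set.InjOn (fun w => WW S (m w) n (x w)) E) : (E.card : ℝ) ≤ nameN S n := by
  classical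
  have h1 : ∀ w ∈ E, WW S (m w) n (x w) ∈ Fintype.piFinset (fun i : Fin d =>
      Finset.range (S.p i * 2 ^ n) ×ˢ Finset.Ico (0 : ℤ) (S.p i * 2 ^ n)) := by
    intro w _
    rw [Fintype.mem_piFinset]
    intro i
    rw [Finset.mem_product, Finset.mem_range, Finset.mem_Ico]
    refine ⟨dl_lt S _ _ _, WW_snd_nonneg S _ _ _ _, lt_of_lt_of_le (WW_snd_lt S _ _ _ _) ?_⟩
    exact_mod_cast pdl_le S (m w) n i
  have h2 := Finset.card_le_card_of_injOn _ h1 h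
  rw [Fintype.card_piFinset] at h2
  unfold nameN
  refine Nat.cast_le.2 (h2.trans (le_of_eq ?_))
  refine Finset.prod_congr rfl fun i _ => ?_
  rw [Finset.card_product, Finset.card_range, Int.card_Ico, sq]
  congr 1

lemma DD_count {ι : Type*} (n : ℕ) (E : Finset ι) (x : ι → Fin d → ℝ) (hx : ∀ w ∈ E, ∀ i, x w i ∈ S.A i)
    (h : Set.InjOn (fun w => DD S n (x w)) E) : (E.card : ℝ) ≤ ((2 : ℝ) ^ n) ^ d := by
  classical
  have h1 : ∀ w ∈ E, DD S n (x w) ∈ Fintype.piFinset (fun _ : Fin d =>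
      Finset.Ico (0 : ℤ) (2 ^ n)) := by
    intro w hw
    rw [Fintype.mem_piFinset]
    intro i
    have h3 := S.hA i (hx w hw i)
    have h4 := qq_pos S n i
    have h5 := qq_le S n i
    rw [Finset.mem_Ico]
    unfold DD
    refine ⟨Int.floor_nonneg.2 (mul_nonneg h4.le h3.1), Int.floor_lt.2 ?_⟩
    push_cast
    nlinarith [h3.1, h3.2]
  have h2 := Finset.card_le_card_of_injOn _ h1 h
  rw [Fintype.card_piFinset] at h2
  have h3 : E.card ≤ (2 ^ n) ^ d := by
    refine h2.trans (le_of_eq ?_)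
    simp
    norm_cast
  exact_mod_cast h3

lemma dl_two (m n : ℕ) (i : Fin d) : dl S m n i = lv S n i ∨ dl S m n i = lv S n i + 1 := by
  have h0 := lv_add S m n i
  have hp := S.hp i
  have h1 : lv S m i + lv S n i ≤ lv S (m + n) i := by
    unfold lv
    apply Nat.le_log_of_pow_le hp
    rw [pow_add, pow_add]
    exact Nat.mul_le_mul (Nat.pow_log_le_self _ (by positivity)) (Nat.pow_log_le_self _ (by positivity))
  have h2 : lv S (m + n) i < lv S m i + lv S n i + 2 := by
    unfold lv
    apply Nat.log_lt_of_lt_pow (by positivity)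
    have e : Nat.log (S.p i) (2 ^ m) + Nat.log (S.p i) (2 ^ n) + 2 =
      (Nat.log (S.p i) (2 ^ m)).succ + (Nat.log (S.p i) (2 ^ n)).succ := by omega
    rw [e, pow_add, pow_add]
    exact Nat.mul_lt_mul'' (Nat.lt_pow_succ_log_self hp _) (Nat.lt_pow_succ_log_self hp _)
  omega

lemma ww_pos (m : ℕ) (i : Fin d) : 0 < ww S m i := div_pos (qq_pos S m i) (by positivity)

lemma ww_le (m : ℕ) (i : Fin d) : ww S m i ≤ 1 := by
  unfold ww
  rw [div_le_one (by positivity)]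
  exact qq_le S m i

lemma ww_ge (m : ℕ) (i : Fin d) : 1 / S.p i ≤ ww S m i := by
  unfold ww
  rw [div_le_div_iff₀ (p_pos S i) (by positivity)]
  linarith [lt_qq S m i]

/-- discretised phase -/
def YY (n m : ℕ) (i : Fin d) : ℤ := ⌊(4 : ℝ) ^ n * ww S m i⌋

lemma YY_count {ι : Type*} (n : ℕ) (E : Finset ι) (m : ι → ℕ)
    (h : Set.InjOn (fun w => YY S n (m w)) E) : (E.card : ℝ) ≤ ((4 : ℝ) ^ n + 1) ^ d := by
  classical
  have h1 : ∀ w ∈ E, YY S n (m w) ∈ Fintype.piFinset (fun _ : Fin d =>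
      Finset.Ico (0 : ℤ) (4 ^ n + 1)) := by
    intro w hw
    rw [Fintype.mem_piFinset]
    intro i
    have h4 := ww_pos S (m w) i
    have h5 := ww_le S (m w) i
    rw [Finset.mem_Ico]
    unfold YY
    refine ⟨Int.floor_nonneg.2 (by positivity), Int.floor_lt.2 ?_⟩
    push_cast
    have : (0:ℝ) < 4 ^ n := by positivity
    nlinarith
  have h2 := Finset.card_le_card_of_injOn _ h1 h
  rw [Fintype.card_piFinset] at h2
  have h3 : E.card ≤ (4 ^ n + 1) ^ d := by
    refine h2.trans (le_of_eq ?_)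
    simp
    norm_cast
  exact_mod_cast h3

def phN : ℕ := ∏ i, 2 * (2 * S.p i + 3)

lemma phN_pos : 0 < phN S := Finset.prod_pos fun i _ => by positivity

lemma YY_step {ι : Type*} (n a : ℕ) (E : Finset ι) (m : ι → ℕ) (z : Fin d → ℤ)
    (hz : ∀ w ∈ E, YY S n (m w) = z)
    (h : Set.InjOn (fun w => YY S n (m w + a)) E) : (E.card : ℝ) ≤ phN S := by
  classical
  let f : ι → Fin d → ℕ × ℤ := fun w i => (dl S (m w) a i - lv S a i,
    YY S n (m w + a) i - ⌊(S.p i : ℝ) ^ dl S (m w) a i / 2 ^ a * z i⌋)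
  have h1 : ∀ w ∈ E, f w ∈ Fintype.piFinset (fun i : Fin d =>
      Finset.range 2 ×ˢ Finset.Icc (-(⌈(S.p i : ℝ)⌉ + 1)) (⌈(S.p i : ℝ)⌉ + 1)) := by
    intro w hw
    rw [Fintype.mem_piFinset]
    intro i
    rw [Finset.mem_product, Finset.mem_range]
    refine ⟨?_, ?_⟩
    · have := dl_two S (m w) a i
      simp only [f]
      omega
    · simp only [f, YY]
      apply floor_range
      have h2 : (z i : ℝ) = ⌊(4 : ℝ) ^ n * ww S (m w) i⌋ := by
        rw [← hz w hw]; rfl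
      have h3 : ww S (m w + a) i = (S.p i : ℝ) ^ dl S (m w) a i / 2 ^ a * ww S (m w) i := by
        unfold ww
        rw [qq_add, pow_add]
        field_simp
      rw [h3, h2]
      have h4 : (S.p i : ℝ) ^ dl S (m w) a i / 2 ^ a ≤ S.p i := by
        rw [div_le_iff₀ (by positivity)]
        exact pdl_le S (m w) a i
      set u := (S.p i : ℝ) ^ dl S (m w) a i / 2 ^ a
      have hu : 0 ≤ u := by positivity
      have h5 := Int.floor_le ((4 : ℝ) ^ n * ww S (m w) i)
      have h6 := Int.lt_floor_add_one ((4 : ℝ) ^ n * ww S (m w) i)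
      set fl := ((⌊(4 : ℝ) ^ n * ww S (m w) i⌋ : ℤ) : ℝ)
      have e : 4 ^ n * (u * ww S (m w) i) - u * fl = u * (4 ^ n * ww S (m w) i - fl) := by ring
      rw [e, abs_of_nonneg (by apply mul_nonneg hu; linarith)]
      nlinarith
  have h2 : Set.InjOn f E := by
    intro w hw w' hw' he
    apply h hw hw'
    funext i
    have h3 := congrFun he i
    simp only [f, Prod.mk.injEq] at h3
    have a1 := dl_two S (m w) a i
    have a2 := dl_two S (m w') a i
    have h4 : dl S (m w) a i = dl S (m w') a i := by omega
    rw [h4] at h3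
    simpa using h3.2
  have h3 := Finset.card_le_card_of_injOn _ h1 h2
  rw [Fintype.card_piFinset] at h3
  unfold phN
  refine Nat.cast_le.2 (h3.trans (le_of_eq ?_))
  refine Finset.prod_congr rfl fun i _ => ?_
  rw [Finset.card_product, Finset.card_range, Int.card_Icc, Int.ceil_natCast]
  congr 1
  omega

lemma T_diff {v : Fin d → ℝ} {k : ℕ} {b c : Fin d → ℝ} {N m : ℕ} {x x' : Fin d → ℝ} {P P' : Fin k → ℝ}
    (h : ∀ i, |x i - b i - c i * pe v P i| ≤ (1 / 2 : ℝ) ^ N)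
    (h' : ∀ i, |x' i - b i - c i * pe v P' i| ≤ (1 / 2 : ℝ) ^ N)
    (hD : DD S m x = DD S m x') (i : Fin d) :
    |TT S m x' i - TT S m x i - c i * ww S m i * pe v (fun j => 2 ^ m * (P' j - P j)) i| ≤
      2 * (2 ^ m * (1 / 2 : ℝ) ^ N) := by
  have h1 := congrFun hD i
  have e1 : TT S m x' i - TT S m x i = qq S m i * (x' i - x i) := by
    unfold TT
    unfold DD at h1
    rw [Int.fract, Int.fract, h1]
    ring
  have e2 : c i * ww S m i * pe v (fun j => 2 ^ m * (P' j - P j)) i = qq S m i * (c i * (pe v P' i - pe v P i)) := by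
    rw [pe_smul, pe_sub]
    unfold ww
    field_simp
  rw [e1, e2, ← mul_sub, abs_mul, abs_of_pos (qq_pos S m i)]
  have h2 : |x' i - x i - c i * (pe v P' i - pe v P i)| ≤ 2 * (1/2:ℝ)^N := by
    have a := h i
    have a' := h' i
    rw [abs_le] at a a' ⊢
    constructor <;> linarith [a.1, a.2, a'.1, a'.2]
  calc _ ≤ 2 ^ m * (2 * (1/2:ℝ)^N) := by
        gcongr
        exact qq_le S m i
    _ = _ := by ring

lemma ww_rel (m m0 : ℕ) (i : Fin d) (r a : ℤ) (τ v : ℝ) (hr : (m : ℤ) = m0 + r) :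
    ww S m i = ww S m0 i * (S.p i : ℝ) ^ ((lv S m i : ℤ) - lv S m0 i - a) * Real.exp (-(τ * v)) *
      Real.exp (-(r * Real.log 2 - a * Real.log (S.p i) - τ * v)) := by
  have hp := p_pos S i
  have e1 : Real.exp (-(τ * v)) * Real.exp (-(r * Real.log 2 - a * Real.log (S.p i) - τ * v)) =
      (S.p i : ℝ) ^ a * (2 : ℝ) ^ (-r) := by
    rw [← Real.exp_add]
    rw [← Real.rpow_intCast, ← Real.rpow_intCast, Real.rpow_def_of_pos hp, Real.rpow_def_of_pos (by norm_num), ← Real.exp_add]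
    congr 1
    push_cast
    ring
  rw [mul_assoc, e1]
  unfold ww qq
  rw [← zpow_natCast (S.p i : ℝ), ← zpow_natCast (S.p i : ℝ), ← zpow_natCast (2 : ℝ), ← zpow_natCast (2 : ℝ), hr]
  rw [zpow_sub₀ hp.ne', zpow_sub₀ hp.ne', zpow_add₀ (by norm_num : (2:ℝ) ≠ 0), zpow_neg]
  have h2 : (2:ℝ) ^ r ≠ 0 := by positivity
  have h3 : (2:ℝ) ^ (m0 : ℤ) ≠ 0 := by positivity
  have h4 : (S.p i : ℝ) ^ (lv S m0 i : ℤ) ≠ 0 := by positivity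
  have h5 : (S.p i : ℝ) ^ a ≠ 0 := by positivity
  field_simp

end levels
end Part7

section Part8
section ent2
variable {Ω Ω' κ α β γ : Type*} [Fintype Ω] [Fintype Ω'] [Fintype κ]

lemma cent_three {p : Ω → ℝ} (hp : ∀ ω, 0 ≤ p ω) (h1 : ∑ ω, p ω = 1)
    (X : Ω → α) (Z : Ω → β) (wr bd : Ω → Prop) (K1 K2 K3 : ℝ) (hK1 : 1 ≤ K1) (hK2 : 0 < K2) (hK3 : 0 < K3)
    (hc1 : ∀ z, ∀ S : Finset Ω, (∀ ω ∈ S, Z ω = z) → (∀ ω ∈ S, ¬ wr ω) → (∀ ω ∈ S, ¬ bd ω) →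
      Set.InjOn X S → (S.card : ℝ) ≤ K1)
    (hc2 : ∀ z, ∀ S : Finset Ω, (∀ ω ∈ S, Z ω = z) → (∀ ω ∈ S, ¬ wr ω) → (∀ ω ∈ S, bd ω) →
      Set.InjOn X S → (S.card : ℝ) ≤ K2)
    (hc3 : ∀ S : Finset Ω, Set.InjOn X S → (S.card : ℝ) ≤ K3) :
    cent p X Z ≤ Real.log 3 + Real.log K1 + (∑ ω, p ω * indi (¬ wr ω ∧ bd ω)) * (Real.log K2 - Real.log K1)
      + (∑ ω, p ω * indi (wr ω)) * Real.log K3 := by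
  classical
  let cls : Ω → Fin 3 := fun ω => if wr ω then 2 else if bd ω then 1 else 0
  let K : Fin 3 → ℝ := ![K1, K2, K3]
  have hK : ∀ c, 0 < K c := by
    intro c
    fin_cases c
    · simp [K]; linarith
    · simpa [K] using hK2
    · simpa [K] using hK3
  have h := cent_cls hp h1 X Z cls K hK ?_
  · refine h.trans ?_
    rw [Fintype.card_fin]
    have h2 : ∑ ω, p ω * Real.log (K (cls ω)) ≤ ∑ ω, (p ω * Real.log K1 +
        (p ω * indi (¬ wr ω ∧ bd ω)) * (Real.log K2 - Real.log K1) + (p ω * indi (wr ω)) * Real.log K3) := by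
      refine Finset.sum_le_sum fun ω _ => ?_
      have hl := Real.log_nonneg hK1
      have := mul_nonneg (hp ω) hl
      by_cases hw : wr ω
      · simp [cls, K, hw, indi]
        linarith
      · by_cases hb : bd ω
        · simp [cls, K, hw, hb, indi]
          linarith
        · simp [cls, K, hw, hb, indi]
    rw [Finset.sum_add_distrib, Finset.sum_add_distrib, ← Finset.sum_mul, ← Finset.sum_mul, ← Finset.sum_mul, h1] at h2
    push_cast
    linarith
  · intro z c T hT hinj
    fin_cases c
    · simp only [K, Fin.zero_eta, Matrix.cons_val_zero]
      refine hc1 z T (fun ω hω => (hT ω hω).1) (fun ω hω hw => ?_) (fun ω hω hw => ?_) hinj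
      · have := (hT ω hω).2; simp [cls, hw] at this
      · have := (hT ω hω).2
        by_cases hw' : wr ω
        · simp [cls, hw'] at this
        · simp [cls, hw, hw'] at this
    · simp only [K, Fin.mk_one, Matrix.cons_val_one]
      refine hc2 z T (fun ω hω => (hT ω hω).1) (fun ω hω hw => ?_) (fun ω hω => ?_) hinj
      · have := (hT ω hω).2; simp [cls, hw] at this
      · have := (hT ω hω).2
        by_contra hb
        by_cases hw' : wr ω
        · simp [cls, hw'] at this
        · simp [cls, hb, hw'] at this
    · exact hc3 T hinj

lemma cent_two {p : Ω → ℝ} (hp : ∀ ω, 0 ≤ p ω) (h1 : ∑ ω, p ω = 1)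
    (X : Ω → α) (Z : Ω → β) (wr : Ω → Prop) (K1 K3 : ℝ) (hK1 : 1 ≤ K1) (hK3 : 0 < K3)
    (hc1 : ∀ z, ∀ S : Finset Ω, (∀ ω ∈ S, Z ω = z) → (∀ ω ∈ S, ¬ wr ω) →
      Set.InjOn X S → (S.card : ℝ) ≤ K1)
    (hc3 : ∀ S : Finset Ω, Set.InjOn X S → (S.card : ℝ) ≤ K3) :
    cent p X Z ≤ Real.log 3 + Real.log K1 + (∑ ω, p ω * indi (wr ω)) * Real.log K3 := by
  have := cent_three hp h1 X Z wr (fun _ => False) K1 1 K3 hK1 one_pos hK3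
    (fun z S a b _ e => hc1 z S a b e) (fun z S a b c e => ?_) hc3
  · simpa [indi] using this
  · rcases S.eq_empty_or_nonempty with rfl | ⟨w, hw⟩
    · simp
    · exact absurd (c w hw) id

lemma pr_indi (p : Ω → ℝ) (X : Ω → α) (a : α) : pr p X a = ∑ ω, p ω * indi (X ω = a) := by
  classical
  unfold pr indi
  refine Finset.sum_congr rfl fun ω _ => ?_
  by_cases h : X ω = a
  · simp [h]
  · simp [h]

/-- uniform weight -/
def un (Ω : Type*) [Fintype Ω] : Ω → ℝ := fun _ => 1 / (Fintype.card Ω : ℝ)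

lemma un_nonneg (ω : Ω) : 0 ≤ un Ω ω := by unfold un; positivity

lemma un_sum [Nonempty Ω] : ∑ ω, un Ω ω = 1 := by
  unfold un
  rw [Finset.sum_const, Finset.card_univ, nsmul_eq_mul]
  have : (Fintype.card Ω : ℝ) ≠ 0 := by exact_mod_cast Fintype.card_ne_zero
  field_simp

lemma un_push [Nonempty κ] (e : Ω ≃ κ × Ω') (a : Ω') : un Ω' a = pr (un Ω) (fun ω => (e ω).2) a := by
  classical
  unfold pr un
  rw [← Finset.sum_filter, Finset.sum_const, nsmul_eq_mul]
  have h1 : (Finset.univ.filter (fun ω => (e ω).2 = a)).card = Fintype.card κ := by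
    rw [← Finset.card_univ]
    symm
    refine Finset.card_bij (fun k _ => e.symm (k, a)) ?_ ?_ ?_
    · intro k _; simp
    · intro k _ k' _ h; simpa using h
    · intro ω hω
      refine ⟨(e ω).1, Finset.mem_univ _, ?_⟩
      have h2 : (e ω).2 = a := by simpa using hω
      rw [← h2]; simp
  rw [h1, Fintype.card_congr e, Fintype.card_prod]
  have : (Fintype.card κ : ℝ) ≠ 0 := by exact_mod_cast Fintype.card_ne_zero
  push_cast
  by_cases h : (Fintype.card Ω' : ℝ) = 0
  · simp [h]
  · field_simp

lemma un_equiv (e : Ω ≃ Ω) (a : Ω) : un Ω a = pr (un Ω) (fun ω => e ω) a := by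
  have := un_push (κ := Unit) (e.trans (Equiv.punitProd Ω).symm) a
  exact this

lemma un_fst [Nonempty κ] (a : Ω') : un Ω' a = pr (un (Ω' × κ)) (fun ω => ω.1) a :=
  un_push (Equiv.prodComm Ω' κ) a

lemma ent_un_inj [Nonempty Ω] (X : Ω → α) (hX : Function.Injective X) : ent (un Ω) X = Real.log (Fintype.card Ω) := by
  classical
  unfold ent
  have h1 : ∀ ω, pr (un Ω) X (X ω) = 1 / (Fintype.card Ω : ℝ) := by
    intro ω
    unfold pr un
    simp [hX.eq_iff]
  simp_rw [h1]
  rw [← Finset.sum_mul, un_sum, one_mul, one_div, Real.log_inv, neg_neg]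

lemma pr_un (X : Ω → α) (a : α) [DecidableEq α] :
    pr (un Ω) X a = ((Finset.univ.filter (fun ω => X ω = a)).card : ℝ) / Fintype.card Ω := by
  rw [pr_indi]
  unfold un indi
  rw [← Finset.mul_sum]
  have : ∑ ω, (if X ω = a then (1:ℝ) else 0) = ((Finset.univ.filter (fun ω => X ω = a)).card : ℝ) := by
    simp
  rw [one_div, mul_comm, div_eq_mul_inv, ← this]
  congr!

end ent2

section kernel
variable {J X δ φ : Type*} [Fintype J] [Fintype X]

open Classical in
/-- size of a class -/
def csz (D : X → δ) (x : X) : ℝ := ((Finset.univ.filter (fun x' => D x' = D x)).card : ℝ)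

lemma csz_pos (D : X → δ) (x : X) : 0 < csz D x := by
  classical
  unfold csz
  have : 0 < (Finset.univ.filter (fun x' => D x' = D x)).card := Finset.card_pos.2 ⟨x, by simp⟩
  exact_mod_cast this

lemma csz_congr (D : X → δ) {x x' : X} (h : D x = D x') : csz D x = csz D x' := by
  unfold csz; rw [h]

lemma csz_sum (D : X → δ) (x : X) : ∑ x', indi (D x' = D x) = csz D x := by
  classical
  unfold csz indi
  simp

/-- The two-point weight: `j`, `x` uniform, `x'` uniform in the `D j`-class of `x`. -/
def pk (D : J → X → δ) : (J × X) × X → ℝ := fun ω =>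
  un (J × X) ω.1 * (indi (D ω.1.1 ω.2 = D ω.1.1 ω.1.2) / csz (D ω.1.1) ω.1.2)

lemma pk_nonneg (D : J → X → δ) (ω) : 0 ≤ pk D ω := by
  unfold pk
  exact mul_nonneg (un_nonneg _) (div_nonneg (indi_nonneg _) (csz_pos _ _).le)

lemma pk_fst (D : J → X → δ) (a : J × X) : un (J × X) a = pr (pk D) (fun ω => ω.1) a := by
  classical
  unfold pr
  rw [Fintype.sum_prod_type]
  rw [Finset.sum_eq_single a]
  · simp only [if_true, pk]
    rw [← Finset.mul_sum, ← Finset.sum_div, csz_sum, div_self (csz_pos _ _).ne', mul_one]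
  · intro b _ hb
    simp [hb]
  · simp

lemma pk_snd (D : J → X → δ) (a : J × X) : un (J × X) a = pr (pk D) (fun ω => (ω.1.1, ω.2)) a := by
  classical
  rw [pr_indi, Fintype.sum_prod_type, Fintype.sum_prod_type]
  rw [Finset.sum_eq_single a.1]
  · have : ∀ x : X, ∑ x', pk D ((a.1, x), x') * indi ((a.1, x') = a) = pk D ((a.1, x), a.2) := by
      intro x
      rw [Finset.sum_eq_single a.2]
      · simp [indi]
      · intro b _ hb
        rw [indi_neg, mul_zero]
        intro h
        exact hb (by rw [← h])
      · simp
    simp only [this]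
    unfold pk
    have h2 : ∀ x : X, indi (D a.1 a.2 = D a.1 x) / csz (D a.1) x = indi (D a.1 x = D a.1 a.2) / csz (D a.1) a.2 := by
      intro x
      by_cases h : D a.1 a.2 = D a.1 x
      · rw [indi_pos h, indi_pos h.symm, csz_congr _ h]
      · rw [indi_neg h, indi_neg (fun h' => h h'.symm)]; simp
    simp only [h2]
    unfold un
    rw [← Finset.mul_sum, ← Finset.sum_div, csz_sum, div_self (csz_pos _ _).ne', mul_one]
  · intro j _ hj
    refine Finset.sum_eq_zero fun x _ => Finset.sum_eq_zero fun x' _ => ?_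
    rw [indi_neg, mul_zero]
    intro h
    exact hj (by rw [← h])
  · simp

lemma pk_sum [Nonempty J] [Nonempty X] (D : J → X → δ) : ∑ ω, pk D ω = 1 := by
  have h := sum_pr (pk D) (fun ω => ω.1) (fun _ => 1)
  simp only [← pk_fst, mul_one] at h
  rw [← h, un_sum]

lemma cent_kernel [Nonempty J] [Nonempty X] (D : J → X → δ) (f : J → X → φ) :
    cent (pk D) (fun ω => f ω.1.1 ω.2) (fun ω => ω.1) =
      ∑ j, un J j * cent (un X) (f j) (D j) := by
  classical
  let G : J × X → ℝ := fun a => Real.log (csz (fun x => (f a.1 x, D a.1 x)) a.2) - Real.log (csz (D a.1) a.2)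
  have hX : (Fintype.card X : ℝ) ≠ 0 := by exact_mod_cast Fintype.card_ne_zero
  have hJX : (Fintype.card (J × X) : ℝ) ≠ 0 := by exact_mod_cast Fintype.card_ne_zero
  have h1 : cent (pk D) (fun ω => f ω.1.1 ω.2) (fun ω => ω.1) = - ∑ ω, pk D ω * G (ω.1.1, ω.2) := by
    unfold cent ent
    rw [← Finset.sum_neg_distrib, ← Finset.sum_neg_distrib, ← Finset.sum_sub_distrib, ← Finset.sum_neg_distrib]
    refine Finset.sum_congr rfl fun ω _ => ?_
    obtain ⟨⟨j, x⟩, x'⟩ := ω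
    by_cases h : D j x' = D j x
    · have e1 : pr (pk D) (fun ω => ω.1) (j, x) = un (J × X) (j, x) := (pk_fst D (j, x)).symm
      have e2 : pr (pk D) (fun ω => (f ω.1.1 ω.2, ω.1)) (f j x', (j, x)) =
          un (J × X) (j, x) * (csz (fun x => (f j x, D j x)) x' / csz (D j) x') := by
        rw [pr_indi, Fintype.sum_prod_type, Finset.sum_eq_single (j, x)]
        · have : ∀ y : X, pk D ((j, x), y) * indi ((f j y, (j, x)) = (f j x', (j, x))) =
            un (J × X) (j, x) * (indi ((f j y, D j y) = (f j x', D j x')) / csz (D j) x') := by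
            intro y
            unfold pk
            simp only [Prod.mk.injEq, and_true]
            rw [h, csz_congr (D j) h]
            by_cases hy : f j y = f j x'
            · simp [hy, indi]
            · simp [hy, indi]
          simp only [this]
          rw [← Finset.mul_sum, ← Finset.sum_div, csz_sum (fun x => (f j x, D j x))]
        · intro b _ hb
          refine Finset.sum_eq_zero fun y _ => ?_
          rw [indi_neg, mul_zero]
          intro hh
          exact hb (Prod.ext_iff.1 hh).2
        · simp
      simp only [e1, e2, G]
      rw [Real.log_mul (by unfold un; positivity) (div_pos (csz_pos _ _) (csz_pos _ _)).ne',
        Real.log_div (csz_pos _ _).ne' (csz_pos _ _).ne']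
      ring
    · have : pk D ((j, x), x') = 0 := by
        unfold pk
        simp only
        rw [indi_neg h]; simp
      rw [this]; simp
  rw [h1, ← sum_pr (pk D) (fun ω => (ω.1.1, ω.2)) G]
  simp only [← pk_snd]
  rw [Fintype.sum_prod_type, ← Finset.sum_neg_distrib]
  refine Finset.sum_congr rfl fun j _ => ?_
  unfold cent ent
  rw [← Finset.sum_neg_distrib, ← Finset.sum_neg_distrib, ← Finset.sum_neg_distrib, ← Finset.sum_sub_distrib, Finset.mul_sum]
  refine Finset.sum_congr rfl fun x _ => ?_
  simp only [G]
  rw [pr_un, pr_un]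
  have e1 : ((Finset.univ.filter (fun ω => (f j ω, D j ω) = (f j x, D j x))).card : ℝ) = csz (fun x => (f j x, D j x)) x := by
    unfold csz
    congr!
  have e2 : ((Finset.univ.filter (fun ω => D j ω = D j x)).card : ℝ) = csz (D j) x := by
    unfold csz
    congr!
  rw [e1, e2, Real.log_div (csz_pos _ _).ne' hX, Real.log_div (csz_pos _ _).ne' hX]
  have e3 : un (J × X) (j, x) = un J j * un X x := by
    unfold un
    rw [Fintype.card_prod]
    push_cast
    rw [div_mul_div_comm, one_mul]
  rw [e3]
  ring

end kernel
end Part8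

section Part9
section dyn
variable {d : ℕ} (S : Sys d) {N : ℕ} [NeZero N] {I X : Type} [Fintype I] [Fintype X] [Nonempty I] [Nonempty X]
  (r : I → ℤ) (ev : X → Fin d → ℝ)

/-- the time reached from `m0` after shift `r t` -/
def mm (j : ZMod N × I) : ℕ := (j.1 + (r j.2 : ZMod N)).val

lemma prob_val (c : ℕ) : ∑ g : ZMod N, un (ZMod N) g * indi (N ≤ g.val + c) ≤ (c : ℝ) / N := by
  classical
  unfold un
  rw [← Finset.mul_sum, ZMod.card]
  have h1 : ∑ g : ZMod N, indi (N ≤ g.val + c) = ((Finset.univ.filter (fun g : ZMod N => N ≤ g.val + c)).card : ℝ) := by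
    rw [Finset.card_filter, Nat.cast_sum]
    refine Finset.sum_congr rfl (fun g _ => ?_)
    by_cases hg : N ≤ g.val + c
    · rw [indi_pos hg, if_pos hg]; simp
    · rw [indi_neg hg, if_neg hg]; simp
  have h2 : (Finset.univ.filter (fun g : ZMod N => N ≤ g.val + c)).card ≤ c := by
    have h3 : ∀ g ∈ Finset.univ.filter (fun g : ZMod N => N ≤ g.val + c), g.val ∈ Finset.Ico (N - c) N := by
      intro g hg
      rw [Finset.mem_filter] at hg
      rw [Finset.mem_Ico]
      have := ZMod.val_lt g
      omega
    have h4 := Finset.card_le_card_of_injOn _ h3 (fun a _ b _ h => ZMod.val_injective N h)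
    rw [Nat.card_Ico] at h4
    omega
  rw [h1, one_div, ← div_eq_inv_mul]
  gcongr

lemma push_mX (a : ZMod N × X) :
    un (ZMod N × X) a = pr (un ((ZMod N × I) × X)) (fun ω => (ω.1.1 + (r ω.1.2 : ZMod N), ω.2)) a := by
  let e : (ZMod N × I) × X ≃ I × (ZMod N × X) :=
    { toFun := fun ω => (ω.1.2, (ω.1.1 + (r ω.1.2 : ZMod N), ω.2))
      invFun := fun w => ((w.2.1 - (r w.1 : ZMod N), w.1), w.2.2)
      left_inv := fun ω => by simp
      right_inv := fun w => by simp }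
  exact un_push e a

lemma push_m (a : ZMod N) :
    un (ZMod N) a = pr (un ((ZMod N × I) × X)) (fun ω => ω.1.1 + (r ω.1.2 : ZMod N)) a := by
  let e : (ZMod N × I) × X ≃ (I × X) × ZMod N :=
    { toFun := fun ω => ((ω.1.2, ω.2), ω.1.1 + (r ω.1.2 : ZMod N))
      invFun := fun w => ((w.2 - (r w.1.1 : ZMod N), w.1.1), w.1.2)
      left_inv := fun ω => by simp
      right_inv := fun w => by simp }
  exact un_push e a

lemma push_m0 (a : ZMod N) :
    un (ZMod N) a = pr (un ((ZMod N × I) × X)) (fun ω => ω.1.1) a := by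
  let e : (ZMod N × I) × X ≃ (I × X) × ZMod N :=
    { toFun := fun ω => ((ω.1.2, ω.2), ω.1.1)
      invFun := fun w => ((w.2, w.1.1), w.1.2)
      left_inv := fun ω => by simp
      right_inv := fun w => by simp }
  exact un_push e a

lemma prob_m (c : ℕ) :
    ∑ ω : (ZMod N × I) × X, un ((ZMod N × I) × X) ω * indi (N ≤ mm r ω.1 + c) ≤ (c : ℝ) / N := by
  have := sum_pr (un ((ZMod N × I) × X)) (fun ω => ω.1.1 + (r ω.1.2 : ZMod N)) (fun g => indi (N ≤ g.val + c))
  simp only [← push_m] at this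
  unfold mm
  rw [← this]
  exact prob_val c

lemma prob_m0 (c : ℕ) :
    ∑ ω : (ZMod N × I) × X, un ((ZMod N × I) × X) ω * indi (N ≤ ω.1.1.val + c) ≤ (c : ℝ) / N := by
  have := sum_pr (un ((ZMod N × I) × X)) (fun ω => ω.1.1) (fun g => indi (N ≤ g.val + c))
  simp only [← push_m0] at this
  rw [← this]
  exact prob_val c

/-- block entropy -/
def hb (N : ℕ) [NeZero N] (n : ℕ) : ℝ :=
  ent (un (ZMod N × X)) (fun g => WW S g.1.val n (ev g.2))

lemma hb_le (n : ℕ) : hb S ev N n ≤ Real.log (nameN S n) := by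
  unfold hb
  rw [ent_eq_cent un_nonneg un_sum]
  refine cent_le_log un_nonneg un_sum _ _ _ (by exact_mod_cast nameN_pos S n) ?_
  intro z E _ h
  exact WW_count S n E (fun g => g.1.val) (fun g => ev g.2) h

lemma hb_nonneg (n : ℕ) : 0 ≤ hb S ev N n := ent_nonneg un_nonneg un_sum _

lemma ent_X (n : ℕ) :
    ent (un ((ZMod N × I) × X)) (fun ω => WW S (mm r ω.1) n (ev ω.2)) = hb S ev N n := by
  have := ent_map (push_mX (N := N) (X := X) r) (fun g => WW S g.1.val n (ev g.2))
  exact this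

lemma val_add_of_lt {g : ZMod N} {c : ℕ} (h : g.val + c < N) : (g + (c : ZMod N)).val = g.val + c := by
  have hc : (c : ZMod N).val = c := ZMod.val_cast_of_lt (by omega)
  rw [ZMod.val_add_of_lt (by rw [hc]; exact h), hc]

/-- the phase and shift -/
lemma step_shift (n n' j : ℕ) :
    cent (un ((ZMod N × I) × X)) (fun ω => WW S (ω.1.1 + (r ω.1.2 : ZMod N) + ((n' * j : ℕ) : ZMod N)).val n' (ev ω.2))
      (fun ω => (YY S n ω.1.1.val, ω.1.2)) ≤
    Real.log 3 + Real.log (phN S) + ((n' * j : ℕ) : ℝ) / N * Real.log (((4 : ℝ) ^ n + 1) ^ d) +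
    cent (un ((ZMod N × I) × X)) (fun ω => WW S (mm r ω.1) n' (ev ω.2))
      (fun ω => (YY S n ω.1.1.val, ω.1.2)) := by
  set p := un ((ZMod N × I) × X) with hp
  have hp0 : ∀ ω, 0 ≤ p ω := un_nonneg
  have hp1 : ∑ ω, p ω = 1 := un_sum
  set c := ((n' * j : ℕ) : ZMod N) with hc
  set U : (ZMod N × I) × X → (Fin d → ℕ × ℤ) :=
    fun ω => WW S (ω.1.1 + (r ω.1.2 : ZMod N) + c).val n' (ev ω.2) with hU
  set Z : (ZMod N × I) × X → (Fin d → ℤ) × I := fun ω => (YY S n ω.1.1.val, ω.1.2) with hZ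
  set Y : (ZMod N × I) × X → (Fin d → ℤ) := fun ω => YY S n (ω.1.1 + c).val with hY
  have a1 : cent p U Z ≤ cent p (fun ω => (Y ω, U ω)) Z :=
    cent_mono hp0 Z (fun ω ω' _ h => (Prod.ext_iff.1 h).2)
  rw [cent_chain hp0] at a1
  have a2 : cent p U (fun ω => (Y ω, Z ω)) ≤ cent p U (fun ω => (Y ω, ω.1.2)) := by
    refine cent_anti hp0 hp1 U ?_
    intro ω ω' h
    simp only [hZ, Prod.mk.injEq] at h ⊢
    exact ⟨h.1, h.2.2⟩
  have a3 : cent p U (fun ω => (Y ω, ω.1.2)) = cent p (fun ω => WW S (mm r ω.1) n' (ev ω.2)) Z := by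
    let e : (ZMod N × I) × X ≃ (ZMod N × I) × X :=
      { toFun := fun ω => ((ω.1.1 + c, ω.1.2), ω.2)
        invFun := fun ω => ((ω.1.1 - c, ω.1.2), ω.2)
        left_inv := fun ω => by simp
        right_inv := fun w => by simp }
    have := cent_map (un_equiv e) (fun ω => WW S (mm r ω.1) n' (ev ω.2)) Z
    rw [← this]
    congr 1
    funext ω
    simp only [hU, mm, e, Equiv.coe_fn_mk]
    congr 2
    ring
  have a4 : cent p Y Z ≤ Real.log 3 + Real.log (phN S) +
      (∑ ω, p ω * indi (N ≤ ω.1.1.val + n' * j)) * Real.log (((4 : ℝ) ^ n + 1) ^ d) := by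
    refine cent_two hp0 hp1 Y Z _ _ _ ?_ (by positivity) ?_ ?_
    · exact_mod_cast phN_pos S
    · intro z E hz hw hinj
      refine YY_step S n (n' * j) E (fun ω => ω.1.1.val) z.1 ?_ ?_
      · intro w hw'
        rw [← hz w hw']
      · intro w hw1 w' hw1' h
        refine hinj hw1 hw1' ?_
        simp only [hY, hc]
        have b1 := hw w hw1
        have b2 := hw w' hw1'
        push Not at b1 b2
        rw [val_add_of_lt b1, val_add_of_lt b2]
        exact h
    · intro E hinj
      exact YY_count S n E (fun ω => (ω.1.1 + c).val) hinj
  have a5 : (∑ ω, p ω * indi (N ≤ ω.1.1.val + n' * j)) * Real.log (((4 : ℝ) ^ n + 1) ^ d) ≤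
      ((n' * j : ℕ) : ℝ) / N * Real.log (((4 : ℝ) ^ n + 1) ^ d) := by
    refine mul_le_mul_of_nonneg_right (prob_m0 (n' * j)) (Real.log_nonneg ?_)
    apply one_le_pow₀
    have : (0:ℝ) < 4 ^ n := by positivity
    linarith
  linarith

lemma step_I (n n' R : ℕ) (hn' : 0 < n') :
    hb S ev N (n' * R) ≤ Real.log (((4 : ℝ) ^ n + 1) ^ d) + Real.log (Fintype.card I) + Real.log 3 +
      ((n' * R : ℕ) : ℝ) / N * Real.log (nameN S (n' * R)) +
      R * (Real.log 3 + Real.log (phN S) + ((n' * R : ℕ) : ℝ) / N * Real.log (((4 : ℝ) ^ n + 1) ^ d) +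
        cent (un ((ZMod N × I) × X)) (fun ω => WW S (mm r ω.1) n' (ev ω.2))
          (fun ω => (YY S n ω.1.1.val, ω.1.2))) := by
  set p := un ((ZMod N × I) × X) with hp
  have hp0 : ∀ ω, 0 ≤ p ω := un_nonneg
  have hp1 : ∑ ω, p ω = 1 := un_sum
  set Z : (ZMod N × I) × X → (Fin d → ℤ) × I := fun ω => (YY S n ω.1.1.val, ω.1.2) with hZ
  set XR : (ZMod N × I) × X → (Fin d → ℕ × ℤ) := fun ω => WW S (mm r ω.1) (n' * R) (ev ω.2) with hXR
  set U : ℕ → (ZMod N × I) × X → (Fin d → ℕ × ℤ) := fun j ω =>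
    WW S (ω.1.1 + (r ω.1.2 : ZMod N) + ((n' * j : ℕ) : ZMod N)).val n' (ev ω.2) with hU
  have hL : 0 ≤ Real.log (((4 : ℝ) ^ n + 1) ^ d) := by
    apply Real.log_nonneg
    apply one_le_pow₀
    have : (0:ℝ) < 4 ^ n := by positivity
    linarith
  have hN : (0:ℝ) < N := by exact_mod_cast Nat.pos_of_ne_zero (NeZero.ne N)
  have a0 : hb S ev N (n' * R) = ent p XR := (ent_X S r ev (n' * R)).symm
  have a1 : ent p XR ≤ cent p XR Z + ent p Z := by
    unfold cent
    have : ent p XR ≤ ent p (fun ω => (XR ω, Z ω)) := ent_mono hp0 (fun ω ω' h => (Prod.ext_iff.1 h).1)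
    linarith
  have a2 : ent p Z ≤ Real.log (((4 : ℝ) ^ n + 1) ^ d) + Real.log (Fintype.card I) := by
    have e1 : ent p Z = cent p (fun ω => YY S n ω.1.1.val) (fun ω => ω.1.2) + ent p (fun ω => ω.1.2) := by
      unfold cent; ring
    have e2 : cent p (fun ω => YY S n ω.1.1.val) (fun ω => ω.1.2) ≤ Real.log (((4 : ℝ) ^ n + 1) ^ d) :=
      cent_le_log hp0 hp1 _ _ _ (by positivity) (fun z E _ h => YY_count S n E (fun ω => ω.1.1.val) h)
    have e3 : ent p (fun ω => ω.1.2) ≤ Real.log (Fintype.card I) := by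
      rw [ent_eq_cent hp0 hp1]
      refine cent_le_log hp0 hp1 _ _ _ (by exact_mod_cast Fintype.card_pos) (fun z E _ h => ?_)
      exact_mod_cast (Finset.card_le_card_of_injOn _ (fun _ _ => Finset.mem_univ _) h)
    linarith
  have a3 : cent p XR Z ≤ cent p (fun ω => (fun j : Fin R => U j ω)) Z +
      cent p XR (fun ω => ((fun j : Fin R => U j ω), Z ω)) := by
    rw [← cent_chain hp0]
    exact cent_mono hp0 Z (fun ω ω' _ h => (Prod.ext_iff.1 h).2)
  have a4 := cent_pi hp0 hp1 U Z R
  have a5 : ∑ j ∈ Finset.range R, cent p (U j) Z ≤ ∑ j ∈ Finset.range R, (Real.log 3 + Real.log (phN S) +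
      ((n' * R : ℕ) : ℝ) / N * Real.log (((4 : ℝ) ^ n + 1) ^ d) +
      cent p (fun ω => WW S (mm r ω.1) n' (ev ω.2)) Z) := by
    refine Finset.sum_le_sum fun j hj => (step_shift S r ev n n' j).trans ?_
    gcongr
    rw [Finset.mem_range] at hj
    exact hj.le
  rw [Finset.sum_const, Finset.card_range, nsmul_eq_mul] at a5
  have a6 : cent p XR (fun ω => ((fun j : Fin R => U j ω), Z ω)) ≤ Real.log 3 + Real.log 1 +
      (∑ ω, p ω * indi (N ≤ mm r ω.1 + n' * R)) * Real.log (nameN S (n' * R)) := by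
    refine cent_two hp0 hp1 _ _ _ _ _ le_rfl (by exact_mod_cast nameN_pos S _) ?_ ?_
    · intro z E hz hw hinj
      have : E.card ≤ 1 := by
        rw [Finset.card_le_one]
        intro w hw1 w' hw1'
        refine hinj hw1 hw1' ?_
        simp only [hXR]
        refine WW_concat_many S R ?_
        intro j hj
        have b1 := hw w hw1
        have b2 := hw w' hw1'
        push Not at b1 b2
        have hlt : n' * j < n' * R := Nat.mul_lt_mul_of_pos_left hj hn'
        have c1 := val_add_of_lt (g := w.1.1 + (r w.1.2 : ZMod N)) (c := n' * j) (by unfold mm at b1; omega)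
        have c2 := val_add_of_lt (g := w'.1.1 + (r w'.1.2 : ZMod N)) (c := n' * j) (by unfold mm at b2; omega)
        have h3 := (hz w hw1).trans (hz w' hw1').symm
        have h4 := congrFun (Prod.ext_iff.1 h3).1 ⟨j, hj⟩
        simp only [hU] at h4
        rw [c1, c2] at h4
        exact h4
      exact_mod_cast this
    · intro E hinj
      exact WW_count S _ E (fun ω => mm r ω.1) (fun ω => ev ω.2) hinj
  have a7 : (∑ ω, p ω * indi (N ≤ mm r ω.1 + n' * R)) * Real.log (nameN S (n' * R)) ≤
      ((n' * R : ℕ) : ℝ) / N * Real.log (nameN S (n' * R)) := by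
    refine mul_le_mul_of_nonneg_right (prob_m r (n' * R)) (Real.log_nonneg ?_)
    exact_mod_cast nameN_pos S _
  rw [Real.log_one] at a6
  linarith

lemma step_II (n n' : ℕ) :
    Real.log (Fintype.card I) + cent (un ((ZMod N × I) × X)) (fun ω => WW S (mm r ω.1) n' (ev ω.2))
          (fun ω => (YY S n ω.1.1.val, ω.1.2)) - hb S ev N n' ≤
      cent (un ((ZMod N × I) × X)) (fun ω => ω.1.2)
        (fun ω => (WW S (mm r ω.1) n' (ev ω.2), YY S n ω.1.1.val)) := by
  set p := un ((ZMod N × I) × X) with hp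
  have hp0 : ∀ ω, 0 ≤ p ω := un_nonneg
  have hp1 : ∑ ω, p ω = 1 := un_sum
  rw [← ent_X S r ev n']
  set XX : (ZMod N × I) × X → (Fin d → ℕ × ℤ) := fun ω => WW S (mm r ω.1) n' (ev ω.2)
  set Y : (ZMod N × I) × X → (Fin d → ℤ) := fun ω => YY S n ω.1.1.val with hY
  set t : (ZMod N × I) × X → I := fun ω => ω.1.2 with ht
  have a1 : Real.log (Fintype.card I) ≤ cent p t Y := by
    have b1 : cent p t (fun ω => (ω.1.1, ω.2)) ≤ cent p t Y := by
      refine cent_anti hp0 hp1 t ?_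
      intro ω ω' h
      simp only [Prod.mk.injEq] at h
      simp only [hY, h.1]
    have b2 : ent p (fun ω => (t ω, (ω.1.1, ω.2))) = Real.log (Fintype.card ((ZMod N × I) × X)) := by
      refine ent_un_inj _ ?_
      intro ω ω' h
      simp only [ht, Prod.mk.injEq] at h
      exact Prod.ext (Prod.ext h.2.1 h.1) h.2.2
    have b3 : ent p (fun ω => (ω.1.1, ω.2)) = Real.log (Fintype.card (ZMod N × X)) := by
      let e : (ZMod N × I) × X ≃ I × (ZMod N × X) :=
        { toFun := fun ω => (ω.1.2, (ω.1.1, ω.2))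
          invFun := fun w => ((w.2.1, w.1), w.2.2)
          left_inv := fun ω => by simp
          right_inv := fun w => by simp }
      have := ent_map (un_push e) (fun g => g)
      rw [← ent_un_inj (fun g : ZMod N × X => g) (fun _ _ h => h)]
      exact this
    unfold cent at b1
    rw [b2, b3, Fintype.card_prod, Fintype.card_prod, Fintype.card_prod] at b1
    have cI : (Fintype.card I : ℝ) ≠ 0 := by exact_mod_cast Fintype.card_ne_zero
    have cX : (Fintype.card X : ℝ) ≠ 0 := by exact_mod_cast Fintype.card_ne_zero
    have cG : (Fintype.card (ZMod N) : ℝ) ≠ 0 := by exact_mod_cast Fintype.card_ne_zero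
    push_cast at b1
    rw [Real.log_mul (mul_ne_zero cG cI) cX, Real.log_mul cG cI, Real.log_mul cG cX] at b1
    unfold cent
    linarith
  have a2 : cent p XX Y ≤ ent p XX := cent_le_ent hp0 hp1 _ _
  have a3 : ent p (fun ω => (t ω, (XX ω, Y ω))) = ent p (fun ω => (XX ω, (Y ω, t ω))) :=
    ent_congr hp0 (by simp; tauto)
  have a4 : ent p (fun ω => (t ω, Y ω)) = ent p (fun ω => (Y ω, t ω)) :=
    ent_congr hp0 (by simp; tauto)
  unfold cent at *
  linarith

lemma step_lab {Ω α β γ : Type*} [Fintype Ω] {p : Ω → ℝ} (hp0 : ∀ ω, 0 ≤ p ω) (hp1 : ∑ ω, p ω = 1)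
    (t : Ω → α) (Z : Ω → β) (lab : Ω → γ) (C : ℝ) (hC : 0 < C)
    (h : ∀ E : Finset Ω, Set.InjOn lab E → (E.card : ℝ) ≤ C) :
    cent p t Z - Real.log C ≤ cent p t (fun ω => (lab ω, Z ω)) := by
  have a1 : cent p t Z ≤ cent p (fun ω => (lab ω, t ω)) Z :=
    cent_mono hp0 Z (fun ω ω' _ h => (Prod.ext_iff.1 h).2)
  rw [cent_chain hp0] at a1
  have a2 : cent p lab Z ≤ Real.log C := cent_le_log hp0 hp1 _ _ _ hC (fun z E _ hE => h E hE)
  linarith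

lemma step_IV (n' : ℕ) (hA : ∀ x i, ev x i ∈ S.A i)
    (hinj : ∀ m, N ≤ m → Function.Injective (fun x => DD S m (ev x))) :
    n' * (Real.log (Fintype.card X) - n' * d * Real.log 2) / N ≤
    cent (pk (fun (j : ZMod N × I) x => DD S (mm r j) (ev x))) (fun ω => WW S (mm r ω.1.1) n' (ev ω.2))
      (fun ω => ω.1) := by
  rw [cent_kernel (fun (j : ZMod N × I) x => DD S (mm r j) (ev x)) (fun j x => WW S (mm r j) n' (ev x))]
  let e : ℕ → ℝ := fun m => ent (un X) (fun x => DD S m (ev x))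
  have h1 : ∀ m, cent (un X) (fun x => WW S m n' (ev x)) (fun x => DD S m (ev x)) = e (m + n') - e m := by
    intro m
    unfold cent
    simp only [e]
    congr 1
    refine ent_congr un_nonneg fun x x' => ?_
    rw [DD_eq_iff, Prod.mk.injEq]
    tauto
  have hN : (0:ℝ) < N := by exact_mod_cast Nat.pos_of_ne_zero (NeZero.ne N)
  have h2 : ∑ j : ZMod N × I, un (ZMod N × I) j * cent (un X) (fun x => WW S (mm r j) n' (ev x)) (fun x => DD S (mm r j) (ev x))
      = (∑ m ∈ Finset.range N, (e (m + n') - e m)) / N := by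
    simp only [h1]
    let eq : ZMod N × I ≃ I × ZMod N :=
      { toFun := fun ω => (ω.2, ω.1 + (r ω.2 : ZMod N))
        invFun := fun w => (w.2 - (r w.1 : ZMod N), w.1)
        left_inv := fun ω => by simp
        right_inv := fun w => by simp }
    have h3 := sum_pr (un (ZMod N × I)) (fun j => (eq j).2) (fun g => e (g.val + n') - e g.val)
    simp only [← un_push eq] at h3
    refine h3.symm.trans ?_
    unfold un
    rw [← Finset.mul_sum, ZMod.card, one_div, ← div_eq_inv_mul]
    congr 1
    refine Finset.sum_bij (fun g _ => g.val) ?_ ?_ ?_ ?_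
    · intro g _; rw [Finset.mem_range]; exact ZMod.val_lt g
    · intro g _ g' _ h; exact ZMod.val_injective N h
    · intro m hm
      rw [Finset.mem_range] at hm
      exact ⟨(m : ZMod N), Finset.mem_univ _, ZMod.val_cast_of_lt hm⟩
    · intro g _; rfl
  rw [h2]
  gcongr
  have h4 : ∑ m ∈ Finset.range N, (e (m + n') - e m) = ∑ m ∈ Finset.range n', (e (N + m) - e m) := by
    rw [Finset.sum_sub_distrib, Finset.sum_sub_distrib]
    have a := Finset.sum_range_add e N n'
    have b := Finset.sum_range_add e n' N
    rw [add_comm n' N] at b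
    have c : ∑ m ∈ Finset.range N, e (m + n') = ∑ m ∈ Finset.range N, e (n' + m) :=
      Finset.sum_congr rfl fun m _ => by rw [add_comm]
    rw [c]
    linarith
  rw [h4]
  have h5 : ∀ m ∈ Finset.range n', Real.log (Fintype.card X) - n' * d * Real.log 2 ≤ e (N + m) - e m := by
    intro m hm
    rw [Finset.mem_range] at hm
    have b1 : e (N + m) = Real.log (Fintype.card X) := ent_un_inj _ (hinj _ (by omega))
    have b2 : e m ≤ Real.log (((2:ℝ)^m)^d) := by
      simp only [e]
      rw [ent_eq_cent un_nonneg un_sum]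
      exact cent_le_log un_nonneg un_sum _ _ _ (by positivity)
        (fun z E _ h => DD_count S m E ev (fun w _ i => hA w i) h)
    rw [Real.log_pow, Real.log_pow] at b2
    have b3 : (d:ℝ) * (m * Real.log 2) ≤ n' * d * Real.log 2 := by
      have : (m:ℝ) ≤ n' := by exact_mod_cast hm.le
      have hl : 0 ≤ Real.log 2 := Real.log_nonneg (by norm_num)
      calc (d:ℝ) * (m * Real.log 2) ≤ d * (n' * Real.log 2) := by gcongr
        _ = _ := by ring
    linarith
  have h6 := Finset.sum_le_sum h5
  rw [Finset.sum_const, Finset.card_range, nsmul_eq_mul] at h6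
  exact h6

end dyn
end Part9

section Part10
/-- bound for the bases -/
def pm {d : ℕ} (S : Sys d) : ℝ := 1 + ∑ i, (S.p i : ℝ)
/-- bound for the speeds -/
def vm {d : ℕ} (v : Fin d → ℝ) : ℝ := 1 + ∑ i, |v i|
/-- the universal geometric constant -/
def LL {d : ℕ} (S : Sys d) (v : Fin d → ℝ) : ℝ := 12 * pm S ^ 3 * Real.exp (2 * vm v + 1)

lemma p_le_pm {d : ℕ} (S : Sys d) (i : Fin d) : (S.p i : ℝ) ≤ pm S := by
  unfold pm
  have := Finset.single_le_sum (f := fun i => (S.p i : ℝ)) (fun i _ => by positivity) (Finset.mem_univ i)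
  linarith

lemma one_le_pm {d : ℕ} (S : Sys d) : 1 ≤ pm S := by
  unfold pm
  have : 0 ≤ ∑ i, (S.p i : ℝ) := Finset.sum_nonneg (fun i _ => by positivity)
  linarith

lemma v_le_vm {d : ℕ} (v : Fin d → ℝ) (i : Fin d) : |v i| ≤ vm v := by
  unfold vm
  have := Finset.single_le_sum (f := fun i => |v i|) (fun i _ => by positivity) (Finset.mem_univ i)
  linarith

lemma one_le_vm {d : ℕ} (v : Fin d → ℝ) : 1 ≤ vm v := by
  unfold vm
  have : 0 ≤ ∑ i, |v i| := Finset.sum_nonneg (fun i _ => by positivity)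
  linarith

lemma le_exp_vm {d : ℕ} (v : Fin d → ℝ) : 2 * vm v + 2 ≤ Real.exp (2 * vm v + 1) := by
  have := Real.add_one_le_exp (2 * vm v + 1)
  linarith

lemma pm_le_LL {d : ℕ} (S : Sys d) (v : Fin d → ℝ) : 12 * pm S ≤ LL S v := by
  unfold LL
  have h1 := one_le_pm S
  have h2 := le_exp_vm v
  have h3 := one_le_vm v
  have h4 : pm S ≤ pm S ^ 3 := by
    calc pm S = pm S ^ 1 := (pow_one _).symm
      _ ≤ _ := pow_le_pow_right₀ h1 (by norm_num)
  calc 12 * pm S ≤ 12 * pm S ^ 3 * 1 := by linarith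
    _ ≤ _ := by gcongr; linarith

lemma one_le_LL {d : ℕ} (S : Sys d) (v : Fin d → ℝ) : 1 ≤ LL S v := by
  have := pm_le_LL S v
  have := one_le_pm S
  linarith

lemma vm_le_LL {d : ℕ} (S : Sys d) (v : Fin d → ℝ) : vm v ≤ LL S v := by
  unfold LL
  have h1 := one_le_pm S
  have h2 := le_exp_vm v
  have h3 := one_le_vm v
  have h4 : 1 ≤ pm S ^ 3 := one_le_pow₀ h1
  calc vm v ≤ 1 * 1 * Real.exp (2 * vm v + 1) := by linarith
    _ ≤ _ := by gcongr; norm_num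

/-- A configuration: a slice together with recurrence times. -/
structure Cfg {d : ℕ} (S : Sys d) (v : Fin d → ℝ) (k n : ℕ) where
  N0 : ℕ
  N : ℕ
  hN : N0 ≤ N
  hN1 : NeZero N
  X : Type
  fX : Fintype X
  nX : Nonempty X
  ev : X → Fin d → ℝ
  b : Fin d → ℝ
  c : Fin d → ℝ
  PX : X → Fin k → ℝ
  hc : ∀ i, 1 ≤ |c i| ∧ |c i| ≤ S.p i
  hev : ∀ x i, ev x i ∈ S.A i
  hsl : ∀ x i, |ev x i - b i - c i * pe v (PX x) i| ≤ (1 / 2 : ℝ) ^ N0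
  hinj : ∀ m, N ≤ m → Function.Injective (fun x => DD S m (ev x))
  r : Fin (4 ^ n) → ℤ
  a : Fin (4 ^ n) → Fin d → ℤ
  hkr : ∀ t i, |r t * Real.log 2 - a t i * Real.log (S.p i) - (t.val : ℝ) / 4 ^ n * v i| < (1 / 4 : ℝ) ^ n
  Mr : ℕ
  hMr : ∀ t, |r t| ≤ Mr

namespace Cfg
variable {d : ℕ} {S : Sys d} {v : Fin d → ℝ} {k n : ℕ} (C : Cfg S v k n)

instance : Fintype C.X := C.fX
instance : Nonempty C.X := C.nX
instance : NeZero C.N := C.hN1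
instance : NeZero (4 ^ n : ℕ) := ⟨by positivity⟩

abbrev J := ZMod C.N × Fin (4 ^ n)
abbrev O1 := C.J × C.X
abbrev O2 := C.O1 × C.X

def m0 (j : C.J) : ℕ := j.1.val
def m (j : C.J) : ℕ := mm C.r j
def good (j : C.J) : Prop := C.Mr ≤ C.m0 j ∧ C.m0 j + C.Mr + 2 * n < C.N0
def gd (ω : C.O2) : Prop := C.good ω.1.1 ∧ DD S (C.m ω.1.1) (C.ev ω.1.2) = DD S (C.m ω.1.1) (C.ev ω.2)
def y (ω : C.O2) : Fin d → ℝ := TT S (C.m ω.1.1) (C.ev ω.2)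
def x (ω : C.O1) : Fin d → ℝ := TT S (C.m ω.1) (C.ev ω.2)
def P (ω : C.O2) : Fin k → ℝ := fun j => 2 ^ C.m ω.1.1 * (C.PX ω.2 j - C.PX ω.1.2 j)
def s (ω : C.O2) : ℝ := ((ω.1.1.2.val % 2 ^ n : ℕ) : ℝ) / 4 ^ n
def tc (j : C.J) : ℕ := j.2.val / 2 ^ n
def ap (j : C.J) (i : Fin d) : ℤ := (lv S (C.m j) i : ℤ) - lv S (C.m0 j) i - C.a j.2 i

/-- bound for `ap` -/
def A0 (S : Sys d) (v : Fin d → ℝ) : ℤ := ⌈(Real.log (pm S) + vm v + 1) / Real.log 2⌉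

lemma m_eq {j : C.J} (h : C.good j) : (C.m j : ℤ) = C.m0 j + C.r j.2 := by
  obtain ⟨h1, h2⟩ := h
  have h3 := C.hMr j.2
  have h4 := abs_le.1 h3
  have hN := C.hN
  have hpos : 0 < C.N := Nat.pos_of_ne_zero C.hN1.out
  unfold m0 at h1 h2
  obtain ⟨q, hq⟩ : ∃ q : ℕ, (q : ℤ) = C.m0 j + C.r j.2 := by
    refine ⟨((C.m0 j : ℤ) + C.r j.2).toNat, ?_⟩
    apply Int.toNat_of_nonneg
    unfold m0
    omega
  have hqN : q < C.N := by
    unfold m0 at hq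
    omega
  have e : j.1 + (C.r j.2 : ZMod C.N) = (q : ZMod C.N) := by
    have : ((q : ℤ) : ZMod C.N) = ((C.m0 j + C.r j.2 : ℤ) : ZMod C.N) := by rw [hq]
    unfold m0 at this
    push_cast at this
    rw [ZMod.natCast_zmod_val] at this
    rw [← this]
  unfold m mm
  rw [e, ZMod.val_cast_of_lt hqN, hq]

lemma m_le {j : C.J} (h : C.good j) : C.m j + 2 * n < C.N0 := by
  have h1 := C.m_eq h
  have h4 := abs_le.1 (C.hMr j.2)
  have h2 := h.2
  omega

/-- the time parameter -/
def τ (j : C.J) : ℝ := (j.2.val : ℝ) / 4 ^ n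
/-- the small error -/
def θ (j : C.J) (i : Fin d) : ℝ := C.r j.2 * Real.log 2 - C.a j.2 i * Real.log (S.p i) - C.τ j * v i

lemma θ_lt (j : C.J) (i : Fin d) : |C.θ j i| ≤ (1 / 4 : ℝ) ^ n := (C.hkr j.2 i).le

lemma θ_one (j : C.J) (i : Fin d) : |C.θ j i| ≤ 1 :=
  (C.θ_lt j i).trans (pow_le_one₀ (by norm_num) (by norm_num))

lemma τ_nonneg (j : C.J) : 0 ≤ C.τ j := by unfold τ; positivity

lemma τ_le (j : C.J) : C.τ j ≤ 1 := by
  unfold τ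
  rw [div_le_one (by positivity)]
  exact_mod_cast j.2.isLt.le

lemma τv (j : C.J) (i : Fin d) : |C.τ j * v i| ≤ vm v := by
  rw [abs_mul, abs_of_nonneg (C.τ_nonneg j)]
  have := v_le_vm v i
  nlinarith [C.τ_le j, C.τ_nonneg j, abs_nonneg (v i)]

lemma rel {j : C.J} (h : C.good j) (i : Fin d) :
    ww S (C.m j) i = ww S (C.m0 j) i * (S.p i : ℝ) ^ C.ap j i * Real.exp (-(C.τ j * v i)) *
      Real.exp (-C.θ j i) := ww_rel S (C.m j) (C.m0 j) i (C.r j.2) (C.a j.2 i) (C.τ j) (v i) (C.m_eq h)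

lemma pap_eq {j : C.J} (h : C.good j) (i : Fin d) :
    (S.p i : ℝ) ^ C.ap j i = ww S (C.m j) i / ww S (C.m0 j) i * Real.exp (C.τ j * v i + C.θ j i) := by
  rw [C.rel h i, Real.exp_add, Real.exp_neg, Real.exp_neg]
  have := ww_pos S (C.m0 j) i
  have := Real.exp_pos (C.τ j * v i)
  have := Real.exp_pos (C.θ j i)
  field_simp

lemma pap_le {j : C.J} (h : C.good j) (i : Fin d) :
    (S.p i : ℝ) ^ C.ap j i ≤ pm S * Real.exp (vm v + 1) := by
  rw [C.pap_eq h]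
  have h1 := ww_pos S (C.m0 j) i
  have h2 := ww_le S (C.m j) i
  have h3 := ww_ge S (C.m0 j) i
  have h4 := (abs_le.1 (C.τv j i)).2
  have h5 := (abs_le.1 (C.θ_one j i)).2
  have h6 := p_pos S i
  have h7 := p_le_pm S i
  have h8 : ww S (C.m j) i / ww S (C.m0 j) i ≤ pm S := by
    rw [div_le_iff₀ h1]
    rw [div_le_iff₀ h6] at h3
    nlinarith
  have := one_le_pm S
  gcongr

lemma pap_ge {j : C.J} (h : C.good j) (i : Fin d) :
    1 ≤ pm S * Real.exp (vm v + 1) * (S.p i : ℝ) ^ C.ap j i := by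
  rw [C.pap_eq h]
  have h1 := ww_pos S (C.m0 j) i
  have h2 := ww_le S (C.m0 j) i
  have h3 := ww_ge S (C.m j) i
  have h4 := (abs_le.1 (C.τv j i)).1
  have h5 := (abs_le.1 (C.θ_one j i)).1
  have h6 := p_pos S i
  have h7 := p_le_pm S i
  have h8 : 1 ≤ pm S * (ww S (C.m j) i / ww S (C.m0 j) i) := by
    rw [← mul_div_assoc, le_div_iff₀ h1]
    rw [div_le_iff₀ h6] at h3
    nlinarith [ww_pos S (C.m j) i]
  have h9 : 1 ≤ Real.exp (vm v + 1) * Real.exp (C.τ j * v i + C.θ j i) := by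
    rw [← Real.exp_add]
    apply Real.one_le_exp
    linarith
  calc (1 : ℝ) ≤ (pm S * (ww S (C.m j) i / ww S (C.m0 j) i)) *
      (Real.exp (vm v + 1) * Real.exp (C.τ j * v i + C.θ j i)) := one_le_mul_of_one_le_of_one_le h8 h9
    _ = _ := by ring

lemma ap_le {j : C.J} (h : C.good j) (i : Fin d) : |C.ap j i| ≤ A0 S v := by
  have hp := p_pos S i
  have hp2 := p_ge S i
  have hm := one_le_pm S
  have hl2 : 0 < Real.log 2 := Real.log_pos (by norm_num)
  have hl : Real.log 2 ≤ Real.log (S.p i) := Real.log_le_log (by norm_num) hp2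
  have hz : (0:ℝ) < (S.p i : ℝ) ^ C.ap j i := zpow_pos hp _
  have h1 := Real.log_le_log hz (C.pap_le h i)
  have h2 := Real.log_le_log one_pos (C.pap_ge h i)
  rw [Real.log_zpow, Real.log_mul (by positivity) (by positivity), Real.log_exp] at h1
  rw [Real.log_mul (by positivity) (by positivity), Real.log_zpow, Real.log_mul (by positivity) (by positivity), Real.log_exp,
    Real.log_one] at h2
  have h3 : |(C.ap j i : ℝ)| * Real.log (S.p i) ≤ Real.log (pm S) + vm v + 1 := by
    rw [← abs_of_pos (lt_of_lt_of_le hl2 hl), ← abs_mul]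
    rw [abs_le]
    constructor <;> linarith
  have h4 : |(C.ap j i : ℝ)| ≤ (Real.log (pm S) + vm v + 1) / Real.log 2 := by
    rw [le_div_iff₀ hl2]
    exact (mul_le_mul_of_nonneg_left hl (abs_nonneg _)).trans h3
  have h5 := h4.trans (Int.le_ceil _)
  unfold A0
  exact_mod_cast h5

/-- the label -/
def lab (j : C.J) (i : Fin d) : ℤ × ℕ := (max (-A0 S v) (min (A0 S v) (C.ap j i)), dl S (C.m j) n i)

lemma lab_fst {j : C.J} (h : C.good j) (i : Fin d) : (C.lab j i).1 = C.ap j i := by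
  have := abs_le.1 (C.ap_le h i)
  unfold lab
  simp only
  omega

/-- number of labels -/
def labN (S : Sys d) (v : Fin d → ℝ) : ℕ := ((2 * A0 S v + 1).toNat * 2) ^ d

lemma A0_nonneg (S : Sys d) (v : Fin d → ℝ) : 0 ≤ A0 S v := by
  unfold A0
  apply Int.ceil_nonneg
  have := Real.log_nonneg (one_le_pm S)
  have := one_le_vm v
  have hl2 : 0 < Real.log 2 := Real.log_pos (by norm_num)
  positivity

lemma labN_pos (S : Sys d) (v : Fin d → ℝ) : 0 < labN S v := by
  have := A0_nonneg S v
  unfold labN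
  apply pow_pos
  omega

lemma lab_count {ι : Type*} (f : ι → C.J) (E : Finset ι) (h : Set.InjOn (fun w => C.lab (f w)) E) :
    (E.card : ℝ) ≤ labN S v := by
  classical
  have hA := A0_nonneg S v
  have h1 : ∀ w ∈ E, C.lab (f w) ∈ Fintype.piFinset (fun i : Fin d =>
      Finset.Icc (-A0 S v) (A0 S v) ×ˢ ({lv S n i, lv S n i + 1} : Finset ℕ)) := by
    intro w _
    rw [Fintype.mem_piFinset]
    intro i
    rw [Finset.mem_product]
    constructor
    · unfold lab
      simp only [Finset.mem_Icc]
      omega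
    · have := dl_two S (C.m (f w)) n i
      unfold lab
      simpa using this
  have h2 := Finset.card_le_card_of_injOn _ h1 h
  have h3 : (Fintype.piFinset (fun i : Fin d =>
      Finset.Icc (-A0 S v) (A0 S v) ×ˢ ({lv S n i, lv S n i + 1} : Finset ℕ))).card ≤ labN S v := by
    rw [Fintype.card_piFinset]
    unfold labN
    calc _ ≤ ∏ _i : Fin d, (2 * A0 S v + 1).toNat * 2 := by
          apply Finset.prod_le_prod'
          intro i _
          rw [Finset.card_product]
          apply Nat.mul_le_mul
          · rw [Int.card_Icc]
            omega
          · exact Finset.card_le_two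
      _ = _ := by simp
  exact_mod_cast h2.trans h3

end Cfg
end Part10

section Part11
namespace Cfg
variable {d : ℕ} {S : Sys d} {v : Fin d → ℝ} {k n : ℕ} (C : Cfg S v k n)

lemma diff {ω : C.O2} (h : C.gd ω) {l : ℕ} (hl : l ≤ 2 * n) (i : Fin d) :
    |C.y ω i - C.x ω.1 i - C.c i * ww S (C.m ω.1.1) i * pe v (C.P ω) i| ≤ 2 * (1 / 2 : ℝ) ^ l := by
  have h1 := T_diff S (C.hsl ω.1.2) (C.hsl ω.2) h.2 i
  refine h1.trans ?_
  have h2 := C.m_le h.1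
  have h3 : (2 : ℝ) ^ C.m ω.1.1 * (1 / 2) ^ C.N0 ≤ (1 / 2) ^ l := by
    obtain ⟨e, he⟩ := Nat.exists_eq_add_of_le (show C.m ω.1.1 + l ≤ C.N0 by omega)
    rw [he, pow_add, pow_add]
    have e1 : (2 : ℝ) ^ C.m ω.1.1 * (1 / 2) ^ C.m ω.1.1 = 1 := by rw [← mul_pow]; norm_num
    have e2 : (1 / 2 : ℝ) ^ e ≤ 1 := pow_le_one₀ (by norm_num) (by norm_num)
    have e3 : (0 : ℝ) < (1 / 2 : ℝ) ^ l := by positivity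
    calc (2 : ℝ) ^ C.m ω.1.1 * ((1 / 2) ^ C.m ω.1.1 * (1 / 2) ^ l * (1 / 2) ^ e)
        = (2 : ℝ) ^ C.m ω.1.1 * (1 / 2) ^ C.m ω.1.1 * ((1 / 2) ^ l * (1 / 2) ^ e) := by ring
      _ ≤ _ := by rw [e1]; nlinarith
  linarith

lemma half_two (n : ℕ) : (1 / 2 : ℝ) ^ (2 * n) = (1 / 4) ^ n := by
  rw [pow_mul]; norm_num

lemma pe_le {ω : C.O2} (h : C.gd ω) (i : Fin d) : |pe v (C.P ω) i| ≤ 3 * pm S := by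
  have h1 := C.diff h (l := 0) (by omega) i
  rw [pow_zero] at h1
  have hy0 := TT_nonneg S (C.m ω.1.1) (C.ev ω.2) i
  have hy1 := TT_lt S (C.m ω.1.1) (C.ev ω.2) i
  have hx0 := TT_nonneg S (C.m ω.1.1) (C.ev ω.1.2) i
  have hx1 := TT_lt S (C.m ω.1.1) (C.ev ω.1.2) i
  have h2 : |C.c i * ww S (C.m ω.1.1) i * pe v (C.P ω) i| ≤ 3 := by
    unfold y x at h1
    rw [abs_le] at h1 ⊢
    constructor <;> linarith [h1.1, h1.2]
  rw [abs_mul, abs_mul, abs_of_pos (ww_pos S _ i)] at h2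
  have h3 := (C.hc i).1
  have h4 := ww_ge S (C.m ω.1.1) i
  have h6 := p_pos S i
  have h7 := p_le_pm S i
  rw [div_le_iff₀ h6] at h4
  have hw := ww_pos S (C.m ω.1.1) i
  have ha := abs_nonneg (pe v (C.P ω) i)
  have h8 : ww S (C.m ω.1.1) i * |pe v (C.P ω) i| ≤ 3 := by
    have : 1 * (ww S (C.m ω.1.1) i * |pe v (C.P ω) i|) ≤ |C.c i| * (ww S (C.m ω.1.1) i * |pe v (C.P ω) i|) := by
      gcongr
    linarith
  calc |pe v (C.P ω) i| = 1 * |pe v (C.P ω) i| := by ring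
    _ ≤ (ww S (C.m ω.1.1) i * S.p i) * |pe v (C.P ω) i| := by gcongr
    _ = (ww S (C.m ω.1.1) i * |pe v (C.P ω) i|) * S.p i := by ring
    _ ≤ 3 * pm S := by gcongr

lemma y_mem (ω : C.O2) (i : Fin d) : C.y ω i ∈ S.A i := TT_mem S _ _ i (C.hev _ i)

/-- conditioning data -/
def Z (ω : C.O1) : (Fin d → ℤ × ℕ) × (Fin d → ℕ × ℤ) × (Fin d → ℤ) :=
  (C.lab ω.1, WW S (C.m ω.1) (2 * n) (C.ev ω.2), YY S n (C.m0 ω.1))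

/-- coarse reference time -/
def τc (j : C.J) : ℝ := (C.tc j : ℝ) / 2 ^ n

lemma τ_split (ω : C.O2) : C.τ ω.1.1 = C.τc ω.1.1 + C.s ω := by
  unfold τ τc s tc
  have h1 : ((ω.1.1.2.val : ℕ) : ℝ) = (2 ^ n : ℝ) * ((ω.1.1.2.val / 2 ^ n : ℕ) : ℝ) + ((ω.1.1.2.val % 2 ^ n : ℕ) : ℝ) := by
    exact_mod_cast (Nat.div_add_mod _ _).symm
  have h4 : (4 : ℝ) ^ n = 2 ^ n * 2 ^ n := by rw [← mul_pow]; norm_num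
  rw [h1, h4]
  field_simp

lemma s_bd (ω : C.O2) : 0 ≤ C.s ω ∧ C.s ω ≤ (1 / 2 : ℝ) ^ n := by
  unfold s
  refine ⟨by positivity, ?_⟩
  rw [div_le_iff₀ (by positivity), ← mul_pow]
  norm_num
  have : ω.1.1.2.val % 2 ^ n < 2 ^ n := Nat.mod_lt _ (by positivity)
  exact_mod_cast this.le

/-- reference coefficients -/
def cr (j : C.J) (i : Fin d) : ℝ :=
  C.c i * ww S (C.m0 j) i * (S.p i : ℝ) ^ C.ap j i * Real.exp (-(C.τc j * v i))

lemma τc_bd (ω : C.O2) (i : Fin d) : |C.τc ω.1.1 * v i| ≤ vm v := by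
  have h1 := C.τ_split ω
  have h2 := C.s_bd ω
  have h3 := C.τ_le ω.1.1
  have h0 : 0 ≤ C.τc ω.1.1 := by unfold τc; positivity
  rw [abs_mul, abs_of_nonneg h0]
  have := v_le_vm v i
  nlinarith [abs_nonneg (v i)]

lemma exp2 (v : Fin d → ℝ) : Real.exp (vm v + 1) * Real.exp (vm v) = Real.exp (2 * vm v + 1) := by
  rw [← Real.exp_add]; congr 1; ring

lemma cr_bd {ω : C.O2} (h : C.gd ω) (i : Fin d) : 1 / LL S v ≤ |C.cr ω.1.1 i| ∧ |C.cr ω.1.1 i| ≤ LL S v := by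
  have hc := C.hc i
  have hw0 := ww_pos S (C.m0 ω.1.1) i
  have hw1 := ww_le S (C.m0 ω.1.1) i
  have hw2 := ww_ge S (C.m0 ω.1.1) i
  have hp := p_pos S i
  have hpm := p_le_pm S i
  have hz : (0:ℝ) < (S.p i : ℝ) ^ C.ap ω.1.1 i := zpow_pos hp _
  have ha1 := C.pap_le h.1 i
  have ha2 := C.pap_ge h.1 i
  have ht := abs_le.1 (C.τc_bd ω i)
  have hm := one_le_pm S
  have e1 : Real.exp (-(C.τc ω.1.1 * v i)) ≤ Real.exp (vm v) := Real.exp_le_exp.2 (by linarith)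
  have e2 : 1 ≤ Real.exp (vm v) * Real.exp (-(C.τc ω.1.1 * v i)) := by
    rw [← Real.exp_add]; apply Real.one_le_exp; linarith
  have e0 := Real.exp_pos (-(C.τc ω.1.1 * v i))
  have hE := exp2 v
  have habs : |C.cr ω.1.1 i| = |C.c i| * ww S (C.m0 ω.1.1) i * (S.p i : ℝ) ^ C.ap ω.1.1 i * Real.exp (-(C.τc ω.1.1 * v i)) := by
    unfold cr
    rw [abs_mul, abs_mul, abs_mul, abs_of_pos hw0, abs_of_pos hz, abs_of_pos e0]
  have hm23 : pm S ^ 2 ≤ 12 * pm S ^ 3 := by nlinarith [pow_pos (show 0 < pm S by linarith) 2]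
  rw [habs]
  constructor
  · rw [div_le_iff₀ (by have := one_le_LL S v; linarith)]
    rw [div_le_iff₀ hp] at hw2
    have h1 : 1 ≤ pm S * ww S (C.m0 ω.1.1) i := by nlinarith
    calc (1 : ℝ) ≤ 1 * (pm S * ww S (C.m0 ω.1.1) i) * (pm S * Real.exp (vm v + 1) * (S.p i : ℝ) ^ C.ap ω.1.1 i) *
          (Real.exp (vm v) * Real.exp (-(C.τc ω.1.1 * v i))) := by
            rw [one_mul]
            exact one_le_mul_of_one_le_of_one_le (one_le_mul_of_one_le_of_one_le h1 ha2) e2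
      _ ≤ |C.c i| * (pm S * ww S (C.m0 ω.1.1) i) * (pm S * Real.exp (vm v + 1) * (S.p i : ℝ) ^ C.ap ω.1.1 i) *
          (Real.exp (vm v) * Real.exp (-(C.τc ω.1.1 * v i))) := by
            gcongr
            exact hc.1
      _ = |C.c i| * ww S (C.m0 ω.1.1) i * (S.p i : ℝ) ^ C.ap ω.1.1 i * Real.exp (-(C.τc ω.1.1 * v i)) *
          (pm S ^ 2 * (Real.exp (vm v + 1) * Real.exp (vm v))) := by ring
      _ ≤ _ := by
            rw [hE]; unfold LL; gcongr
  · calc _ ≤ pm S * 1 * (pm S * Real.exp (vm v + 1)) * Real.exp (vm v) := by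
          gcongr
          exact hc.2.trans hpm
      _ = pm S ^ 2 * (Real.exp (vm v + 1) * Real.exp (vm v)) := by ring
      _ ≤ _ := by rw [hE]; unfold LL; gcongr

lemma floor_close {Q a b : ℝ} (hQ : 0 < Q) (h : ⌊Q * a⌋ = ⌊Q * b⌋) : |a - b| ≤ 1 / Q := by
  have := Int.abs_sub_lt_one_of_floor_eq_floor h
  rw [← mul_sub, abs_mul, abs_of_pos hQ] at this
  rw [le_div_iff₀ hQ]
  linarith

lemma ww_close {j j' : C.J} (h : YY S n (C.m0 j) = YY S n (C.m0 j')) (i : Fin d) :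
    |ww S (C.m0 j) i - ww S (C.m0 j') i| ≤ (1 / 4 : ℝ) ^ n := by
  have h1 := congrFun h i
  unfold YY at h1
  have := floor_close (by positivity) h1
  rwa [one_div_pow]

lemma hy_bd {ω ω0 : C.O2} (h : C.gd ω) (h0 : C.gd ω0) (hZ : C.Z ω.1 = C.Z ω0.1) (ht : C.tc ω.1.1 = C.tc ω0.1.1) (i : Fin d) :
    |C.y ω i - C.x ω0.1 i - C.cr ω0.1.1 i * (Real.exp (-(C.s ω * v i)) * pe v (C.P ω) i)| ≤ LL S v * (1 / 4 : ℝ) ^ n := by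
  have d1 := C.diff h (l := 2 * n) le_rfl i
  rw [half_two] at d1
  have hZ1 : C.lab ω.1.1 = C.lab ω0.1.1 := congrArg Prod.fst hZ
  have hZ2 : WW S (C.m ω.1.1) (2 * n) (C.ev ω.1.2) = WW S (C.m ω0.1.1) (2 * n) (C.ev ω0.1.2) :=
    congrArg (fun z => z.2.1) hZ
  have hZ3 : YY S n (C.m0 ω.1.1) = YY S n (C.m0 ω0.1.1) := congrArg (fun z => z.2.2) hZ
  have d2 := WW_close S hZ2 i
  rw [half_two] at d2
  have d3 := C.ww_close hZ3 i
  have hap : C.ap ω.1.1 i = C.ap ω0.1.1 i := by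
    rw [← C.lab_fst h.1, ← C.lab_fst h0.1, hZ1]
  have hτ : C.τc ω0.1.1 = C.τc ω.1.1 := by unfold τc; rw [ht]
  have hrel := C.rel h.1 i
  have hpe := C.pe_le h i
  set q := (1 / 4 : ℝ) ^ n with hq
  have hq0 : 0 < q := by positivity
  set w := ww S (C.m0 ω.1.1) i with hw
  set w0 := ww S (C.m0 ω0.1.1) i with hw0
  set pa := (S.p i : ℝ) ^ C.ap ω0.1.1 i with hpa
  set eτ := Real.exp (-(C.τ ω.1.1 * v i)) with heτ
  set eθ := Real.exp (-C.θ ω.1.1 i) with heθ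
  set p' := pe v (C.P ω) i with hp'
  have hcr : C.cr ω0.1.1 i * Real.exp (-(C.s ω * v i)) = C.c i * w0 * pa * eτ := by
    unfold cr
    rw [hτ, mul_assoc _ (Real.exp _), ← Real.exp_add, heτ, C.τ_split ω]
    congr 2
    ring
  rw [hap] at hrel
  have hm := one_le_pm S
  have hpa1 : pa ≤ pm S * Real.exp (vm v + 1) := C.pap_le h0.1 i
  have hpa0 : 0 < pa := zpow_pos (p_pos S i) _
  have he1 : eτ ≤ Real.exp (vm v) := Real.exp_le_exp.2 (by linarith [(abs_le.1 (C.τv ω.1.1 i)).1])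
  have he0 : 0 < eτ := Real.exp_pos _
  have hθ : |eθ - 1| ≤ 2 * q := by
    have := Real.abs_exp_sub_one_le (x := -C.θ ω.1.1 i) (by rw [abs_neg]; exact C.θ_one _ _)
    rw [abs_neg] at this
    linarith [C.θ_lt ω.1.1 i]
  have hww : |w * eθ - w0| ≤ 3 * q := by
    have e : w * eθ - w0 = w * (eθ - 1) + (w - w0) := by ring
    rw [e]
    have hw1 : |w| ≤ 1 := by rw [abs_of_pos (ww_pos S _ i)]; exact ww_le S _ i
    calc _ ≤ |w * (eθ - 1)| + |w - w0| := abs_add_le _ _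
      _ ≤ 1 * (2 * q) + q := by
        rw [abs_mul]; gcongr
      _ = _ := by ring
  have hE := exp2 v
  have key : |C.c i * ww S (C.m ω.1.1) i * p' - C.cr ω0.1.1 i * (Real.exp (-(C.s ω * v i)) * p')| ≤
      9 * pm S ^ 3 * Real.exp (2 * vm v + 1) * q := by
    rw [← mul_assoc (C.cr _ _), hcr, hrel]
    have e : C.c i * (w * pa * eτ * eθ) * p' - C.c i * w0 * pa * eτ * p' = C.c i * pa * eτ * (w * eθ - w0) * p' := by ring
    rw [e, abs_mul, abs_mul, abs_mul, abs_mul, abs_of_pos hpa0, abs_of_pos he0]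
    calc _ ≤ pm S * (pm S * Real.exp (vm v + 1)) * Real.exp (vm v) * (3 * q) * (3 * pm S) := by
          gcongr
          exact (C.hc i).2.trans (p_le_pm S i)
      _ = 9 * pm S ^ 3 * (Real.exp (vm v + 1) * Real.exp (vm v)) * q := by ring
      _ = _ := by rw [hE]
  have d2' : |C.x ω.1 i - C.x ω0.1 i| ≤ pm S * q := by
    refine d2.trans ?_
    gcongr
    exact p_le_pm S i
  have hfin : 2 + pm S ≤ 3 * pm S ^ 3 * Real.exp (2 * vm v + 1) := by
    have h1 := le_exp_vm v
    have h2 := one_le_vm v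
    have h3 : pm S ≤ pm S ^ 3 := by
      calc pm S = pm S ^ 1 := (pow_one _).symm
        _ ≤ _ := pow_le_pow_right₀ hm (by norm_num)
    calc 2 + pm S ≤ 3 * pm S ^ 3 * 1 := by linarith
      _ ≤ _ := by gcongr; linarith
  calc _ = |(C.y ω i - C.x ω.1 i - C.c i * ww S (C.m ω.1.1) i * p') + (C.x ω.1 i - C.x ω0.1 i) +
        (C.c i * ww S (C.m ω.1.1) i * p' - C.cr ω0.1.1 i * (Real.exp (-(C.s ω * v i)) * p'))| := by congr 1; ring
    _ ≤ 2 * q + pm S * q + 9 * pm S ^ 3 * Real.exp (2 * vm v + 1) * q :=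
        (abs_add_le _ _).trans (add_le_add ((abs_add_le _ _).trans (add_le_add d1 d2')) key)
    _ = (2 + pm S + 9 * pm S ^ 3 * Real.exp (2 * vm v + 1)) * q := by ring
    _ ≤ _ := by unfold LL; gcongr; linarith

lemma geo (E : Finset C.O2) (ω0 : C.O2) (h0 : C.gd ω0) (h : ∀ ω ∈ E, C.gd ω)
    (hZ : ∀ ω ∈ E, C.Z ω.1 = C.Z ω0.1) (ht : ∀ ω ∈ E, C.tc ω.1.1 = C.tc ω0.1.1) :
    Geo S v (LL S v) n E C.y (C.x ω0.1) (C.cr ω0.1.1) C.s C.P where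
  hv i := (v_le_vm v i).trans (vm_le_LL S v)
  hA ω _ i := C.y_mem ω i
  hc i := C.cr_bd h0 i
  hs ω _ := C.s_bd ω
  hpe ω hω i := (C.pe_le (h ω hω) i).trans (by
    have := pm_le_LL S v
    have := one_le_pm S
    linarith)
  hy ω hω i := C.hy_bd (h ω hω) h0 (hZ ω hω) (ht ω hω) i

end Cfg
end Part11

section Part12
namespace Cfg
variable {d : ℕ} {S : Sys d} {v : Fin d → ℝ}

section defs
variable {k n : ℕ} (C : Cfg S v k n)

/-- the two-point weights -/
def pp : C.O2 → ℝ := pk (fun (j : C.J) x => DD S (mm C.r j) (C.ev x))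
lemma pp_nonneg (ω : C.O2) : 0 ≤ C.pp ω := pk_nonneg _ ω
lemma pp_sum : ∑ ω, C.pp ω = 1 := pk_sum _

/-- wrap error -/
def ew : ℝ := ∑ ω, C.pp ω * indi (¬ C.gd ω)

/-- future names of the second point -/
def W (l : ℕ) (ω : C.O2) : Fin d → ℕ × ℤ := WW S (C.m ω.1.1) l (C.ev ω.2)

lemma ew_nonneg : 0 ≤ C.ew := Finset.sum_nonneg fun ω _ => mul_nonneg (C.pp_nonneg ω) (indi_nonneg _)

lemma pq_le (l : ℕ) (j : C.J) (i : Fin d) : 0 < (S.p i : ℝ) ^ dl S (C.m j) l i ∧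
    (S.p i : ℝ) ^ dl S (C.m j) l i ≤ LL S v * 2 ^ l := by
  refine ⟨pow_pos (p_pos S i) _, (pdl_le S _ l i).trans ?_⟩
  gcongr
  have := pm_le_LL S v
  have := p_le_pm S i
  have := one_le_pm S
  linarith

lemma W_cells (l : ℕ) (ω0 : C.O2) (E : Finset C.O2) (hd : ∀ ω ∈ E, ∀ i, dl S (C.m ω.1.1) l i = dl S (C.m ω0.1.1) l i)
    (h : Set.InjOn (C.W l) E) :
    Set.InjOn (fun (ω : C.O2) (i : Fin d) => ⌊(S.p i : ℝ) ^ dl S (C.m ω0.1.1) l i * C.y ω i⌋) E := by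
  intro ω hω ω' hω' he
  apply h hω hω'
  funext i
  have := congrFun he i
  simp only at this
  unfold W WW
  rw [hd ω hω i, hd ω' hω' i]
  exact Prod.ext rfl this

lemma W_count (l : ℕ) (E : Finset C.O2) (h : Set.InjOn (C.W l) E) : (E.card : ℝ) ≤ nameN S l :=
  WW_count S l E (fun ω => C.m ω.1.1) (fun ω => C.ev ω.2) h

lemma W_close {l : ℕ} {ω ω' : C.O2} (h : C.W l ω = C.W l ω') (i : Fin d) :
    |C.y ω i - C.y ω' i| ≤ LL S v * (1 / 2 : ℝ) ^ l := by
  refine (WW_close S h i).trans ?_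
  gcongr
  have := pm_le_LL S v
  have := p_le_pm S i
  have := one_le_pm S
  linarith

end defs

lemma ent_b {k : ℕ} {β : ℝ} (hβ : 0 ≤ β) (h : UB S v k β) : ∃ Kc : ℝ, 1 ≤ Kc ∧ ∀ (n : ℕ) (C : Cfg S v k n),
    cent C.pp (C.W n) (fun ω => (C.tc ω.1.1, C.Z ω.1)) ≤
      Real.log 3 + Real.log (Kc * (2 : ℝ) ^ (β * n)) + C.ew * Real.log (nameN S n) := by
  obtain ⟨Kc, hKc, H⟩ := geo_b h (LL S v) (one_le_LL S v)
  refine ⟨Kc, hKc, fun n C => ?_⟩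
  refine cent_two C.pp_nonneg C.pp_sum _ _ (fun ω => ¬ C.gd ω) _ _ ?_ (by exact_mod_cast nameN_pos S n) ?_ ?_
  · exact one_le_mul_of_one_le_of_one_le hKc (Real.one_le_rpow (by norm_num) (by positivity))
  · intro z E hz hg hinj
    rcases E.eq_empty_or_nonempty with rfl | ⟨ω0, hω0⟩
    · simp; positivity
    have hZ : ∀ ω ∈ E, C.Z ω.1 = C.Z ω0.1 := fun ω hω => by
      have := (hz ω hω).trans (hz ω0 hω0).symm
      exact congrArg Prod.snd this
    have ht : ∀ ω ∈ E, C.tc ω.1.1 = C.tc ω0.1.1 := fun ω hω => by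
      have := (hz ω hω).trans (hz ω0 hω0).symm
      exact congrArg Prod.fst this
    refine H n E C.y _ _ _ _ _ (C.geo E ω0 (not_not.1 (hg ω0 hω0)) (fun ω hω => not_not.1 (hg ω hω)) hZ ht)
      (fun i => C.pq_le n ω0.1.1 i) (C.W_cells n ω0 E ?_ hinj)
    intro ω hω i
    exact congrArg (fun z => (z.1 i).2) (hZ ω hω)
  · intro E hE
    exact C.W_count n E hE

lemma ent_c {k : ℕ} {β : ℝ} (hβ : 0 ≤ β) (h : UB S v (k + 1) β) : ∃ Kc : ℝ, 1 ≤ Kc ∧ ∀ (n : ℕ) (C : Cfg S v k n),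
    cent C.pp (C.W (2 * n)) (fun ω => (C.W n ω, (C.tc ω.1.1, C.Z ω.1))) ≤
      Real.log 3 + Real.log (Kc * (2 : ℝ) ^ (β * n)) + C.ew * Real.log (nameN S (2 * n)) := by
  obtain ⟨Kc, hKc, H⟩ := geo_c h (LL S v) (one_le_LL S v)
  refine ⟨Kc, hKc, fun n C => ?_⟩
  refine cent_two C.pp_nonneg C.pp_sum _ _ (fun ω => ¬ C.gd ω) _ _ ?_ (by exact_mod_cast nameN_pos S _) ?_ ?_
  · exact one_le_mul_of_one_le_of_one_le hKc (Real.one_le_rpow (by norm_num) (by positivity))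
  · intro z E hz hg hinj
    rcases E.eq_empty_or_nonempty with rfl | ⟨ω0, hω0⟩
    · simp; positivity
    have hW : ∀ ω ∈ E, C.W n ω = z.1 := fun ω hω => congrArg Prod.fst (hz ω hω)
    have hZ : ∀ ω ∈ E, C.Z ω.1 = C.Z ω0.1 := fun ω hω => by
      have := (hz ω hω).trans (hz ω0 hω0).symm
      exact congrArg (fun z => z.2.2) this
    have ht : ∀ ω ∈ E, C.tc ω.1.1 = C.tc ω0.1.1 := fun ω hω => by
      have := (hz ω hω).trans (hz ω0 hω0).symm
      exact congrArg (fun z => z.2.1) this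
    refine H n E C.y _ _ _ _ _ (C.geo E ω0 (not_not.1 (hg ω0 hω0)) (fun ω hω => not_not.1 (hg ω hω)) hZ ht)
      (fun i => ?_) (fun ω hω ω' hω' i => C.W_close ((hW ω hω).trans (hW ω' hω').symm) i) (C.W_cells (2 * n) ω0 E ?_ hinj)
    · have := C.pq_le (2 * n) ω0.1.1 i
      rw [pow_mul] at this
      norm_num at this ⊢
      exact this
    intro ω hω i
    exact congrArg (fun z => (z.2.1 i).1) (hZ ω hω)
  · intro E hE
    exact C.W_count _ E hE

section lastcoord
variable {k n : ℕ} (C : Cfg S v (k + 1) n)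
/-- degenerate leading coefficient -/
def bd (l : ℕ) (ω : C.O2) : Prop := |C.P ω (Fin.last k)| ≤ (1 / 2 : ℝ) ^ l
/-- its probability -/
def eb (l : ℕ) : ℝ := ∑ ω, C.pp ω * indi (¬ ¬ C.gd ω ∧ C.bd l ω)
lemma eb_nonneg (l : ℕ) : 0 ≤ C.eb l := Finset.sum_nonneg fun ω _ => mul_nonneg (C.pp_nonneg ω) (indi_nonneg _)
end lastcoord

lemma ent_p {k : ℕ} {β0 β : ℝ} (hβ : 0 ≤ β) (h : UB S v (k + 1) β) (h0 : UB S v k β0) :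
    ∃ Kp : ℝ, 1 ≤ Kp ∧ ∃ Kd : ℝ, 1 ≤ Kd ∧ ∀ (n : ℕ) (C : Cfg S v (k + 1) n) (l : ℕ), l ≤ 2 * n →
    cent C.pp (C.W l) (fun ω => ω.1) ≤
      Real.log 3 + Real.log (Kp * (2 : ℝ) ^ (β * l)) +
      C.eb l * (Real.log (Kd * (2 : ℝ) ^ (β0 * l)) - Real.log (Kp * (2 : ℝ) ^ (β * l))) +
      C.ew * Real.log (nameN S l) := by
  obtain ⟨Kp, hKp, Hp⟩ := count_plain h (LL S v) (one_le_LL S v)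
  obtain ⟨Kd, hKd, Hd⟩ := count_drop h0 (LL S v) (one_le_LL S v)
  refine ⟨Kp, hKp, Kd, hKd, fun n C l hl => ?_⟩
  have hm := one_le_pm S
  have hmL := pm_le_LL S v
  have hcb : ∀ (j : C.J) i, 1 / LL S v ≤ |C.c i * ww S (C.m j) i| ∧ |C.c i * ww S (C.m j) i| ≤ LL S v := by
    intro j i
    have hc := C.hc i
    have hw1 := ww_ge S (C.m j) i
    have hw2 := ww_le S (C.m j) i
    have hw := ww_pos S (C.m j) i
    have hp := p_pos S i
    have hpm := p_le_pm S i
    rw [abs_mul, abs_of_pos hw]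
    constructor
    · calc 1 / LL S v ≤ 1 / S.p i := by gcongr; linarith
        _ ≤ 1 * ww S (C.m j) i := by linarith
        _ ≤ _ := by gcongr; exact hc.1
    · calc _ ≤ pm S * 1 := by gcongr; exact hc.2.trans hpm
        _ ≤ _ := by linarith
  have hdf : ∀ ω : C.O2, C.gd ω → ∀ i, |C.y ω i - C.x ω.1 i - C.c i * ww S (C.m ω.1.1) i * pe v (C.P ω) i| ≤ LL S v * (1 / 2 : ℝ) ^ l := by
    intro ω hω i
    refine (C.diff hω hl i).trans ?_
    gcongr
    linarith
  refine cent_three C.pp_nonneg C.pp_sum _ _ (fun ω => ¬ C.gd ω) (C.bd l) _ _ _ ?_ (by positivity) (by exact_mod_cast nameN_pos S _) ?_ ?_ ?_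
  · exact one_le_mul_of_one_le_of_one_le hKp (Real.one_le_rpow (by norm_num) (by positivity))
  · intro z E hz hg hb hinj
    rcases E.eq_empty_or_nonempty with rfl | ⟨ω0, hω0⟩
    · simp; positivity
    refine Hp l E C.y (C.x z) _ C.P _ (fun ω _ i => C.y_mem ω i) (hcb z.1) ?_ (fun i => C.pq_le l ω0.1.1 i) (C.W_cells l ω0 E ?_ hinj)
    · intro ω hω i
      have := hdf ω (not_not.1 (hg ω hω)) i
      rwa [hz ω hω] at this
    · intro ω hω i
      rw [hz ω hω, hz ω0 hω0]
  · intro z E hz hg hb hinj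
    rcases E.eq_empty_or_nonempty with rfl | ⟨ω0, hω0⟩
    · simp; positivity
    refine Hd l E C.y (C.x z) _ C.P _ (fun i => (v_le_vm v i).trans (vm_le_LL S v)) (fun ω _ i => C.y_mem ω i) (hcb z.1) ?_ (fun ω hω => hb ω hω) (fun i => C.pq_le l ω0.1.1 i) (C.W_cells l ω0 E ?_ hinj)
    · intro ω hω i
      have := hdf ω (not_not.1 (hg ω hω)) i
      rwa [hz ω hω] at this
    · intro ω hω i
      rw [hz ω hω, hz ω0 hω0]
  · intro E hE
    exact C.W_count _ E hE

lemma ent_d {k : ℕ} (hv : Function.Injective v) (hk : k + 2 ≤ d) : ∃ Cd : ℝ, 1 ≤ Cd ∧ ∀ (n : ℕ) (C : Cfg S v (k + 1) n) (l : ℕ),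
    cent C.pp (fun ω => ω.1.1.2) (fun ω => (C.W (2 * n) ω, (C.W n ω, (C.tc ω.1.1, C.Z ω.1)))) ≤
      Real.log 3 + Real.log (3 * Cd * 2 ^ l) +
      C.eb l * (Real.log ((2:ℝ) ^ n) - Real.log (3 * Cd * 2 ^ l)) + C.ew * Real.log ((4:ℝ) ^ n) := by
  obtain ⟨Cd, hCd, H⟩ := geo_d S hv hk (LL S v) (one_le_LL S v)
  refine ⟨Cd, hCd, fun n C l => ?_⟩
  have h2l : (1:ℝ) ≤ 2 ^ l := one_le_pow₀ (by norm_num)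
  have hCl : 1 ≤ Cd * 2 ^ l := one_le_mul_of_one_le_of_one_le hCd h2l
  refine cent_three C.pp_nonneg C.pp_sum _ _ (fun ω => ¬ C.gd ω) (C.bd l) _ _ _ ?_ (by positivity) (by positivity) ?_ ?_ ?_
  · linarith
  · intro z E hz hg hb hinj
    rcases E.eq_empty_or_nonempty with rfl | ⟨ω0, hω0⟩
    · simp; positivity
    have hW : ∀ ω ∈ E, C.W (2 * n) ω = z.1 := fun ω hω => congrArg Prod.fst (hz ω hω)
    have hZ : ∀ ω ∈ E, C.Z ω.1 = C.Z ω0.1 := fun ω hω => by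
      have := (hz ω hω).trans (hz ω0 hω0).symm
      exact congrArg (fun z => z.2.2.2) this
    have ht : ∀ ω ∈ E, C.tc ω.1.1 = C.tc ω0.1.1 := fun ω hω => by
      have := (hz ω hω).trans (hz ω0 hω0).symm
      exact congrArg (fun z => z.2.2.1) this
    have key := H n E C.y _ _ _ _ ((1 / 2 : ℝ) ^ l) (C.geo E ω0 (not_not.1 (hg ω0 hω0)) (fun ω hω => not_not.1 (hg ω hω)) hZ ht)
      (fun ω hω ω' hω' i => by
        have := C.W_close ((hW ω hω).trans (hW ω' hω').symm) i
        rwa [half_two] at this) (by positivity) (fun ω hω => (not_le.1 (hb ω hω)).le)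
    have h1 : ∀ ω ∈ E, (ω.1.1.2.val : ℤ) ∈ Finset.Icc ((ω0.1.1.2.val : ℤ) - ⌊Cd * 2 ^ l⌋) ((ω0.1.1.2.val : ℤ) + ⌊Cd * 2 ^ l⌋) := by
      intro ω hω
      have e1 := key ω hω ω0 hω0
      have e2 : Cd / (1 / 2 : ℝ) ^ l = Cd * 2 ^ l := by
        rw [one_div_pow]; field_simp
      rw [e2] at e1
      have e3 := C.τ_split ω
      have e4 := C.τ_split ω0
      have e5 : C.τc ω.1.1 = C.τc ω0.1.1 := by unfold τc; rw [ht ω hω]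
      have e6 : C.s ω - C.s ω0 = C.τ ω.1.1 - C.τ ω0.1.1 := by rw [e3, e4, e5]; ring
      rw [e6] at e1
      unfold τ at e1
      rw [← sub_div, abs_div, abs_of_pos (by positivity : (0:ℝ) < 4 ^ n), one_div_pow, div_eq_mul_one_div] at e1
      have e7 : |(ω.1.1.2.val : ℝ) - ω0.1.1.2.val| ≤ Cd * 2 ^ l := le_of_mul_le_mul_right e1 (by positivity)
      have e8 : |(ω.1.1.2.val : ℤ) - ω0.1.1.2.val| ≤ ⌊Cd * 2 ^ l⌋ := by
        rw [Int.le_floor]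
        push_cast
        exact e7
      rw [Finset.mem_Icc]
      have := abs_le.1 e8
      constructor <;> linarith
    have h2 := Finset.card_le_card_of_injOn _ h1 (fun ω hω ω' hω' he => hinj hω hω' (Fin.ext (by simpa using he)))
    rw [Int.card_Icc] at h2
    have h3 : ((E.card : ℤ) : ℝ) ≤ ((2 * ⌊Cd * 2 ^ l⌋ + 1 : ℤ) : ℝ) := by
      have : (0:ℤ) ≤ ⌊Cd * 2 ^ l⌋ := Int.floor_nonneg.2 (by linarith)
      exact_mod_cast (by omega : (E.card : ℤ) ≤ 2 * ⌊Cd * 2 ^ l⌋ + 1)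
    push_cast at h3
    have := Int.floor_le (Cd * 2 ^ l)
    linarith
  · intro z E hz hg hb hinj
    rcases E.eq_empty_or_nonempty with rfl | ⟨ω0, hω0⟩
    · simp
    have ht : ∀ ω ∈ E, C.tc ω.1.1 = C.tc ω0.1.1 := fun ω hω => by
      have := (hz ω hω).trans (hz ω0 hω0).symm
      exact congrArg (fun z => z.2.2.1) this
    have h1 : ∀ ω ∈ E, ω.1.1.2.val % 2 ^ n ∈ Finset.range (2 ^ n) := fun ω _ =>
      Finset.mem_range.2 (Nat.mod_lt _ (by positivity))
    have h2 := Finset.card_le_card_of_injOn _ h1 (fun ω hω ω' hω' he => hinj hω hω' (Fin.ext (by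
      have t1 := (ht ω hω).trans (ht ω' hω').symm
      unfold tc at t1
      rw [← Nat.div_add_mod ω.1.1.2.val (2 ^ n), ← Nat.div_add_mod ω'.1.1.2.val (2 ^ n), t1, he])))
    rw [Finset.card_range] at h2
    exact_mod_cast h2
  · intro E hE
    have := Finset.card_le_card_of_injOn _ (fun _ _ => Finset.mem_univ _) hE
    rw [Finset.card_univ, Fintype.card_fin] at this
    exact_mod_cast this

end Cfg
end Part12

section Part13
lemma prob_val_lt {N : ℕ} [NeZero N] (c : ℕ) : ∑ g : ZMod N, un (ZMod N) g * indi (g.val < c) ≤ (c : ℝ) / N := by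
  classical
  unfold un
  rw [← Finset.mul_sum, ZMod.card]
  have h1 : ∑ g : ZMod N, indi (g.val < c) = ((Finset.univ.filter (fun g : ZMod N => g.val < c)).card : ℝ) := by
    rw [Finset.card_filter, Nat.cast_sum]
    refine Finset.sum_congr rfl (fun g _ => ?_)
    by_cases hg : g.val < c
    · rw [indi_pos hg, if_pos hg]; simp
    · rw [indi_neg hg, if_neg hg]; simp
  have h2 : (Finset.univ.filter (fun g : ZMod N => g.val < c)).card ≤ c := by
    have h3 : ∀ g ∈ Finset.univ.filter (fun g : ZMod N => g.val < c), g.val ∈ Finset.range c := by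
      intro g hg
      rw [Finset.mem_filter] at hg
      exact Finset.mem_range.2 hg.2
    have h4 := Finset.card_le_card_of_injOn _ h3 (fun a _ b _ h => ZMod.val_injective N h)
    rwa [Finset.card_range] at h4
  rw [h1, one_div, ← div_eq_inv_mul]
  gcongr

namespace Cfg
variable {d : ℕ} {S : Sys d} {v : Fin d → ℝ} {k n : ℕ} (C : Cfg S v k n)

lemma pp_fst (a : C.O1) : un C.O1 a = pr C.pp (fun ω => ω.1) a := pk_fst _ a

lemma ew_le : C.ew ≤ (2 * C.Mr + 2 * n + (C.N - C.N0) : ℝ) / C.N := by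
  have hN := C.hN
  have h1 : C.ew ≤ ∑ ω, C.pp ω * indi (¬ C.good ω.1.1) := by
    unfold ew
    apply Finset.sum_le_sum
    intro ω _
    by_cases hD : DD S (C.m ω.1.1) (C.ev ω.1.2) = DD S (C.m ω.1.1) (C.ev ω.2)
    · apply mul_le_mul_of_nonneg_left _ (C.pp_nonneg ω)
      by_cases hg : C.good ω.1.1
      · rw [indi_neg (not_not.2 ⟨hg, hD⟩)]; exact indi_nonneg _
      · rw [indi_pos hg]; exact indi_le_one _
    · have : C.pp ω = 0 := by
        unfold pp pk
        rw [indi_neg]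
        · simp
        · intro h; exact hD h.symm
      rw [this]; simp
  have h2 : ∑ ω, C.pp ω * indi (¬ C.good ω.1.1) = ∑ ω : C.O1, un C.O1 ω * indi (¬ C.good ω.1) := by
    have := sum_pr C.pp (fun ω => ω.1) (fun ω : C.O1 => indi (¬ C.good ω.1))
    rw [← this]
    exact Finset.sum_congr rfl fun ω _ => by rw [C.pp_fst]
  have h3 : ∑ ω : C.O1, un C.O1 ω * indi (¬ C.good ω.1) ≤ ∑ g : ZMod C.N, un (ZMod C.N) g *
      indi (¬ (C.Mr ≤ g.val ∧ g.val + C.Mr + 2 * n < C.N0)) := by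
    have := sum_pr (un C.O1) (fun ω => ω.1.1) (fun g => indi (¬ (C.Mr ≤ g.val ∧ g.val + C.Mr + 2 * n < C.N0)))
    have e : ∀ g, pr (un C.O1) (fun ω => ω.1.1) g = un (ZMod C.N) g := fun g => (push_m0 (I := Fin (4 ^ n)) (X := C.X) g).symm
    simp only [e] at this
    rw [this]
    exact le_rfl
  have h4 : ∑ g : ZMod C.N, un (ZMod C.N) g * indi (¬ (C.Mr ≤ g.val ∧ g.val + C.Mr + 2 * n < C.N0)) ≤
      ∑ g : ZMod C.N, un (ZMod C.N) g * indi (g.val < C.Mr) +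
      ∑ g : ZMod C.N, un (ZMod C.N) g * indi (C.N ≤ g.val + (C.Mr + 2 * n + (C.N - C.N0))) := by
    rw [← Finset.sum_add_distrib]
    apply Finset.sum_le_sum
    intro g _
    rw [← mul_add]
    apply mul_le_mul_of_nonneg_left _ (un_nonneg g)
    by_cases h1 : g.val < C.Mr
    · rw [indi_pos h1]
      linarith [indi_le_one (¬ (C.Mr ≤ g.val ∧ g.val + C.Mr + 2 * n < C.N0)), indi_nonneg (C.N ≤ g.val + (C.Mr + 2 * n + (C.N - C.N0)))]
    by_cases h2 : g.val + C.Mr + 2 * n < C.N0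
    · rw [indi_neg (not_not.2 ⟨not_lt.1 h1, h2⟩)]
      linarith [indi_nonneg (g.val < C.Mr), indi_nonneg (C.N ≤ g.val + (C.Mr + 2 * n + (C.N - C.N0)))]
    · rw [indi_pos (show C.N ≤ g.val + (C.Mr + 2 * n + (C.N - C.N0)) by omega)]
      linarith [indi_le_one (¬ (C.Mr ≤ g.val ∧ g.val + C.Mr + 2 * n < C.N0)), indi_nonneg (g.val < C.Mr)]
  have h5 := prob_val_lt (N := C.N) C.Mr
  have h6 := prob_val (N := C.N) (C.Mr + 2 * n + (C.N - C.N0))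
  push_cast [Nat.cast_sub hN] at h6
  rw [h2] at h1
  calc C.ew ≤ (C.Mr : ℝ) / C.N + (C.Mr + 2 * n + (C.N - C.N0)) / C.N := by linarith
    _ = _ := by ring

/-- upper half of the entropy chain -/
lemma chain :
    cent (un C.O1) (fun ω => ω.1.2) C.Z + cent C.pp (C.W (2 * n)) (fun ω => ω.1) ≤
      Real.log (2 ^ n) + cent C.pp (C.W n) (fun ω => (C.tc ω.1.1, C.Z ω.1)) +
      cent C.pp (C.W (2 * n)) (fun ω => (C.W n ω, (C.tc ω.1.1, C.Z ω.1))) +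
      cent C.pp (fun ω => ω.1.1.2) (fun ω => (C.W (2 * n) ω, (C.W n ω, (C.tc ω.1.1, C.Z ω.1)))) := by
  have hp0 := C.pp_nonneg
  have hp1 := C.pp_sum
  have e1 : cent (un C.O1) (fun ω => ω.1.2) C.Z = cent C.pp (fun ω => ω.1.1.2) (fun ω => C.Z ω.1) :=
    (cent_map C.pp_fst (fun ω => ω.1.2) C.Z).symm
  have e2 : cent C.pp (C.W (2 * n)) (fun ω => ω.1) ≤ cent C.pp (C.W (2 * n)) (fun ω => (ω.1.1.2, C.Z ω.1)) :=
    cent_anti hp0 hp1 _ (fun ω ω' h => by rw [h])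
  have e3 := cent_chain hp0 (fun ω : C.O2 => ω.1.1.2) (C.W (2 * n)) (fun ω => C.Z ω.1)
  have e4 : cent C.pp (fun ω => (ω.1.1.2, C.W (2 * n) ω)) (fun ω => C.Z ω.1) ≤
      cent C.pp (fun ω => (C.tc ω.1.1, (C.W n ω, (C.W (2 * n) ω, ω.1.1.2)))) (fun ω => C.Z ω.1) :=
    cent_mono hp0 _ (fun ω ω' _ h => by
      have h1 := congrArg (fun z => z.2.2.1) h
      have h2 := congrArg (fun z => z.2.2.2) h
      exact Prod.ext h2 h1)
  have e5 := cent_chain hp0 (fun ω : C.O2 => C.tc ω.1.1) (fun ω => (C.W n ω, (C.W (2 * n) ω, ω.1.1.2))) (fun ω => C.Z ω.1)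
  have e6 := cent_chain hp0 (C.W n) (fun ω => (C.W (2 * n) ω, ω.1.1.2)) (fun ω => (C.tc ω.1.1, C.Z ω.1))
  have e7 := cent_chain hp0 (C.W (2 * n)) (fun ω => ω.1.1.2) (fun ω => (C.W n ω, (C.tc ω.1.1, C.Z ω.1)))
  have e8 : cent C.pp (fun ω => C.tc ω.1.1) (fun ω => C.Z ω.1) ≤ Real.log (2 ^ n) := by
    refine cent_le_log hp0 hp1 _ _ _ (by positivity) (fun z E _ hE => ?_)
    have h1 : ∀ ω ∈ E, C.tc ω.1.1 ∈ Finset.range (2 ^ n) := fun ω _ => by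
      rw [Finset.mem_range]
      unfold tc
      rw [Nat.div_lt_iff_lt_mul (by positivity), ← mul_pow]
      exact ω.1.1.2.isLt
    have h2 := Finset.card_le_card_of_injOn _ h1 hE
    rw [Finset.card_range] at h2
    exact_mod_cast h2
  linarith

lemma lower_lab : cent (un C.O1) (fun ω => ω.1.2)
    (fun ω => (WW S (mm C.r ω.1) (2 * n) (C.ev ω.2), YY S n ω.1.1.val)) - Real.log (labN S v) ≤
    cent (un C.O1) (fun ω => ω.1.2) C.Z := by
  have hC : (0 : ℝ) < (labN S v : ℝ) := Nat.cast_pos.2 (labN_pos S v)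
  have hE : ∀ E : Finset C.O1, Set.InjOn (fun ω : C.O1 => C.lab ω.1) E → (E.card : ℝ) ≤ (labN S v : ℝ) :=
    fun E hE => lab_count C (ι := C.O1) (fun ω : C.O1 => ω.1) E hE
  unfold Z
  exact step_lab (un_nonneg (Ω := C.O1)) un_sum (fun ω => ω.1.2)
    (fun ω => (WW S (mm C.r ω.1) (2 * n) (C.ev ω.2), YY S n ω.1.1.val)) (fun ω => C.lab ω.1) (labN S v : ℝ) hC hE

lemma lower_arith {R h1 L l4 l3 e n1 ph h2 H H2 lb : ℝ} (hR : 0 < R)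
    (s1 : h1 ≤ L + l4 + l3 + e * n1 + R * (l3 + ph + e * L + H))
    (s2 : l4 + H - h2 ≤ H2) {H3 : ℝ} (s3 : H2 - lb ≤ H3) :
    l4 + (h1 - (L + l4 + l3 + e * n1)) / R - l3 - ph - e * L - h2 - lb ≤ H3 := by
  have s5 := sub_le_iff_le_add'.2 s1
  rw [mul_comm R, ← div_le_iff₀ hR] at s5
  linarith

/-- lower bound for the time entropy -/
lemma lower (R : ℕ) (hR : 0 < R) (hn : 0 < n) :
    Real.log ((4:ℝ) ^ n) + (hb S C.ev C.N (2 * n * R) - (Real.log (((4 : ℝ) ^ n + 1) ^ d) + Real.log ((4:ℝ) ^ n) + Real.log 3 +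
      ((2 * n * R : ℕ) : ℝ) / C.N * Real.log (nameN S (2 * n * R)))) / R - Real.log 3 - Real.log (phN S)
      - ((2 * n * R : ℕ) : ℝ) / C.N * Real.log (((4 : ℝ) ^ n + 1) ^ d)
      - hb S C.ev C.N (2 * n) - Real.log (labN S v) ≤
    cent (un C.O1) (fun ω => ω.1.2) C.Z := by
  have hI : (Fintype.card (Fin (4 ^ n)) : ℝ) = 4 ^ n := by simp
  have s1 := step_I S (N := C.N) C.r C.ev n (2 * n) R (by omega)
  have s2 := step_II S (N := C.N) C.r C.ev n (2 * n)
  rw [hI] at s1 s2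
  have s3 := C.lower_lab
  have hR' : (0:ℝ) < R := by exact_mod_cast hR
  exact lower_arith hR' s1 s2 s3

lemma lowerW (n' : ℕ) : n' * (Real.log (Fintype.card C.X) - n' * d * Real.log 2) / C.N ≤ cent C.pp (C.W n') (fun ω => ω.1) :=
  step_IV S C.r C.ev n' C.hev C.hinj

end Cfg
end Part13

section Part14
lemma logK {K β : ℝ} (hK : 1 ≤ K) (n : ℕ) : Real.log (K * (2:ℝ) ^ (β * n)) = Real.log K + β * n * Real.log 2 := by
  rw [Real.log_mul (by positivity) (by positivity), Real.log_rpow (by norm_num)]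

lemma log4 (n : ℕ) : Real.log ((4:ℝ) ^ n) = 2 * n * Real.log 2 := by
  rw [Real.log_pow, show (4:ℝ) = 2 ^ 2 by norm_num, Real.log_pow]; push_cast; ring

lemma arith_eb {e l L η β0 β1 kp kd l3 : ℝ} (hL : 0 < L) (hl : 1 ≤ l) (he : 0 ≤ e) (hη : 0 < η) (hkp : 0 ≤ kp)
    (hb : β0 < β1) (hl3 : 0 ≤ l3) (hkd0 : 0 ≤ kd) (hk : l3 + kp + kd ≤ η * l * L)
    (h : l * (β1 - 2 * η) * L ≤ l3 + (kp + (β1 + η) * l * L) + e * ((kd + β0 * l * L) - (kp + (β1 + η) * l * L)) + η * L) :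
    e * (β1 - β0) ≤ 5 * η := by
  have h1 : e * ((β1 - β0) * l * L) + e * (η * l * L - kd) + e * kp ≤ l3 + kp + 3 * η * l * L + η * L := by
    linarith
  have h2 : 0 ≤ e * (η * l * L - kd) := mul_nonneg he (by linarith)
  have h3 : 0 ≤ e * kp := mul_nonneg he hkp
  have h4 : η * L ≤ η * l * L := by
    have : η * 1 * L ≤ η * l * L := by gcongr
    linarith
  have h5 : (e * (β1 - β0)) * (l * L) ≤ (5 * η) * (l * L) := by linarith
  exact le_of_mul_le_mul_right h5 (by positivity)

lemma arith_main {n L η β1 γ e D hb1 hb2 R A Bn l3 ph lab kb kc k1 e1 w1 w2 w3 H2 HZ : ℝ}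
    (hL : 0 < L) (hn : 1 ≤ n) (hη : 0 < η) (he : 0 ≤ e) (hk1 : 0 ≤ k1) (hR : 1 ≤ R)
    (hlow : 2 * n * L + (hb1 - (A + 2 * n * L + l3 + Bn)) / R - l3 - ph - e1 - hb2 - lab ≤ HZ)
    (hBn : 0 ≤ Bn) (hBn' : Bn ≤ η * L) (he1 : e1 ≤ η * L) (hAR : (A + 2 * n * L + l3) / R ≤ η * n * L)
    (hh : hb2 ≤ hb1 / R + 2 * n * η * L)
    (hH2 : 2 * n * ((β1 - 2 * η) * L) ≤ H2)
    (hch : HZ + H2 ≤ n * L + (l3 + (kb + (β1 + η) * n * L) + w1) + (l3 + (kc + γ * n * L) + w2) +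
      (l3 + k1 + e * (n * L - k1) + w3))
    (hw1 : w1 ≤ η * L) (hw2 : w2 ≤ η * L) (hw3 : w3 ≤ η * L)
    (hc : 4 * l3 + ph + lab + kb + kc + k1 ≤ η * n * L) (heD : e ≤ D) :
    β1 + 1 ≤ γ + 14 * η + D := by
  have h1 : Bn / R ≤ η * L := by
    rw [div_le_iff₀ (by linarith)]
    have : 0 < η * L := by positivity
    nlinarith
  have h2 : (hb1 - (A + 2 * n * L + l3 + Bn)) / R = hb1 / R - (A + 2 * n * L + l3) / R - Bn / R := by ring
  rw [h2] at hlow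
  have h3 : η * L ≤ η * n * L := by
    have : η * 1 * L ≤ η * n * L := by gcongr
    linarith
  have h4 : e * (n * L - k1) ≤ D * (n * L) := by
    have : 0 ≤ e * k1 := mul_nonneg he hk1
    have : e * (n * L) ≤ D * (n * L) := by gcongr
    linarith
  have h5 : (β1 + 1) * (n * L) ≤ (γ + 14 * η + D) * (n * L) := by linarith
  exact le_of_mul_le_mul_right h5 (by positivity)

/-- the final inequality for one configuration -/
lemma fin_ineq {d : ℕ} {S : Sys d} {v : Fin d → ℝ} (hv : Function.Injective v) {k : ℕ} (hk : k + 2 ≤ d)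
    {β0 β1 γ η : ℝ} (hβ0 : 0 ≤ β0) (hβ : β0 < β1) (hγ0 : 0 ≤ γ) (hη : 0 < η)
    (h0 : UB S v k β0) (h1 : UB S v (k + 1) (β1 + η)) (h2 : UB S v (k + 2) γ) :
    ∃ l : ℕ, ∃ n0 : ℕ, ∀ n R : ℕ, ∀ C : Cfg S v (k + 1) n, n0 ≤ n → 0 < R →
      ((Real.log (((4 : ℝ) ^ n + 1) ^ d) + 2 * n * Real.log 2 + Real.log 3) / R ≤ η * n * Real.log 2) →
      (C.ew * Real.log (nameN S l) ≤ η * Real.log 2) → (C.ew * Real.log (nameN S n) ≤ η * Real.log 2) →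
      (C.ew * Real.log (nameN S (2 * n)) ≤ η * Real.log 2) → (C.ew * Real.log ((4 : ℝ) ^ n) ≤ η * Real.log 2) →
      (((2 * n * R : ℕ) : ℝ) / C.N * Real.log (nameN S (2 * n * R)) ≤ η * Real.log 2) →
      (((2 * n * R : ℕ) : ℝ) / C.N * Real.log (((4 : ℝ) ^ n + 1) ^ d) ≤ η * Real.log 2) →
      ((β1 - 2 * η) * Real.log 2 ≤ (Real.log (Fintype.card C.X) - ((2 * n : ℕ) : ℝ) * d * Real.log 2) / C.N) →
      (hb S C.ev C.N (2 * n) ≤ hb S C.ev C.N (2 * n * R) / R + 2 * n * η * Real.log 2) →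
      β1 + 1 ≤ γ + 14 * η + 5 * η / (β1 - β0) := by
  obtain ⟨Kp, hKp, Kd, hKd, Hp⟩ := Cfg.ent_p (β := β1 + η) (by linarith) h1 h0
  obtain ⟨Kb, hKb, Hb⟩ := Cfg.ent_b (β := β1 + η) (by linarith) h1
  obtain ⟨Kc, hKc, Hc⟩ := Cfg.ent_c hγ0 h2
  obtain ⟨Cd, hCd, Hd⟩ := Cfg.ent_d (S := S) hv hk
  have hL : 0 < Real.log 2 := Real.log_pos (by norm_num)
  have hl3 : 0 ≤ Real.log 3 := Real.log_nonneg (by norm_num)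
  obtain ⟨l, hl⟩ := exists_nat_ge ((Real.log 3 + Real.log Kp + Real.log Kd) / (η * Real.log 2) + 1)
  have hl0 : 0 ≤ (Real.log 3 + Real.log Kp + Real.log Kd) / (η * Real.log 2) :=
    div_nonneg (by have := Real.log_nonneg hKp; have := Real.log_nonneg hKd; linarith) (by positivity)
  obtain ⟨n0, hn0⟩ := exists_nat_ge ((4 * Real.log 3 + Real.log (phN S) + Real.log (Cfg.labN S v) + Real.log Kb + Real.log Kc +
    Real.log (3 * Cd * 2 ^ l)) / (η * Real.log 2))
  refine ⟨l, n0 + l + 1, ?_⟩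
  intro n R C hn hR hAR w0 w1 w2 w3 e1 e2 hx hh
  have hn1 : (1 : ℝ) ≤ n := by exact_mod_cast (show 1 ≤ n by omega)
  have hR1 : (1 : ℝ) ≤ R := by exact_mod_cast hR
  have hNpos : (0 : ℝ) < C.N := by exact_mod_cast Nat.pos_of_ne_zero C.hN1.out
  have h2l : (1 : ℝ) ≤ 2 ^ l := one_le_pow₀ (by norm_num)
  have hk1 : 0 ≤ Real.log (3 * Cd * 2 ^ l) := Real.log_nonneg (by
    have := one_le_mul_of_one_le_of_one_le hCd h2l
    linarith)
  have hlw : ∀ n' : ℕ, n' ≤ 2 * n → n' * ((β1 - 2 * η) * Real.log 2) ≤ cent C.pp (C.W n') (fun ω => ω.1) := by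
    intro n' hn'
    refine le_trans ?_ (C.lowerW n')
    rw [mul_div_assoc]
    apply mul_le_mul_of_nonneg_left _ (by positivity)
    refine hx.trans ?_
    have : (n' : ℝ) ≤ ((2 * n : ℕ) : ℝ) := by exact_mod_cast hn'
    gcongr
  have heb : C.eb l * (β1 - β0) ≤ 5 * η := by
    have a1 := hlw l (by omega)
    have a2 := Hp n C l (by omega)
    rw [logK hKp, logK hKd] at a2
    refine arith_eb hL (by linarith : (1:ℝ) ≤ l) (C.eb_nonneg l) hη (Real.log_nonneg hKp) hβ hl3 (Real.log_nonneg hKd) ?_ ?_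
    · have : (Real.log 3 + Real.log Kp + Real.log Kd) / (η * Real.log 2) ≤ l := by linarith
      rw [div_le_iff₀ (by positivity)] at this
      linarith
    · linarith
  have heD : C.eb l ≤ 5 * η / (β1 - β0) := by
    rw [le_div_iff₀ (by linarith)]; exact heb
  have b1 := C.chain
  have b2 := Hb n C
  have b3 := Hc n C
  have b4 := Hd n C l
  rw [logK hKb] at b2
  rw [logK hKc] at b3
  rw [Real.log_pow 2 n] at b4
  rw [Real.log_pow] at b1
  have b5 := C.lower R hR (by omega)
  rw [log4] at b5
  have b6 := hlw (2 * n) le_rfl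
  push_cast at b6
  refine arith_main (kb := Real.log Kb) (kc := Real.log Kc) hL hn1 hη (C.eb_nonneg l) hk1 hR1 b5 ?_ e1 e2 hAR hh b6 ?_ w1 w2 w3 ?_ heD
  · apply mul_nonneg (by positivity)
    apply Real.log_nonneg
    exact_mod_cast nameN_pos S _
  · linarith
  · have : (n0 : ℝ) ≤ n := by exact_mod_cast (show n0 ≤ n by omega)
    have h3 := hn0.trans this
    rw [div_le_iff₀ (by positivity)] at h3
    linarith
end Part14

section Part15
lemma nameN_mono {d : ℕ} (S : Sys d) {a b : ℕ} (h : a ≤ b) : nameN S a ≤ nameN S b := by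
  unfold nameN
  gcongr
  norm_num

lemma log_nameN_nonneg {d : ℕ} (S : Sys d) (a : ℕ) : 0 ≤ Real.log (nameN S a) := by
  apply Real.log_nonneg
  exact_mod_cast nameN_pos S _

lemma log_nameN_mono {d : ℕ} (S : Sys d) {a b : ℕ} (h : a ≤ b) :
    Real.log (nameN S a) ≤ Real.log (nameN S b) := by
  apply Real.log_le_log
  · exact_mod_cast nameN_pos S _
  · exact_mod_cast nameN_mono S h

/-- separation gives injectivity of the names -/
lemma slice_inj {d : ℕ} {S : Sys d} {v : Fin d → ℝ} {k N0 κ0 : ℕ} {E : Finset (Fin d → ℝ)}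
    (h : IsSlice S v k N0 E) (hκ : pm S ≤ 2 ^ κ0) (m : ℕ) (hm : N0 + κ0 ≤ m) :
    Function.Injective (fun x : {x // x ∈ E} => DD S m x.1) := by
  intro x y hxy
  by_contra hne
  obtain ⟨i, hi⟩ := h.2.2 x.1 x.2 y.1 y.2 (fun h => hne (Subtype.ext h))
  have h1 : ⌊qq S m i * x.1 i⌋ = ⌊qq S m i * y.1 i⌋ := congrFun hxy i
  have h2 := Int.abs_sub_lt_one_of_floor_eq_floor h1
  rw [← mul_sub, abs_mul, abs_of_pos (qq_pos S m i)] at h2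
  have h3 := lt_qq S m i
  have h4 := p_le_pm S i
  have h5 : (2:ℝ) ^ N0 * 2 ^ κ0 ≤ 2 ^ m := by
    rw [← pow_add]
    exact pow_le_pow_right₀ (by norm_num) hm
  have hq := qq_pos S m i
  have h6 : (2:ℝ) ^ N0 < qq S m i := by
    have hκp : (0:ℝ) < 2 ^ κ0 := by positivity
    have : (2:ℝ) ^ N0 * 2 ^ κ0 < qq S m i * 2 ^ κ0 := by
      calc (2:ℝ) ^ N0 * 2 ^ κ0 ≤ 2 ^ m := h5
        _ < S.p i * qq S m i := h3
        _ ≤ 2 ^ κ0 * qq S m i := by gcongr; linarith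
        _ = _ := mul_comm _ _
    exact lt_of_mul_lt_mul_right this hκp.le
  have h7 : (1:ℝ) ≤ 2 ^ N0 * |x.1 i - y.1 i| := by
    have : (2:ℝ) ^ N0 * (1/2) ^ N0 = 1 := by rw [← mul_pow]; norm_num
    rw [← this]
    gcongr
  have h8 : (2:ℝ) ^ N0 * |x.1 i - y.1 i| ≤ qq S m i * |x.1 i - y.1 i| := by gcongr
  linarith

/-- long slices with many points -/
lemma big_slice {d : ℕ} {S : Sys d} {v : Fin d → ℝ} {k : ℕ} {α B : ℝ} (hα : 0 ≤ α) (hB : 0 ≤ B)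
    (h1 : UB S v k B) (h2 : ¬ UB S v k α) (M : ℕ) :
    ∃ N0 E, M ≤ N0 ∧ IsSlice S v k N0 E ∧ (2:ℝ) ^ (α * N0) < E.card := by
  obtain ⟨K', hK', H⟩ := h1
  unfold UB at h2
  push Not at h2
  obtain ⟨n, E, hE, hc⟩ := h2 (1 + K' * 2 ^ (B * M)) (by positivity)
  have hp : (1:ℝ) ≤ 2 ^ (α * n) := Real.one_le_rpow (by norm_num) (by positivity)
  have hq : (0:ℝ) < K' * 2 ^ (B * M) := by positivity
  refine ⟨n, E, ?_, hE, ?_⟩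
  · by_contra hlt
    push Not at hlt
    have h3 := H n E hE
    have h4 : (2:ℝ) ^ (B * n) ≤ 2 ^ (B * M) := by
      apply Real.rpow_le_rpow_of_exponent_le (by norm_num)
      gcongr
    have h5 : K' * (2:ℝ) ^ (B * n) ≤ K' * 2 ^ (B * M) := by gcongr
    nlinarith
  · nlinarith

lemma scale_pigeon (f : ℕ → ℝ) (hf : ∀ j, 0 ≤ f j) (R : ℝ) (hR : 0 < R) (c : ℝ) (J : ℕ) (hJ : f 0 < J * c) :
    ∃ j < J, f j ≤ f (j + 1) / R + R ^ j * c := by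
  by_contra hcon
  push Not at hcon
  have : ∀ j ≤ J, f j / R ^ j + j * c ≤ f 0 := by
    intro j
    induction j with
    | zero => intro _; simp
    | succ j ih =>
      intro hj
      refine le_trans ?_ (ih (by omega))
      have := hcon j (by omega)
      have hRj : 0 < R ^ j := by positivity
      have h2 : (f (j + 1) / R + R ^ j * c) / R ^ j ≤ f j / R ^ j := by gcongr
      have h3 : (f (j + 1) / R + R ^ j * c) / R ^ j = f (j + 1) / R ^ (j + 1) + c := by
        field_simp
        try ring
      rw [h3] at h2
      push_cast
      linarith
  have h1 := this J le_rfl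
  have h2 : 0 ≤ f J / R ^ J := div_nonneg (hf _) (by positivity)
  linarith

lemma err_le {x X y Y N t : ℝ} (hN : 0 < N) (hx0 : 0 ≤ x) (hx : x ≤ X) (hy : y ≤ Y) (hY : 0 ≤ Y) (h : X * Y ≤ t * N) :
    x / N * y ≤ t := by
  rw [div_mul_eq_mul_div, div_le_iff₀ hN]
  calc x * y ≤ x * Y := by gcongr
    _ ≤ X * Y := by gcongr
    _ ≤ _ := h

lemma log41 (n d : ℕ) (hn : 1 ≤ n) : Real.log (((4 : ℝ) ^ n + 1) ^ d) ≤ 3 * d * n * Real.log 2 := by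
  rw [Real.log_pow]
  have hL : 0 < Real.log 2 := Real.log_pos (by norm_num)
  have h1 : Real.log ((4 : ℝ) ^ n + 1) ≤ Real.log (2 * 4 ^ n) := by
    apply Real.log_le_log (by positivity)
    have : (1:ℝ) ≤ 4 ^ n := one_le_pow₀ (by norm_num)
    linarith
  rw [Real.log_mul (by norm_num) (by positivity), log4] at h1
  have hn' : (1:ℝ) ≤ n := by exact_mod_cast hn
  have h2 : Real.log 2 ≤ n * Real.log 2 := by nlinarith
  calc (d:ℝ) * Real.log ((4 : ℝ) ^ n + 1) ≤ d * (3 * n * Real.log 2) := by gcongr; linarith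
    _ = _ := by ring
end Part15

section Part16
lemma R_bound {η : ℝ} {d n R : ℕ} (hRη : (3 * d + 4 : ℝ) ≤ η * R) (hR1 : (1:ℝ) ≤ R) (hn : 1 ≤ n) :
    (Real.log (((4 : ℝ) ^ n + 1) ^ d) + 2 * n * Real.log 2 + Real.log 3) / R ≤ η * n * Real.log 2 := by
  have hL : 0 < Real.log 2 := Real.log_pos (by norm_num)
  have hn1 : (1:ℝ) ≤ n := by exact_mod_cast hn
  rw [div_le_iff₀ (by linarith)]
  have e1 := log41 n d hn
  have e2 : Real.log 3 ≤ 2 * n * Real.log 2 := by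
    have h3 : Real.log 3 ≤ Real.log 4 := Real.log_le_log (by norm_num) (by norm_num)
    have e3 := log4 1
    rw [pow_one] at e3
    rw [e3] at h3
    have : 1 * Real.log 2 ≤ n * Real.log 2 := by gcongr
    push_cast at h3
    linarith
  have e3 : (3 * d + 4 : ℝ) * (n * Real.log 2) ≤ η * R * (n * Real.log 2) := by gcongr
  linarith

set_option maxHeartbeats 2000000 in
lemma main_eta {d : ℕ} {S : Sys d} {v : Fin d → ℝ} (hv : Function.Injective v)
    (hkr : ∀ τ κ : ℝ, 0 < κ → ∃ (r : ℤ) (a : Fin d → ℤ),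
      ∀ i, |r * Real.log 2 - a i * Real.log (S.p i) - τ * v i| < κ) {k : ℕ} (hk : k + 2 ≤ d)
    {β0 β1 γ η : ℝ} (hβ0 : 0 ≤ β0) (hβ : β0 < β1) (hγ0 : 0 ≤ γ) (hη : 0 < η) (hηβ : η ≤ β1)
    (h0 : UB S v k β0) (h1 : UB S v (k + 1) (β1 + η)) (h1' : ¬ UB S v (k + 1) (β1 - η)) (h2 : UB S v (k + 2) γ) :
    β1 + 1 ≤ γ + 14 * η + 5 * η / (β1 - β0) := by
  classical
  obtain ⟨l, n0, H⟩ := fin_ineq hv hk hβ0 hβ hγ0 hη h0 h1 h2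
  have hL : 0 < Real.log 2 := Real.log_pos (by norm_num)
  obtain ⟨R, hR⟩ := exists_nat_ge ((3 * d + 4) / η + 1)
  have hR0 : (0:ℝ) ≤ (3 * d + 4) / η := by positivity
  have hR1 : (1:ℝ) ≤ R := by linarith
  have hRη : (3 * d + 4 : ℝ) ≤ η * R := by
    have : (3 * d + 4) / η ≤ R := by linarith
    rw [div_le_iff₀ hη] at this
    linarith
  have hRpos : 0 < R := by
    have : (0:ℝ) < R := by linarith
    exact_mod_cast this
  set n1 := n0 + 1 with hn1
  have hn1pos : (1:ℝ) ≤ n1 := by rw [hn1]; push_cast; linarith [Nat.cast_nonneg (α := ℝ) n0]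
  obtain ⟨J, hJ⟩ := exists_nat_gt (Real.log (nameN S (2 * n1)) / (2 * n1 * η * Real.log 2))
  rw [div_lt_iff₀ (by positivity)] at hJ
  set nm := n1 * R ^ J with hnm
  -- recurrence times
  have hrec : ∀ (n : ℕ) (t : Fin (4 ^ n)), ∃ (r : ℤ) (a : Fin d → ℤ),
      ∀ i, |r * Real.log 2 - a i * Real.log (S.p i) - (t.val : ℝ) / 4 ^ n * v i| < (1 / 4 : ℝ) ^ n :=
    fun n t => hkr _ _ (by positivity)
  choose r a hra using hrec
  set Mr : ℕ := ∑ n ∈ Finset.range (nm + 1), ∑ t : Fin (4 ^ n), (r n t).natAbs with hMr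
  have hMr' : ∀ n ≤ nm, ∀ t : Fin (4 ^ n), |r n t| ≤ Mr := by
    intro n hn t
    have e1 : (r n t).natAbs ≤ ∑ t : Fin (4 ^ n), (r n t).natAbs :=
      Finset.single_le_sum (f := fun t => (r n t).natAbs) (fun _ _ => Nat.zero_le _) (Finset.mem_univ t)
    have e2 : ∑ t : Fin (4 ^ n), (r n t).natAbs ≤ Mr :=
      Finset.single_le_sum (f := fun n => ∑ t : Fin (4 ^ n), (r n t).natAbs) (fun _ _ => Nat.zero_le _)
        (Finset.mem_range.2 (by omega))
    have e3 : (r n t).natAbs ≤ Mr := e1.trans e2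
    rw [Int.abs_eq_natAbs]
    exact_mod_cast e3
  obtain ⟨κ0, hκ0⟩ : ∃ κ0 : ℕ, pm S ≤ 2 ^ κ0 := by
    obtain ⟨κ, h⟩ := pow_unbounded_of_one_lt (pm S) (by norm_num : (1:ℝ) < 2)
    exact ⟨κ, h.le⟩
  set G1 : ℝ := 2 * Mr + 2 * nm + κ0 + 2 * nm * R with hG1
  set G2 : ℝ := Real.log (nameN S (2 * nm * R + l)) + Real.log ((4:ℝ) ^ nm) + Real.log (((4 : ℝ) ^ nm + 1) ^ d) with hG2
  have hg1 := log_nameN_nonneg S (2 * nm * R + l)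
  have hg2 : 0 ≤ Real.log ((4:ℝ) ^ nm) := Real.log_nonneg (one_le_pow₀ (by norm_num))
  have hg3 : 0 ≤ Real.log (((4 : ℝ) ^ nm + 1) ^ d) :=
    Real.log_nonneg (one_le_pow₀ (by have : (0:ℝ) < 4 ^ nm := by positivity
                                     linarith))
  have hG20 : 0 ≤ G2 := by rw [hG2]; linarith
  obtain ⟨M, hM⟩ := exists_nat_ge (G1 * G2 / (η * Real.log 2) + (β1 * κ0 + 2 * nm * d) / η + 1)
  have hM1 : 0 ≤ G1 * G2 / (η * Real.log 2) := by positivity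
  have hβ1 : 0 < β1 := by linarith
  have hM2 : 0 ≤ (β1 * κ0 + 2 * nm * d) / η := by positivity
  obtain ⟨N0, E, hMN, hE, hcard⟩ := big_slice (by linarith : 0 ≤ β1 - η) (by linarith : 0 ≤ β1 + η) h1 h1' M
  have hMN' : (M:ℝ) ≤ N0 := by exact_mod_cast hMN
  have hNpos : 0 < N0 + κ0 := by
    have : (0:ℝ) < N0 := by linarith
    have : 0 < N0 := by exact_mod_cast this
    omega
  have hNZ : NeZero (N0 + κ0) := ⟨by omega⟩
  have hNr : (N0:ℝ) ≤ ((N0 + κ0 : ℕ) : ℝ) := by push_cast; linarith [Nat.cast_nonneg (α := ℝ) κ0]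
  have hGN : G1 * G2 ≤ (η * Real.log 2) * ((N0 + κ0 : ℕ) : ℝ) := by
    have : G1 * G2 / (η * Real.log 2) ≤ ((N0 + κ0 : ℕ) : ℝ) := by linarith
    rw [div_le_iff₀ (by positivity)] at this
    linarith
  have hGN2 : β1 * κ0 + 2 * nm * d ≤ η * ((N0 + κ0 : ℕ) : ℝ) := by
    have : (β1 * κ0 + 2 * nm * d) / η ≤ ((N0 + κ0 : ℕ) : ℝ) := by linarith
    rw [div_le_iff₀ hη] at this
    linarith
  have hNp : (0:ℝ) < ((N0 + κ0 : ℕ) : ℝ) := by exact_mod_cast hNpos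
  have hEpos : (0:ℝ) < E.card := lt_trans (by positivity) hcard
  have hEne : E.Nonempty := Finset.card_pos.1 (by exact_mod_cast hEpos)
  have hEn : Nonempty {x // x ∈ E} := hEne.to_subtype
  obtain ⟨hEA, ⟨b, c, hc, hP⟩, hsep⟩ := id hE
  choose! P hP using hP
  -- scale
  let ev : {x // x ∈ E} → Fin d → ℝ := fun x => x.1
  obtain ⟨j, hj, hjf⟩ := scale_pigeon (fun j => hb S ev (N0 + κ0) (2 * (n1 * R ^ j))) (fun j => hb_nonneg S ev _) R
    (by linarith) (2 * n1 * η * Real.log 2) J (by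
      refine lt_of_le_of_lt (hb_le S ev _) ?_
      simp only [pow_zero, mul_one]
      exact hJ)
  set n := n1 * R ^ j with hn
  have hnle : n ≤ nm := by
    rw [hn, hnm]
    exact Nat.mul_le_mul_left _ (Nat.pow_le_pow_right hRpos hj.le)
  have hnge : n1 ≤ n := Nat.le_mul_of_pos_right _ (by positivity)
  have hnler : (n:ℝ) ≤ nm := by exact_mod_cast hnle
  have hn1' : (1:ℝ) ≤ n := by
    have : 1 ≤ n := by omega
    exact_mod_cast this
  let C : Cfg S v (k + 1) n :=
    { N0 := N0
      N := N0 + κ0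
      hN := by omega
      hN1 := hNZ
      X := {x // x ∈ E}
      fX := inferInstance
      nX := hEn
      ev := ev
      b := b
      c := c
      PX := fun x => P x.1
      hc := hc
      hev := fun x i => hEA x.1 x.2 i
      hsl := fun x i => hP x.1 x.2 i
      hinj := fun m hm => slice_inj hE hκ0 m hm
      r := r n
      a := a n
      hkr := hra n
      Mr := Mr
      hMr := hMr' n hnle }
  have hCN : (C.N : ℝ) = ((N0 + κ0 : ℕ) : ℝ) := rfl
  have hew : C.ew ≤ G1 / ((N0 + κ0 : ℕ) : ℝ) := by
    refine C.ew_le.trans ?_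
    rw [hCN]
    gcongr
    have : (C.N0 : ℝ) = N0 := rfl
    rw [this, hG1]
    have : (C.Mr : ℝ) = Mr := rfl
    rw [this]
    push_cast
    have : (0:ℝ) ≤ 2 * nm * R := by positivity
    linarith
  have hewt : ∀ y : ℝ, 0 ≤ y → y ≤ G2 → C.ew * y ≤ η * Real.log 2 := by
    intro y hy0 hy
    refine le_trans (mul_le_mul_of_nonneg_right hew hy0) ?_
    exact err_le hNp (by positivity) le_rfl hy hG20 hGN
  have hname : ∀ n' ≤ 2 * nm * R + l, Real.log (nameN S n') ≤ G2 := by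
    intro n' hn'
    have := log_nameN_mono S hn'
    rw [hG2]
    linarith
  have hmR : 2 * n ≤ 2 * n * R := Nat.le_mul_of_pos_right _ hRpos
  have hnR : 2 * n * R ≤ 2 * nm * R := Nat.mul_le_mul_right _ (by omega)
  have hd4 : Real.log (((4 : ℝ) ^ n + 1) ^ d) ≤ G2 := by
    have : Real.log (((4 : ℝ) ^ n + 1) ^ d) ≤ Real.log (((4 : ℝ) ^ nm + 1) ^ d) := by
      apply Real.log_le_log (by positivity)
      gcongr
      norm_num
    rw [hG2]; linarith
  have hG1n : ((2 * n * R : ℕ) : ℝ) ≤ G1 := by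
    have : ((2 * n * R : ℕ) : ℝ) ≤ ((2 * nm * R : ℕ) : ℝ) := by exact_mod_cast hnR
    rw [hG1]
    push_cast at this ⊢
    have : (0:ℝ) ≤ 2 * Mr + 2 * nm + κ0 := by positivity
    linarith
  refine H n R C (by omega) hRpos ?_ ?_ ?_ ?_ ?_ ?_ ?_ ?_ ?_
  · exact R_bound hRη hR1 (by omega)
  · exact hewt _ (log_nameN_nonneg S l) (hname l (by omega))
  · exact hewt _ (log_nameN_nonneg S n) (hname n (by omega))
  · exact hewt _ (log_nameN_nonneg S _) (hname _ (by omega))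
  · refine hewt _ (Real.log_nonneg (one_le_pow₀ (by norm_num))) ?_
    have : Real.log ((4 : ℝ) ^ n) ≤ Real.log ((4 : ℝ) ^ nm) := by
      apply Real.log_le_log (by positivity)
      gcongr
      norm_num
    rw [hG2]; linarith
  · rw [hCN]
    exact err_le hNp (by positivity) hG1n (hname _ (by omega)) hG20 hGN
  · rw [hCN]
    exact err_le hNp (by positivity) hG1n hd4 hG20 hGN
  · rw [hCN, le_div_iff₀ hNp]
    have e1 : (Fintype.card C.X : ℝ) = E.card := by
      exact_mod_cast Fintype.card_coe E
    rw [e1]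
    have e2 : (β1 - η) * N0 * Real.log 2 ≤ Real.log E.card := by
      have := Real.log_le_log (by positivity) hcard.le
      rwa [Real.log_rpow (by norm_num)] at this
    have e3 : (2 * n * d : ℝ) ≤ 2 * nm * d := by gcongr
    have e4 : (β1 - 2 * η) * (N0 + κ0) ≤ (β1 - η) * N0 - 2 * n * d := by
      push_cast at hGN2
      have : 0 ≤ η * κ0 := by positivity
      linarith
    have e5 := mul_le_mul_of_nonneg_right e4 hL.le
    push_cast
    linarith
  · have e1 : hb S C.ev C.N (2 * n) ≤ hb S C.ev C.N (2 * (n1 * R ^ (j + 1))) / R + R ^ j * (2 * n1 * η * Real.log 2) := hjf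
    have e2 : 2 * (n1 * R ^ (j + 1)) = 2 * n * R := by rw [hn]; ring
    rw [e2] at e1
    have e3 : (n : ℝ) = n1 * R ^ j := by rw [hn]; push_cast; ring
    have e4 : (R:ℝ) ^ j * (2 * n1 * η * Real.log 2) = 2 * n * η * Real.log 2 := by rw [e3]; ring
    rwa [e4] at e1

lemma main_step {d : ℕ} {S : Sys d} {v : Fin d → ℝ} (hv : Function.Injective v)
    (hkr : ∀ τ κ : ℝ, 0 < κ → ∃ (r : ℤ) (a : Fin d → ℤ),
      ∀ i, |r * Real.log 2 - a i * Real.log (S.p i) - τ * v i| < κ) {k : ℕ} (hk : k + 2 ≤ d)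
    {β0 β1 γ : ℝ} (hβ0 : 0 ≤ β0) (hβ : β0 < β1) (hγ0 : 0 ≤ γ)
    (h0 : UB S v k β0) (h1 : ∀ η > 0, UB S v (k + 1) (β1 + η)) (h1' : ∀ η > 0, ¬ UB S v (k + 1) (β1 - η))
    (h2 : UB S v (k + 2) γ) :
    β1 + 1 ≤ γ := by
  by_contra hcon
  push Not at hcon
  have hb : 0 < β1 - β0 := by linarith
  set D := 14 + 5 / (β1 - β0) with hD
  have hDpos : 0 < D := by positivity
  set η := min β1 ((β1 + 1 - γ) / (2 * D)) with hη
  have hη0 : 0 < η := lt_min (by linarith) (div_pos (by linarith) (by positivity))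
  have := main_eta hv hkr hk hβ0 hβ hγ0 hη0 (min_le_left _ _) h0 (h1 η hη0) (h1' η hη0) h2
  have e1 : 14 * η + 5 * η / (β1 - β0) = D * η := by rw [hD]; ring
  have e2 : η ≤ (β1 + 1 - γ) / (2 * D) := min_le_right _ _
  rw [le_div_iff₀ (by positivity)] at e2
  linarith
end Part16

section Part17
lemma UB.mono {d : ℕ} {S : Sys d} {v : Fin d → ℝ} {k : ℕ} {α β : ℝ} (h : UB S v k α) (hab : α ≤ β) : UB S v k β := by
  obtain ⟨K, hK, H⟩ := h
  refine ⟨K, hK, fun n E hE => (H n E hE).trans ?_⟩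
  have : (2:ℝ) ^ (α * n) ≤ 2 ^ (β * n) := by
    apply Real.rpow_le_rpow_of_exponent_le (by norm_num)
    gcongr
  gcongr

/-- optimal exponent -/
def bk {d : ℕ} (S : Sys d) (v : Fin d → ℝ) (k : ℕ) : ℝ := sInf {β : ℝ | 0 ≤ β ∧ UB S v k β}

lemma bk_bdd {d : ℕ} (S : Sys d) (v : Fin d → ℝ) (k : ℕ) : BddBelow {β : ℝ | 0 ≤ β ∧ UB S v k β} :=
  ⟨0, fun _ h => h.1⟩

lemma bk_nonneg {d : ℕ} (S : Sys d) (v : Fin d → ℝ) (k : ℕ) : 0 ≤ bk S v k :=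
  Real.sInf_nonneg fun _ h => h.1

lemma bk_le {d : ℕ} {S : Sys d} {v : Fin d → ℝ} {k : ℕ} {β : ℝ} (h0 : 0 ≤ β) (h : UB S v k β) : bk S v k ≤ β :=
  csInf_le (bk_bdd S v k) ⟨h0, h⟩

lemma UB_bk {d : ℕ} {S : Sys d} {v : Fin d → ℝ} {k : ℕ} {T : ℝ} (h0 : 0 ≤ T) (h : UB S v k T) {η : ℝ} (hη : 0 < η) :
    UB S v k (bk S v k + η) := by
  obtain ⟨β, hβ, hlt⟩ := exists_lt_of_csInf_lt (s := {β : ℝ | 0 ≤ β ∧ UB S v k β}) ⟨T, h0, h⟩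
    (show bk S v k < bk S v k + η by linarith)
  exact hβ.2.mono hlt.le

lemma not_UB_bk {d : ℕ} {S : Sys d} {v : Fin d → ℝ} {k : ℕ} (hp : 0 < bk S v k) {η : ℝ} (hη : 0 < η) :
    ¬ UB S v k (bk S v k - η) := by
  intro h
  have h1 := h.mono (le_max_left _ 0)
  have h2 := bk_le (le_max_right _ _) h1
  rcases le_max_iff.1 h2 with h3 | h3 <;> linarith

lemma bk_step {d : ℕ} {S : Sys d} {v : Fin d → ℝ} (hv : Function.Injective v)
    (hkr : ∀ τ κ : ℝ, 0 < κ → ∃ (r : ℤ) (a : Fin d → ℤ),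
      ∀ i, |r * Real.log 2 - a i * Real.log (S.p i) - τ * v i| < κ) {T : ℝ} (hT : 0 ≤ T) (hU : ∀ k, UB S v k T)
    {k : ℕ} (hk : k + 2 ≤ d) (hlt : bk S v k < bk S v (k + 1)) :
    bk S v (k + 1) + 1 ≤ bk S v (k + 2) := by
  refine le_of_forall_pos_le_add fun ε hε => ?_
  have h0 := bk_nonneg S v k
  have h2 := bk_nonneg S v (k + 2)
  refine main_step hv hkr hk (β0 := bk S v k + (bk S v (k + 1) - bk S v k) / 2) (by linarith) (by linarith) (by linarith)
    (UB_bk hT (hU k) (by linarith)) (fun η hη => UB_bk hT (hU _) hη) (fun η hη => not_UB_bk (by linarith) hη)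
    (UB_bk hT (hU _) hε)

lemma UB_one {d : ℕ} (hd : 1 ≤ d) {S : Sys d} {v : Fin d → ℝ} (hv : Function.Injective v)
    (hkr : ∀ τ κ : ℝ, 0 < κ → ∃ (r : ℤ) (a : Fin d → ℤ),
      ∀ i, |r * Real.log 2 - a i * Real.log (S.p i) - τ * v i| < κ) {T : ℝ} (hT : 0 ≤ T) (hU : ∀ k, UB S v k T)
    {ε : ℝ} (hε : 0 < ε) : UB S v 1 (max (T - (d - 1)) 0 + ε) := by
  refine (UB_bk hT (hU 1) hε).mono ?_
  suffices bk S v 1 ≤ max (T - (d - 1)) 0 by linarith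
  by_cases hp : 0 < bk S v 1
  · have hb0 : bk S v 0 ≤ 0 := bk_le le_rfl (UB_zero S v)
    have : ∀ k : ℕ, k + 1 ≤ d → bk S v 1 + k ≤ bk S v (k + 1) ∧ bk S v k < bk S v (k + 1) := by
      intro k
      induction k with
      | zero => intro _; exact ⟨by simp, by simpa using lt_of_le_of_lt hb0 hp⟩
      | succ k ih =>
        intro hk
        obtain ⟨i1, i2⟩ := ih (by omega)
        have := bk_step hv hkr hT hU (k := k) (by omega) i2
        refine ⟨?_, ?_⟩
        · push_cast
          rw [show k + 1 + 1 = k + 2 from rfl]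
          linarith
        · rw [show k + 1 + 1 = k + 2 from rfl]
          linarith
    have h1 := (this (d - 1) (by omega)).1
    rw [Nat.sub_add_cancel hd, Nat.cast_sub hd] at h1
    have h2 := bk_le hT (hU d)
    push_cast at h1
    exact le_max_of_le_left (by linarith)
  · exact le_max_of_le_right (not_lt.1 hp)

/-- counting bound from slices -/
lemma count_bound {d : ℕ} (hd : 1 ≤ d) {S : Sys d} {v : Fin d → ℝ} {β : ℝ} (hβ : 0 ≤ β) (hU : UB S v 1 β)
    (K : ℝ) (hK : 1 ≤ K) :
    ∃ C : ℝ, 1 ≤ C ∧ ∀ g : Fin d → ℝ × ℝ, (∀ j, |(g j).1| ≤ K) → ∀ δ : ℝ, 0 < δ → δ ≤ 1 → ∀ F : Finset ℝ,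
      ↑F ⊆ ⋂ j, (fun x => (g j).1 * x + (g j).2) '' S.A j →
      (∀ a ∈ F, ∀ b ∈ F, a ≠ b → δ ≤ dist a b) → (F.card : ℝ) ≤ C * δ ^ (-β) := by
  classical
  obtain ⟨Kc, hKc, H⟩ := magnify S v 1 1 le_rfl
  obtain ⟨K0, hK0, H0⟩ := hU
  refine ⟨1 + Kc * K0 * (2 * K) ^ β, by have : 0 < Kc * K0 * (2 * K) ^ β := by positivity
                                        linarith, ?_⟩
  intro g hg δ hδ hδ1 F hF hsep
  have hCp : 0 < Kc * K0 * (2 * K) ^ β := by positivity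
  have hδβ : 1 ≤ δ ^ (-β) := Real.one_le_rpow_of_pos_of_le_one_of_nonpos hδ hδ1 (by linarith)
  have hmem : ∀ t ∈ F, ∀ j, ∃ x ∈ S.A j, (g j).1 * x + (g j).2 = t := by
    intro t ht j
    have := mem_iInter.1 (hF (Finset.mem_coe.2 ht)) j
    exact this
  have triv : F.card ≤ 1 → (F.card : ℝ) ≤ (1 + Kc * K0 * (2 * K) ^ β) * δ ^ (-β) := by
    intro h
    have h' : (F.card : ℝ) ≤ 1 := by exact_mod_cast h
    nlinarith
  by_cases hz : ∃ j, (g j).1 = 0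
  · obtain ⟨j, hj⟩ := hz
    apply triv
    rw [Finset.card_le_one]
    intro s hs t ht
    obtain ⟨x, _, hx⟩ := hmem s hs j
    obtain ⟨y, _, hy⟩ := hmem t ht j
    rw [hj] at hx hy
    linarith
  push Not at hz
  rcases F.eq_empty_or_nonempty with rfl | ⟨t0, ht0⟩
  · exact triv (by simp)
  have : Nonempty (Fin d) := ⟨⟨0, by omega⟩⟩
  obtain ⟨i0, hi0⟩ := Finite.exists_min (fun i => |(g i).1|)
  set α := |(g i0).1| with hα
  have hα0 : 0 < α := abs_pos.2 (hz i0)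
  obtain ⟨m, hm1, hm2⟩ := exists_nat_pow_near (x := K / δ) (y := (2:ℝ)) (by rw [le_div_iff₀ hδ]; linarith) (by norm_num)
  let ξ : ℝ → Fin d → ℝ := fun t i => (t - (g i).2) / (g i).1
  have hξA : ∀ t ∈ F, ∀ i, ξ t i ∈ S.A i := by
    intro t ht i
    obtain ⟨x, hx, hxt⟩ := hmem t ht i
    have : ξ t i = x := by
      simp only [ξ]
      rw [div_eq_iff (hz i)]; linarith
    rwa [this]
  have hξd : ∀ s t i, ξ s i - ξ t i = (s - t) / (g i).1 := by
    intro s t i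
    simp only [ξ]
    rw [← sub_div]; congr 1; ring
  have hinj : Function.Injective ξ := by
    intro s t h
    have h1 := hξd s t i0
    rw [h, sub_self, eq_comm, div_eq_zero_iff] at h1
    rcases h1 with h1 | h1
    · linarith
    · exact absurd h1 (hz i0)
  have hdist : ∀ t ∈ F, |t - t0| ≤ α := by
    intro t ht
    have h1 := S.hA _ (hξA t ht i0)
    have h2 := S.hA _ (hξA t0 ht0 i0)
    have h3 : |ξ t i0 - ξ t0 i0| ≤ 1 := by
      rw [abs_le]; constructor <;> linarith [h1.1, h1.2, h2.1, h2.2]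
    rw [hξd, abs_div, div_le_one hα0] at h3
    exact h3
  have key : ∃ E', IsSlice S v 1 (m + 1) E' ∧ ((F.image ξ).card : ℝ) ≤ Kc * E'.card := by
    refine H (m + 1) (F.image ξ) (ξ t0) (fun i => - (g i).2 / (g i).1) (fun i => α / (g i).1) ?_ ?_ ?_ ?_ ?_
    · intro x hx i
      obtain ⟨t, ht, rfl⟩ := Finset.mem_image.1 hx
      exact hξA t ht i
    · intro i
      have hp : 0 < |(g i).1| := abs_pos.2 (hz i)
      rw [abs_div, abs_of_pos hα0]
      exact ⟨by positivity, (div_le_one hp).2 (hi0 i)⟩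
    · intro x hx i
      obtain ⟨t, ht, rfl⟩ := Finset.mem_image.1 hx
      rw [hξd, one_mul, abs_div, abs_div, abs_of_pos hα0]
      gcongr
      exact hdist t ht
    · intro x hx
      obtain ⟨t, ht, rfl⟩ := Finset.mem_image.1 hx
      refine ⟨fun _ => t / α, fun i => ?_⟩
      have : ξ t i - -(g i).2 / (g i).1 - α / (g i).1 * pe v (fun _ : Fin 1 => t / α) i = 0 := by
        have := hz i
        simp only [pe, ξ]
        simp
        field_simp
        ring
      rw [this, abs_zero]
      positivity
    · intro x hx y hy hxy
      obtain ⟨s, hs, rfl⟩ := Finset.mem_image.1 hx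
      obtain ⟨t, ht, rfl⟩ := Finset.mem_image.1 hy
      refine ⟨i0, ?_⟩
      have h1 := hsep s hs t ht (fun h => hxy (by rw [h]))
      rw [Real.dist_eq] at h1
      rw [hξd, one_mul, abs_div, abs_div, abs_of_pos hα0, div_mul_eq_mul_div]
      gcongr
      refine le_trans ?_ h1
      have h2 : α ≤ K := hg i0
      rw [div_lt_iff₀ hδ] at hm2
      rw [one_div, inv_pow, ← div_eq_mul_inv, div_le_iff₀ (by positivity)]
      linarith
  obtain ⟨E', hE', hcard⟩ := key
  rw [Finset.card_image_of_injective _ hinj] at hcard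
  have h1 := H0 _ _ hE'
  have h2 : (2:ℝ) ^ (β * (m + 1 : ℕ)) ≤ (2 * K) ^ β * δ ^ (-β) := by
    rw [mul_comm β, Real.rpow_mul (by norm_num), Real.rpow_natCast, Real.rpow_neg hδ.le, ← div_eq_mul_inv,
      ← Real.div_rpow (by positivity) hδ.le]
    apply Real.rpow_le_rpow (by positivity) _ hβ
    rw [pow_succ, mul_div_assoc]
    linarith
  calc (F.card : ℝ) ≤ Kc * E'.card := hcard
    _ ≤ Kc * (K0 * (2:ℝ) ^ (β * (m + 1 : ℕ))) := by gcongr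
    _ ≤ Kc * (K0 * ((2 * K) ^ β * δ ^ (-β))) := by gcongr
    _ = (Kc * K0 * (2 * K) ^ β) * δ ^ (-β) := by ring
    _ ≤ _ := by gcongr; linarith
end Part17

section Part18
lemma haus_zero (A A' : Set ℝ) (hA' : A' ⊆ A ∪ {1}) (s : ℝ) (hs : (dimH A).toReal < s) :
    Measure.hausdorffMeasure s A' = 0 := by
  have h1 : dimH A ≤ 1 := by
    rw [← Real.dimH_univ]
    exact dimH_mono (subset_univ A)
  have hne : dimH A ≠ ⊤ := ne_top_of_le_ne_top (by norm_num) h1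
  have hs0 : 0 ≤ s := ENNReal.toReal_nonneg.trans hs.le
  have h2 : dimH A' < (s.toNNReal : ℝ≥0∞) := by
    refine lt_of_le_of_lt (dimH_mono hA') ?_
    rw [dimH_union, dimH_singleton, max_eq_left zero_le]
    rw [← ENNReal.ofReal_toReal hne]
    exact (ENNReal.ofReal_lt_ofReal_iff (lt_of_le_of_lt ENNReal.toReal_nonneg hs)).2 hs
  have := hausdorffMeasure_of_dimH_lt h2
  rwa [Real.coe_toNNReal _ hs0] at this

/-- the system attached to the invariant sets -/
lemma sys_exists (d : ℕ)
    (p : Fin d → ℕ) (hp : ∀ j, 2 ≤ p j)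
    (B : Fin d → Set (AddCircle (1 : ℝ)))
    (hBclosed : ∀ j, IsClosed (B j))
    (hBinv : ∀ j, (fun x => (p j) • x) '' B j ⊆ B j)
    (A : Fin d → Set ℝ)
    (hA : ∀ j, A j = {t : ℝ | t ∈ Set.Ico (0 : ℝ) 1 ∧ (↑t : AddCircle (1 : ℝ)) ∈ B j}) :
    ∃ S : Sys d, S.p = p ∧ S.A = A ∧ ∀ v : Fin d → ℝ, ∀ ε > 0, ∀ k, UB S v k (∑ j, (dimH (A j)).toReal + ε) := by
  have hsub : ∀ j, A j ⊆ Set.Ico 0 1 := fun j t ht => by rw [hA j] at ht; exact ht.1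
  have hinv : ∀ j, ∀ x ∈ A j, Int.fract ((p j : ℝ) * x) ∈ A j := by
    intro j x hx
    rw [hA j] at hx ⊢
    refine ⟨⟨Int.fract_nonneg _, Int.fract_lt_one _⟩, ?_⟩
    have h1 : ((Int.fract ((p j : ℝ) * x) : ℝ) : AddCircle (1 : ℝ)) = (p j) • (x : AddCircle (1 : ℝ)) := by
      rw [← AddCircle.coe_nsmul, nsmul_eq_mul, ← sub_eq_zero, ← AddCircle.coe_sub, AddCircle.coe_eq_zero_iff]
      refine ⟨-⌊(p j : ℝ) * x⌋, ?_⟩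
      have := Int.fract_add_floor ((p j : ℝ) * x)
      simp only [zsmul_eq_mul, mul_one]
      push_cast
      linarith
    rw [h1]
    exact hBinv j ⟨_, hx.2, rfl⟩
  let S : Sys d := { p := p, hp := hp, A := A, hA := hsub, hinv := hinv }
  refine ⟨S, rfl, rfl, ?_⟩
  intro v ε hε k
  have hb : ∀ j, BoxB (S.p j) (S.A j) ((dimH (A j)).toReal + ε / (d + 1)) := by
    intro j
    have hε' : 0 < ε / (d + 1) := by positivity
    have hpos : 0 < (dimH (A j)).toReal + ε / (d + 1) := by
      have : 0 ≤ (dimH (A j)).toReal := ENNReal.toReal_nonneg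
      linarith
    refine box_haus (p j) (hp j) (A j) {t : ℝ | t ∈ Set.Icc (0 : ℝ) 1 ∧ (↑t : AddCircle (1 : ℝ)) ∈ B j} (hsub j) ?_ ?_
      (fun l x hx => S.hpow j l x hx) _ hpos (haus_zero (A j) _ ?_ _ (by linarith))
    · intro t ht
      rw [hA j] at ht
      exact ⟨⟨ht.1.1, ht.1.2.le⟩, ht.2⟩
    · refine IsCompact.inter_right isCompact_Icc ((hBclosed j).preimage (AddCircle.continuous_mk' 1))
    · rintro t ⟨ht, htB⟩
      rcases eq_or_lt_of_le ht.2 with h | h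
      · right; exact h
      · left; rw [hA j]; exact ⟨⟨ht.1, h⟩, htB⟩
  refine (UB_top S v k _ (fun j => by positivity) hb).mono ?_
  rw [Finset.sum_add_distrib, Finset.sum_const, Finset.card_univ, Fintype.card_fin, nsmul_eq_mul]
  have : (d:ℝ) * (ε / (d + 1)) ≤ ε := by
    rw [← mul_div_assoc, div_le_iff₀ (by positivity)]
    nlinarith
  linarith

lemma limsup_bound (P : ℝ → ℕ) (s C : ℝ) (hC : 1 ≤ C) (h : ∀ δ : ℝ, 0 < δ → δ ≤ 1 → (P δ : ℝ) ≤ C * δ ^ (-s))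
    (hs : 0 ≤ s) (ε : ℝ) (hε : 0 < ε) :
    Filter.limsup (fun δ : ℝ => Real.log (P δ) / Real.log (1 / δ)) (nhdsWithin 0 (Set.Ioi 0)) ≤ s + ε := by
  have hlt : ∀ᶠ δ : ℝ in nhdsWithin 0 (Set.Ioi 0), 0 < δ ∧ δ < 1 ∧ δ < Real.exp (-(Real.log C / ε)) := by
    filter_upwards [self_mem_nhdsWithin, nhdsWithin_le_nhds (Iio_mem_nhds (show (0:ℝ) < 1 by norm_num)),
      nhdsWithin_le_nhds (Iio_mem_nhds (Real.exp_pos (-(Real.log C / ε))))] with δ h1 h2 h3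
    exact ⟨h1, h2, h3⟩
  apply Filter.limsup_le_of_le
  · refine Filter.isCoboundedUnder_le_of_eventually_le (x := 0) (nhdsWithin 0 (Set.Ioi 0)) ?_
    filter_upwards [hlt] with δ hδ
    apply div_nonneg (Real.log_natCast_nonneg _)
    apply Real.log_nonneg
    rw [le_div_iff₀ hδ.1]
    linarith
  · filter_upwards [hlt] with δ hδ
    obtain ⟨h1, h2, h3⟩ := hδ
    have hl : Real.log (1 / δ) = - Real.log δ := by rw [one_div, Real.log_inv]
    have hneg : Real.log δ < 0 := Real.log_neg h1 h2
    have h4 : Real.log δ < -(Real.log C / ε) := (Real.log_lt_iff_lt_exp h1).2 h3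
    have h5 : Real.log C ≤ ε * (-Real.log δ) := by
      have : Real.log C / ε ≤ - Real.log δ := by linarith
      rw [div_le_iff₀ hε] at this
      linarith
    rw [hl, div_le_iff₀ (by linarith)]
    rcases Nat.eq_zero_or_pos (P δ) with h0 | h0
    · rw [h0]
      simp only [Nat.cast_zero, Real.log_zero]
      nlinarith
    · have h6 := Real.log_le_log (by exact_mod_cast h0) (h δ h1 h2.le)
      rw [Real.log_mul (by linarith) (by positivity), Real.log_rpow h1] at h6
      linarith
end Part18

end Furst

/-- Corollary 1.6: higher-rank Furstenberg slicing for intersections of affine images of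
`×p_j`-invariant sets. An affine map `g(x) = a·x + b` is encoded by the pair `(a, b)`. -/
theorem furstenberg_intersections (d : ℕ) (hd : 1 ≤ d)
    (p : Fin d → ℕ) (hp : ∀ j, 2 ≤ p j)
    (hindep : ∀ i j, i ≠ j → Irrational (Real.log (p i) / Real.log (p j)))
    (B : Fin d → Set (AddCircle (1 : ℝ)))
    (hBclosed : ∀ j, IsClosed (B j))
    (hBinv : ∀ j, (fun x => (p j) • x) '' B j ⊆ B j)
    (A : Fin d → Set ℝ)
    (hA : ∀ j, A j = {t : ℝ | t ∈ Set.Ico (0 : ℝ) 1 ∧ (↑t : AddCircle (1 : ℝ)) ∈ B j}) :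
    (∀ g : Fin d → ℝ × ℝ,
      ubdim (⋂ j, (fun x => (g j).1 * x + (g j).2) '' A j) ≤
        max (∑ j, (dimH (A j)).toReal - ((d : ℝ) - 1)) 0) ∧
    (∀ ε : ℝ, 0 < ε → ∀ K : ℝ, 1 ≤ K →
      ∃ C : ℝ, 0 < C ∧
        ∀ g : Fin d → ℝ × ℝ, (∀ j, |(g j).1| ≤ K) →
          ∀ δ : ℝ, 0 < δ → δ ≤ 1 →
            ∀ F : Finset ℝ,
              ↑F ⊆ ⋂ j, (fun x => (g j).1 * x + (g j).2) '' A j →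
              IsDeltaSep F δ →
              (F.card : ℝ) ≤
                C * δ ^ (-(max (∑ j, (dimH (A j)).toReal - ((d : ℝ) - 1)) 0) - ε)) := by
  obtain ⟨v, hv, hkr⟩ := Furst.kron p hp hindep
  obtain ⟨S, hSp, hSA, hU⟩ := Furst.sys_exists d p hp B hBclosed hBinv A hA
  have hkr' : ∀ τ κ : ℝ, 0 < κ → ∃ (r : ℤ) (a : Fin d → ℤ),
      ∀ i, |r * Real.log 2 - a i * Real.log (S.p i) - τ * v i| < κ := by
    rw [hSp]; exact hkr
  have hs0 : 0 ≤ ∑ j, (dimH (A j)).toReal := Finset.sum_nonneg fun j _ => ENNReal.toReal_nonneg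
  have hm0 : 0 ≤ max (∑ j, (dimH (A j)).toReal - ((d : ℝ) - 1)) 0 := le_max_right _ _
  have hone : ∀ ε : ℝ, 0 < ε → Furst.UB S v 1 (max (∑ j, (dimH (A j)).toReal - ((d : ℝ) - 1)) 0 + ε) := by
    intro ε hε
    refine (Furst.UB_one hd hv hkr' (T := ∑ j, (dimH (A j)).toReal + ε / 2) (by linarith)
      (fun k => hU v (ε / 2) (by linarith) k) (ε := ε / 2) (by linarith)).mono ?_
    have : max (∑ j, (dimH (A j)).toReal + ε / 2 - ((d : ℝ) - 1)) 0 ≤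
        max (∑ j, (dimH (A j)).toReal - ((d : ℝ) - 1)) 0 + ε / 2 := by
      apply max_le
      · have := le_max_left (∑ j, (dimH (A j)).toReal - ((d : ℝ) - 1)) 0
        linarith
      · linarith
    linarith
  have hcb := fun (ε : ℝ) (hε : 0 < ε) (K : ℝ) (hK : 1 ≤ K) =>
    Furst.count_bound hd (by linarith) (hone ε hε) K hK
  rw [hSA] at hcb
  constructor
  · intro g
    refine le_of_forall_pos_le_add fun ε hε => ?_
    obtain ⟨C, hC, H⟩ := hcb (ε / 2) (by linarith) (1 + ∑ j, |(g j).1|)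
      (by have : 0 ≤ ∑ j, |(g j).1| := Finset.sum_nonneg fun j _ => abs_nonneg _
          linarith)
    have hg : ∀ j, |(g j).1| ≤ 1 + ∑ j, |(g j).1| := by
      intro j
      have := Finset.single_le_sum (f := fun j => |(g j).1|) (fun j _ => abs_nonneg _) (Finset.mem_univ j)
      linarith
    have := Furst.limsup_bound (fun δ => packingNumber (⋂ j, (fun x => (g j).1 * x + (g j).2) '' A j) δ)
      (max (∑ j, (dimH (A j)).toReal - ((d : ℝ) - 1)) 0 + ε / 2) C hC (by
        intro δ hδ hδ1
        have hb : ∀ n ∈ {n : ℕ | ∃ F : Finset ℝ, ↑F ⊆ (⋂ j, (fun x => (g j).1 * x + (g j).2) '' A j) ∧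
            IsDeltaSep F δ ∧ F.card = n},
            n ≤ ⌊C * δ ^ (-(max (∑ j, (dimH (A j)).toReal - ((d : ℝ) - 1)) 0 + ε / 2))⌋₊ := by
          rintro n ⟨F, hF, hsep, rfl⟩
          exact Nat.le_floor (H g hg δ hδ hδ1 F hF hsep)
        have hne : {n : ℕ | ∃ F : Finset ℝ, ↑F ⊆ (⋂ j, (fun x => (g j).1 * x + (g j).2) '' A j) ∧
            IsDeltaSep F δ ∧ F.card = n}.Nonempty :=
          ⟨0, ∅, by simp, by intro a ha; simp at ha, by simp⟩
        have h1 := csSup_le hne hb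
        refine le_trans (Nat.cast_le.2 h1) (Nat.floor_le (by positivity))) (by linarith) (ε / 2) (by linarith)
    refine le_trans this ?_
    linarith
  · intro ε hε K hK
    obtain ⟨C, hC, H⟩ := hcb ε hε K hK
    refine ⟨C, by linarith, ?_⟩
    intro g hg δ hδ hδ1 F hF hsep
    have := H g hg δ hδ hδ1 F hF hsep
    rwa [neg_add] at this


end
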